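/- arXiv:2408.16765 — 3 statements merged into one kernel-verified Lean document; each statement's English description precedes it below -/
import Mathlib

section
/- Let 0 < t₁ < t₂ < 1. Then for ρ₀-almost every x₀ ∈ ℝ^d, the conditional expectation E[log ρ_{t₂}(X_{t₂}) − log ρ_{t₁}(X_{t₁}) | X₀ = x₀] equals the integral over t ∈ [t₁, t₂] of ( (1/(2(1−t))) · E[ ‖(X_t − √(1−t) X₀)/t + ∇log ρ_t(X_t)‖₂² | X₀ = x₀ ] − d/(2t) ) dt. -/
open MeasureTheory Real Filter
open scoped ENNReal

noncomputable section

/-- Density at `x` of the Gaussian distribution `N(√(1-t)·x₀, t·I_d)`, i.e. the transition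
density of `X_t = √(1-t)·X₀ + √t·Z` given `X₀ = x₀`. -/
def heatKernel (d : ℕ) (t : ℝ) (x x₀ : EuclideanSpace ℝ (Fin d)) : ℝ :=
  (2 * π * t) ^ (-(d : ℝ) / 2) * Real.exp (-‖x - Real.sqrt (1 - t) • x₀‖ ^ 2 / (2 * t))

/-- The density `ρ_t` of `X_t = √(1-t)·X₀ + √t·Z` where `X₀ ∼ μ` and `Z ∼ N(0, I_d)`
is independent of `X₀`. -/
def rho (d : ℕ) (μ : Measure (EuclideanSpace ℝ (Fin d))) (t : ℝ)
    (x : EuclideanSpace ℝ (Fin d)) : ℝ :=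
  ∫ x₀, heatKernel d t x x₀ ∂μ

/-- Density of the standard Gaussian `N(0, I_d)` on `ℝ^d`. -/
def stdGaussianDensity (d : ℕ) (z : EuclideanSpace ℝ (Fin d)) : ℝ :=
  (2 * π) ^ (-(d : ℝ) / 2) * Real.exp (-‖z‖ ^ 2 / 2)

/-- Conditional expectation `E[f(X_t) | X₀ = x₀] = E_{Z ∼ N(0,I_d)}[f(√(1-t)·x₀ + √t·Z)]`. -/
def condExpX0 (d : ℕ) (t : ℝ) (x₀ : EuclideanSpace ℝ (Fin d))
    (f : EuclideanSpace ℝ (Fin d) → ℝ) : ℝ :=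
  ∫ z, f (Real.sqrt (1 - t) • x₀ + Real.sqrt t • z) * stdGaussianDensity d z

/-- the exponential tilt -/
def sbE {d : ℕ} (a : ℝ) (w z : EuclideanSpace ℝ (Fin d)) : ℝ :=
  Real.exp (-(a ^ 2 * ‖w‖ ^ 2) / 2 - a * inner ℝ w z)

/-- tilted integrals -/
def sbJ {d : ℕ} (ν : Measure (EuclideanSpace ℝ (Fin d))) (p : EuclideanSpace ℝ (Fin d) → ℝ)
    (a : ℝ) (z : EuclideanSpace ℝ (Fin d)) : ℝ :=
  ∫ w, p w * sbE a w z ∂ν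

/-- growth class -/
def SbG {d : ℕ} (p : EuclideanSpace ℝ (Fin d) → ℝ) : Prop :=
  Continuous p ∧ ∃ C, 0 ≤ C ∧ ∀ w, |p w| ≤ C * Real.exp (2 * ‖w‖)

lemma sbE_pos {d : ℕ} (a : ℝ) (w z : EuclideanSpace ℝ (Fin d)) : 0 < sbE a w z :=
  Real.exp_pos _

lemma sbE_cont {d : ℕ} (a : ℝ) (z : EuclideanSpace ℝ (Fin d)) :
    Continuous (fun w => sbE a w z) := by
  unfold sbE; fun_prop

lemma sb_quad (a c x R : ℝ) (ha : 0 < a) :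
    c * x + (-(a ^ 2 * x ^ 2) / 2 + a * x * R) ≤ (c + a * R) ^ 2 / (2 * a ^ 2) := by
  rw [le_div_iff₀ (by positivity)]
  nlinarith [sq_nonneg (a ^ 2 * x - (c + a * R))]

lemma sbE_bound {d : ℕ} (a c R : ℝ) (ha : 0 < a) (w z : EuclideanSpace ℝ (Fin d))
    (hz : ‖z‖ ≤ R) :
    Real.exp (c * ‖w‖) * sbE a w z ≤ Real.exp ((c + a * R) ^ 2 / (2 * a ^ 2)) := by
  unfold sbE
  rw [← Real.exp_add]
  apply Real.exp_le_exp.mpr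
  refine le_trans ?_ (sb_quad a c ‖w‖ R ha)
  have h1 : -(inner ℝ w z) ≤ ‖w‖ * R :=
    (neg_le_abs _).trans ((abs_real_inner_le_norm w z).trans
      (mul_le_mul_of_nonneg_left hz (norm_nonneg _)))
  nlinarith

lemma sb_le_exp {d : ℕ} (w : EuclideanSpace ℝ (Fin d)) : ‖w‖ ≤ Real.exp ‖w‖ := by
  linarith [Real.add_one_le_exp ‖w‖]

lemma sb_sq_le_exp {d : ℕ} (w : EuclideanSpace ℝ (Fin d)) : ‖w‖ ^ 2 ≤ Real.exp (2 * ‖w‖) := by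
  rw [two_mul, Real.exp_add, sq]
  exact mul_le_mul (sb_le_exp w) (sb_le_exp w) (norm_nonneg _) (Real.exp_pos _).le

lemma sb_one_le_exp {d : ℕ} (w : EuclideanSpace ℝ (Fin d)) : 1 ≤ Real.exp (2 * ‖w‖) :=
  Real.one_le_exp (by positivity)

lemma sb_le_exp2 {d : ℕ} (w : EuclideanSpace ℝ (Fin d)) : ‖w‖ ≤ Real.exp (2 * ‖w‖) :=
  (sb_le_exp w).trans (Real.exp_le_exp.mpr (by linarith [norm_nonneg w]))

lemma sbG_one {d : ℕ} : SbG (fun _ : EuclideanSpace ℝ (Fin d) => (1 : ℝ)) :=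
  ⟨continuous_const, 1, zero_le_one, fun w => by simp⟩

lemma sb_coord {d : ℕ} (w : EuclideanSpace ℝ (Fin d)) (i : Fin d) : |w i| ≤ ‖w‖ := by
  simpa using PiLp.norm_apply_le w i

lemma sbG_coord {d : ℕ} (i : Fin d) : SbG (fun w : EuclideanSpace ℝ (Fin d) => w i) :=
  ⟨by fun_prop, 1, zero_le_one, fun w => by
    simpa using (sb_coord w i).trans (sb_le_exp2 w)⟩

lemma sbG_coord_sq {d : ℕ} (i : Fin d) : SbG (fun w : EuclideanSpace ℝ (Fin d) => w i * w i) :=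
  ⟨by fun_prop, 1, zero_le_one, fun w => by
    rw [one_mul, abs_mul, ← sq]
    exact (pow_le_pow_left₀ (abs_nonneg _) (sb_coord w i) 2).trans (sb_sq_le_exp w)⟩

lemma sbG_norm_sq {d : ℕ} : SbG (fun w : EuclideanSpace ℝ (Fin d) => ‖w‖ ^ 2) :=
  ⟨by fun_prop, 1, zero_le_one, fun w => by
    rw [one_mul, abs_of_nonneg (by positivity)]
    exact sb_sq_le_exp w⟩

lemma sbJ_integrable {d : ℕ} (ν : Measure (EuclideanSpace ℝ (Fin d))) [IsProbabilityMeasure ν]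
    (p : EuclideanSpace ℝ (Fin d) → ℝ) (hp : SbG p) (a : ℝ) (ha : 0 < a)
    (z : EuclideanSpace ℝ (Fin d)) : Integrable (fun w => p w * sbE a w z) ν := by
  obtain ⟨hc, C, hC, hb⟩ := hp
  refine Integrable.of_bound (C := C * Real.exp ((2 + a * ‖z‖) ^ 2 / (2 * a ^ 2)))
    (hc.mul (sbE_cont a z)).aestronglyMeasurable (ae_of_all _ fun w => ?_)
  rw [norm_mul, Real.norm_eq_abs, Real.norm_eq_abs, abs_of_pos (sbE_pos a w z)]
  calc |p w| * sbE a w z ≤ (C * Real.exp (2 * ‖w‖)) * sbE a w z :=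
        mul_le_mul_of_nonneg_right (hb w) (sbE_pos _ _ _).le
    _ = C * (Real.exp (2 * ‖w‖) * sbE a w z) := by ring
    _ ≤ _ := mul_le_mul_of_nonneg_left (sbE_bound a 2 ‖z‖ ha w z le_rfl) hC

lemma sbJ_hasFDerivAt {d : ℕ} (ν : Measure (EuclideanSpace ℝ (Fin d))) [IsProbabilityMeasure ν]
    (p : EuclideanSpace ℝ (Fin d) → ℝ) (hp : SbG p) (a : ℝ) (ha : 0 < a)
    (z : EuclideanSpace ℝ (Fin d)) :
    ∃ L : EuclideanSpace ℝ (Fin d) →L[ℝ] ℝ, HasFDerivAt (sbJ ν p a) L z ∧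
      ∀ i, L (EuclideanSpace.single i 1) = -a * sbJ ν (fun w => p w * w i) a z := by
  obtain ⟨hc, C, hC, hb⟩ := id hp
  have hcont : ∀ z : EuclideanSpace ℝ (Fin d),
      Continuous (fun w => (-a * (p w * sbE a w z)) • innerSL ℝ w) := fun z => by
    have := sbE_cont a z
    fun_prop
  have hbd : ∀ w, ∀ x ∈ Metric.ball z 1, ‖(-a * (p w * sbE a w x)) • innerSL ℝ w‖ ≤
      a * C * Real.exp ((3 + a * (‖z‖ + 1)) ^ 2 / (2 * a ^ 2)) := by
    intro w x hx
    have hx' : ‖x‖ ≤ ‖z‖ + 1 := by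
      have h1 : ‖x - z‖ < 1 := by simpa [dist_eq_norm] using hx
      have h2 := norm_sub_norm_le x z
      linarith
    rw [norm_smul, innerSL_apply_norm, norm_mul, norm_mul, norm_neg]
    simp only [Real.norm_eq_abs]
    rw [abs_of_pos (sbE_pos a w x), abs_of_pos ha]
    have h3 := sbE_bound a 3 (‖z‖ + 1) ha w x hx'
    have h4 : Real.exp (3 * ‖w‖) = Real.exp (2 * ‖w‖) * Real.exp ‖w‖ := by
      rw [← Real.exp_add]; ring_nf
    have h5 : |p w| * ‖w‖ ≤ C * Real.exp (3 * ‖w‖) := by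
      rw [h4, ← mul_assoc]
      exact mul_le_mul (hb w) (sb_le_exp w) (norm_nonneg _) (by positivity)
    calc a * (|p w| * sbE a w x) * ‖w‖ = a * ((|p w| * ‖w‖) * sbE a w x) := by ring
      _ ≤ a * ((C * Real.exp (3 * ‖w‖)) * sbE a w x) := by
          have := (sbE_pos a w x).le
          gcongr
      _ = a * C * (Real.exp (3 * ‖w‖) * sbE a w x) := by ring
      _ ≤ _ := by gcongr
  have hint : Integrable (fun w => (-a * (p w * sbE a w z)) • innerSL ℝ w) ν :=
    Integrable.of_bound (hcont z).aestronglyMeasurable _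
      (ae_of_all _ fun w => hbd w z (Metric.mem_ball_self one_pos))
  refine ⟨∫ w, (-a * (p w * sbE a w z)) • innerSL ℝ w ∂ν, ?_, ?_⟩
  · refine hasFDerivAt_integral_of_dominated_of_fderiv_le
      (F := fun z w => p w * sbE a w z)
      (F' := fun z w => (-a * (p w * sbE a w z)) • innerSL ℝ w)
      (bound := fun _ => a * C * Real.exp ((3 + a * (‖z‖ + 1)) ^ 2 / (2 * a ^ 2)))
      (Metric.ball_mem_nhds z one_pos) ?_ (sbJ_integrable ν p hp a ha z)
      (hcont z).aestronglyMeasurable (ae_of_all _ hbd) (integrable_const _) ?_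
    · exact Eventually.of_forall fun x => (sbJ_integrable ν p hp a ha x).aestronglyMeasurable
    · refine ae_of_all _ fun w x _ => ?_
      unfold sbE
      have h := ((((innerSL ℝ w).hasFDerivAt (x := x)).const_mul a).const_sub
        (-(a ^ 2 * ‖w‖ ^ 2) / 2)).exp.const_mul (p w)
      simp only [innerSL_apply_apply] at h
      refine h.congr_fderiv ?_
      ext v
      simp
      ring
  · intro i
    rw [ContinuousLinearMap.integral_apply hint, sbJ, ← integral_const_mul]
    congr 1
    ext w
    have h1 : inner ℝ w (EuclideanSpace.single i 1) = w i := by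
      simp [EuclideanSpace.inner_single_right]
    simp only [smul_apply, innerSL_apply_apply, h1, smul_eq_mul]
    ring

lemma sbJ_continuous {d : ℕ} (ν : Measure (EuclideanSpace ℝ (Fin d))) [IsProbabilityMeasure ν]
    (p : EuclideanSpace ℝ (Fin d) → ℝ) (hp : SbG p) (a : ℝ) (ha : 0 < a) :
    Continuous (sbJ ν p a) := by
  rw [continuous_iff_continuousAt]
  intro z
  obtain ⟨L, hL, -⟩ := sbJ_hasFDerivAt ν p hp a ha z
  exact hL.continuousAt

lemma sbK_hasDerivAt {d : ℕ} (ν : Measure (EuclideanSpace ℝ (Fin d))) [IsProbabilityMeasure ν]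
    (a : ℝ) (ha : 0 < a) (z : EuclideanSpace ℝ (Fin d)) :
    HasDerivAt (fun a => sbJ ν (fun _ => 1) a z)
      (-a * sbJ ν (fun w => ‖w‖ ^ 2) a z - ∑ i, z i * sbJ ν (fun w => w i) a z) a := by
  have key : (-a * sbJ ν (fun w => ‖w‖ ^ 2) a z - ∑ i, z i * sbJ ν (fun w => w i) a z)
      = ∫ w, -(a * ‖w‖ ^ 2 + inner ℝ w z) * sbE a w z ∂ν := by
    simp only [sbJ, ← integral_const_mul]
    rw [← integral_finsetSum, ← integral_sub]
    · congr 1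
      ext w
      have : inner ℝ w z = ∑ i, z i * w i := by simp [PiLp.inner_apply]
      have h2 : ∑ i, z i * (w i * sbE a w z) = (∑ i, z i * w i) * sbE a w z := by
        rw [Finset.sum_mul]
        exact Finset.sum_congr rfl fun i _ => by ring
      rw [this, h2]
      ring
    · exact (sbJ_integrable ν _ sbG_norm_sq a ha z).const_mul _
    · exact integrable_finsetSum _ fun i _ => (sbJ_integrable ν _ (sbG_coord i) a ha z).const_mul _
    · exact fun i _ => (sbJ_integrable ν _ (sbG_coord i) a ha z).const_mul _
  rw [key]
  refine (hasDerivAt_integral_of_dominated_loc_of_deriv_le (μ := ν)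
      (F := fun a w => 1 * sbE a w z)
      (F' := fun a w => -(a * ‖w‖ ^ 2 + inner ℝ w z) * sbE a w z)
      (bound := fun _ => (2 * a + ‖z‖) * Real.exp ((2 + (2 * a) * ‖z‖) ^ 2 / (2 * (a / 2) ^ 2)))
      (Ioo_mem_nhds (show a / 2 < a by linarith) (show a < 2 * a by linarith)) ?_
      (sbJ_integrable ν _ sbG_one a ha z) ?_ (ae_of_all _ ?_) (integrable_const _)
      (ae_of_all _ ?_)).2
  · exact Eventually.of_forall fun x => (continuous_const.mul (sbE_cont x z)).aestronglyMeasurable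
  · have := sbE_cont a z
    exact Continuous.aestronglyMeasurable (by fun_prop)
  · rintro w b ⟨hb1, hb2⟩
    have hb : 0 < b := by linarith
    rw [norm_mul, norm_neg, Real.norm_eq_abs, Real.norm_eq_abs, abs_of_pos (sbE_pos b w z)]
    have h1 : |b * ‖w‖ ^ 2 + inner ℝ w z| ≤ (2 * a + ‖z‖) * Real.exp (2 * ‖w‖) := by
      refine (abs_add_le _ _).trans ?_
      rw [abs_of_nonneg (by positivity), add_mul]
      have := sb_sq_le_exp w
      have h3 := sb_le_exp2 w
      refine add_le_add ?_ ((abs_real_inner_le_norm w z).trans ?_)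
      · gcongr
      · rw [mul_comm]; gcongr
    have h2 := sbE_bound b 2 ‖z‖ hb w z le_rfl
    calc _ ≤ ((2 * a + ‖z‖) * Real.exp (2 * ‖w‖)) * sbE b w z :=
          mul_le_mul_of_nonneg_right h1 (sbE_pos _ _ _).le
      _ = (2 * a + ‖z‖) * (Real.exp (2 * ‖w‖) * sbE b w z) := by ring
      _ ≤ (2 * a + ‖z‖) * Real.exp ((2 + b * ‖z‖) ^ 2 / (2 * b ^ 2)) := by gcongr
      _ ≤ _ := by gcongr
  · rintro w b -
    unfold sbE
    have h := ((((((hasDerivAt_id b).pow 2).mul_const (‖w‖ ^ 2)).neg.div_const 2).sub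
      ((hasDerivAt_id b).mul_const (inner ℝ w z))).exp).const_mul (1 : ℝ)
    refine (h.congr_deriv ?_)
    simp
    ring

lemma sbK_lower {d : ℕ} (ν : Measure (EuclideanSpace ℝ (Fin d))) [IsProbabilityMeasure ν] :
    ∃ κ r : ℝ, 0 < κ ∧ 0 ≤ r ∧ ∀ a, 0 < a → ∀ z : EuclideanSpace ℝ (Fin d),
      κ * Real.exp (-(a ^ 2 * r ^ 2) - ‖z‖ ^ 2 / 2) ≤ sbJ ν (fun _ => 1) a z := by
  have hex : ∃ n : ℕ, 0 < ν (Metric.closedBall 0 (n : ℝ)) := by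
    by_contra! h
    have h1 : ν (⋃ n : ℕ, Metric.closedBall (0 : EuclideanSpace ℝ (Fin d)) (n : ℝ)) = 0 :=
      measure_iUnion_null fun n => le_antisymm (h n) bot_le
    rw [Metric.iUnion_closedBall_nat] at h1
    simp at h1
  obtain ⟨n, hn⟩ := hex
  refine ⟨ν.real (Metric.closedBall 0 (n : ℝ)), n, ?_, by positivity, ?_⟩
  · exact ENNReal.toReal_pos hn.ne' (measure_ne_top _ _)
  intro a ha z
  have hint := sbJ_integrable ν _ sbG_one a ha z
  calc _ = ∫ w in Metric.closedBall (0 : EuclideanSpace ℝ (Fin d)) (n : ℝ),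
        Real.exp (-(a ^ 2 * (n : ℝ) ^ 2) - ‖z‖ ^ 2 / 2) ∂ν := by
        rw [setIntegral_const, smul_eq_mul]
    _ ≤ ∫ w in Metric.closedBall (0 : EuclideanSpace ℝ (Fin d)) (n : ℝ), 1 * sbE a w z ∂ν := by
        refine setIntegral_mono_on (integrable_const _) hint.integrableOn
          Metric.isClosed_closedBall.measurableSet fun w hw => ?_
        rw [one_mul]
        unfold sbE
        apply Real.exp_le_exp.mpr
        have hw' : ‖w‖ ≤ n := by simpa using hw
        have h1 : inner ℝ w z ≤ ‖w‖ * ‖z‖ := real_inner_le_norm w z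
        have h2 : a * inner ℝ w z ≤ a * (‖w‖ * ‖z‖) := by gcongr
        have h3 : a * ‖w‖ ≤ a * n := by gcongr
        have h4 : (a * ‖w‖) ^ 2 ≤ (a * n) ^ 2 := by gcongr
        nlinarith [sq_nonneg (a * ‖w‖ - ‖z‖)]
    _ ≤ _ := setIntegral_le_integral hint
        (ae_of_all _ fun w => by simpa using (sbE_pos a w z).le)

lemma sbK_pos {d : ℕ} (ν : Measure (EuclideanSpace ℝ (Fin d))) [IsProbabilityMeasure ν]
    (a : ℝ) (ha : 0 < a) (z : EuclideanSpace ℝ (Fin d)) : 0 < sbJ ν (fun _ => 1) a z := by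
  obtain ⟨κ, r, hκ, hr, h⟩ := sbK_lower ν
  exact lt_of_lt_of_le (by positivity) (h a ha z)

lemma sb_bounds {d : ℕ} (ν : Measure (EuclideanSpace ℝ (Fin d))) [IsProbabilityMeasure ν]
    (α β : ℝ) (hα : 0 < α) :
    ∃ C : ℝ, 1 ≤ C ∧ ∀ a, α ≤ a → a ≤ β → ∀ z : EuclideanSpace ℝ (Fin d),
      sbJ ν (fun w => ‖w‖ ^ 2) a z ≤ C * (1 + ‖z‖ ^ 2) * sbJ ν (fun _ => 1) a z ∧
      |Real.log (sbJ ν (fun _ => 1) a z)| ≤ C * (1 + ‖z‖ ^ 2) := by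
  obtain ⟨κ, r, hκ, hr, hlow⟩ := sbK_lower ν
  set B := β ^ 2 * r ^ 2 + |Real.log κ| with hB
  have hB0 : 0 ≤ B := by positivity
  refine ⟨4 / α ^ 2 * (B + 3) + (B + 1), ?_, ?_⟩
  · have : 0 ≤ 4 / α ^ 2 * (B + 3) := by positivity
    linarith
  intro a haα haβ z
  have ha : 0 < a := hα.trans_le haα
  have hK := sbK_pos ν a ha z
  have hl := hlow a ha z
  set K := sbJ ν (fun _ => 1) a z with hKdef
  have har : a ^ 2 * r ^ 2 ≤ β ^ 2 * r ^ 2 := by gcongr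
  have hpos : 0 ≤ 4 / α ^ 2 * (B + 3) := by positivity
  have hz2 : 0 ≤ ‖z‖ ^ 2 := by positivity
  constructor
  · set L := 3 / 2 * ‖z‖ ^ 2 + a ^ 2 * r ^ 2 - Real.log κ with hL
    have hLe : Real.exp (‖z‖ ^ 2 - L) ≤ K := by
      refine le_trans (le_of_eq ?_) hl
      have : ‖z‖ ^ 2 - L = Real.log κ + (-(a ^ 2 * r ^ 2) - ‖z‖ ^ 2 / 2) := by rw [hL]; ring
      rw [this, Real.exp_add, Real.exp_log hκ]
    have h1 : a ^ 2 / 4 * sbJ ν (fun w => ‖w‖ ^ 2) a z ≤ L * K + Real.exp (‖z‖ ^ 2 - L) := by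
      have hi := sbJ_integrable ν _ sbG_one a ha z
      have : L * K + Real.exp (‖z‖ ^ 2 - L) =
          ∫ w, (L * (1 * sbE a w z) + Real.exp (‖z‖ ^ 2 - L)) ∂ν := by
        rw [integral_add (hi.const_mul _) (integrable_const _), integral_const_mul]
        simp [hKdef, sbJ]
      rw [this, sbJ, ← integral_const_mul]
      refine integral_mono ((sbJ_integrable ν _ sbG_norm_sq a ha z).const_mul _)
        ((hi.const_mul _).add (integrable_const _)) fun w => ?_
      simp only [one_mul]
      set u := a ^ 2 * ‖w‖ ^ 2 / 4 with hu
      have h2 : u ≤ L + Real.exp (u - L) := by linarith [Real.add_one_le_exp (u - L)]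
      have h3 : Real.exp (u - L) * sbE a w z ≤ Real.exp (‖z‖ ^ 2 - L) := by
        unfold sbE
        rw [← Real.exp_add]
        apply Real.exp_le_exp.mpr
        have h4 : -(inner ℝ w z) ≤ ‖w‖ * ‖z‖ :=
          (neg_le_abs _).trans (abs_real_inner_le_norm w z)
        have h5 : a * -(inner ℝ w z) ≤ a * (‖w‖ * ‖z‖) := by gcongr
        rw [hu]
        nlinarith [sq_nonneg (a * ‖w‖ / 2 - ‖z‖)]
      have h6 := mul_le_mul_of_nonneg_right h2 (sbE_pos a w z).le
      have h7 : a ^ 2 / 4 * (‖w‖ ^ 2 * sbE a w z) = u * sbE a w z := by rw [hu]; ring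
      rw [h7]
      nlinarith
    have h8 : a ^ 2 / 4 * sbJ ν (fun w => ‖w‖ ^ 2) a z ≤ (L + 1) * K := by linarith
    have h9 : L + 1 ≤ (B + 3) * (1 + ‖z‖ ^ 2) := by
      have := neg_le_abs (Real.log κ)
      nlinarith
    have h10 : sbJ ν (fun w => ‖w‖ ^ 2) a z ≤ 4 / a ^ 2 * ((L + 1) * K) := by
      have h11 : sbJ ν (fun w => ‖w‖ ^ 2) a z =
        4 / a ^ 2 * (a ^ 2 / 4 * sbJ ν (fun w => ‖w‖ ^ 2) a z) := by field_simp
      rw [h11]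
      gcongr
    calc _ ≤ 4 / a ^ 2 * ((L + 1) * K) := h10
      _ ≤ 4 / a ^ 2 * (((B + 3) * (1 + ‖z‖ ^ 2)) * K) := by gcongr
      _ ≤ 4 / α ^ 2 * (((B + 3) * (1 + ‖z‖ ^ 2)) * K) := by gcongr
      _ = (4 / α ^ 2 * (B + 3)) * (1 + ‖z‖ ^ 2) * K := by ring
      _ ≤ _ := by gcongr; linarith
  · have hup : K ≤ Real.exp (‖z‖ ^ 2 / 2) := by
      have : Real.exp (‖z‖ ^ 2 / 2) = ∫ w, Real.exp (‖z‖ ^ 2 / 2) ∂ν := by simp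
      rw [this, hKdef, sbJ]
      refine integral_mono (sbJ_integrable ν _ sbG_one a ha z) (integrable_const _) fun w => ?_
      have h1 := sbE_bound a 0 ‖z‖ ha w z le_rfl
      rw [zero_mul, Real.exp_zero] at h1
      refine h1.trans (le_of_eq ?_)
      congr 1
      field_simp
      ring
    have h1 : Real.log K ≤ ‖z‖ ^ 2 / 2 := by
      rw [← Real.log_exp (‖z‖ ^ 2 / 2)]
      exact Real.log_le_log hK hup
    have h2 : Real.log κ + (-(a ^ 2 * r ^ 2) - ‖z‖ ^ 2 / 2) ≤ Real.log K := by
      rw [← Real.log_exp (-(a ^ 2 * r ^ 2) - ‖z‖ ^ 2 / 2),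
        ← Real.log_mul hκ.ne' (Real.exp_pos _).ne']
      exact Real.log_le_log (by positivity) hl
    have := neg_abs_le (Real.log κ)
    have h3 : 0 ≤ 4 / α ^ 2 * (B + 3) * ‖z‖ ^ 2 := by positivity
    have h4 : 0 ≤ B * ‖z‖ ^ 2 := by positivity
    rw [abs_le]
    constructor <;> nlinarith

/-- posterior mean coordinate -/
def sbQ {d : ℕ} (ν : Measure (EuclideanSpace ℝ (Fin d))) (i : Fin d)
    (a : ℝ) (z : EuclideanSpace ℝ (Fin d)) : ℝ :=
  sbJ ν (fun w => w i) a z / sbJ ν (fun _ => 1) a z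

lemma sbQ_sq_le {d : ℕ} (ν : Measure (EuclideanSpace ℝ (Fin d))) [IsProbabilityMeasure ν]
    (i : Fin d) (a : ℝ) (ha : 0 < a) (z : EuclideanSpace ℝ (Fin d)) (S : ℝ) (hS : 0 < S)
    (h : sbJ ν (fun w => ‖w‖ ^ 2) a z ≤ S * sbJ ν (fun _ => 1) a z) :
    sbQ ν i a z ^ 2 ≤ S := by
  have hK := sbK_pos ν a ha z
  set s := Real.sqrt S with hs
  have hs0 : 0 < s := Real.sqrt_pos.mpr hS
  have hss : s ^ 2 = S := Real.sq_sqrt hS.le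
  have h1 : |sbJ ν (fun w => w i) a z| ≤
      s / 2 * sbJ ν (fun _ => 1) a z + 1 / (2 * s) * sbJ ν (fun w => ‖w‖ ^ 2) a z := by
    rw [sbJ, sbJ, sbJ, ← integral_const_mul, ← integral_const_mul, ← integral_add]
    · refine (abs_integral_le_integral_abs).trans (integral_mono
        (sbJ_integrable ν _ (sbG_coord i) a ha z).abs
        (((sbJ_integrable ν _ sbG_one a ha z).const_mul _).add
          ((sbJ_integrable ν _ sbG_norm_sq a ha z).const_mul _)) fun w => ?_)
      simp only [abs_mul, abs_of_pos (sbE_pos a w z)]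
      have h2 : |w i| ≤ s / 2 + 1 / (2 * s) * ‖w‖ ^ 2 := by
        refine (sb_coord w i).trans ?_
        have : s / 2 + 1 / (2 * s) * ‖w‖ ^ 2 - ‖w‖ = (s - ‖w‖) ^ 2 / (2 * s) := by
          field_simp; ring
        have h3 : 0 ≤ (s - ‖w‖) ^ 2 / (2 * s) := by positivity
        linarith
      have := mul_le_mul_of_nonneg_right h2 (sbE_pos a w z).le
      linarith
    · exact (sbJ_integrable ν _ sbG_one a ha z).const_mul _
    · exact (sbJ_integrable ν _ sbG_norm_sq a ha z).const_mul _
  have h4 : |sbJ ν (fun w => w i) a z| ≤ s * sbJ ν (fun _ => 1) a z := by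
    refine h1.trans ?_
    have h5 : 1 / (2 * s) * sbJ ν (fun w => ‖w‖ ^ 2) a z ≤
        1 / (2 * s) * (S * sbJ ν (fun _ => 1) a z) := by gcongr
    have h6 : 1 / (2 * s) * (S * sbJ ν (fun _ => 1) a z) = s / 2 * sbJ ν (fun _ => 1) a z := by
      rw [← hss]; field_simp
    linarith
  have h7 : |sbQ ν i a z| ≤ s := by
    rw [sbQ, abs_div, abs_of_pos hK, div_le_iff₀ hK]
    exact h4
  rw [← hss, ← sq_abs]
  gcongr

lemma sbGauss_pos {d : ℕ} (z : EuclideanSpace ℝ (Fin d)) : 0 < stdGaussianDensity d z := by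
  unfold stdGaussianDensity; positivity

lemma sbGauss_cont {d : ℕ} : Continuous (stdGaussianDensity d) := by
  unfold stdGaussianDensity; fun_prop

lemma sbGauss_integrable_exp {d : ℕ} (b : ℝ) (hb : 0 < b) :
    Integrable (fun z : EuclideanSpace ℝ (Fin d) => Real.exp (-b * ‖z‖ ^ 2)) := by
  have h := GaussianFourier.integrable_cexp_neg_mul_sq_norm_add
    (V := EuclideanSpace ℝ (Fin d)) (b := (b : ℂ)) (by simpa using hb) 0 0
  have h2 := h.norm
  refine h2.congr (ae_of_all _ fun z => ?_)
  simp only [Complex.norm_exp]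
  congr 1
  simp [← Complex.ofReal_pow, ← Complex.ofReal_mul]

lemma sbGauss_integral {d : ℕ} : ∫ z, stdGaussianDensity d z = 1 := by
  unfold stdGaussianDensity
  rw [integral_const_mul]
  have h := GaussianFourier.integral_rexp_neg_mul_sq_norm
    (V := EuclideanSpace ℝ (Fin d)) (b := 1 / 2) (by norm_num)
  have h2 : ∀ z : EuclideanSpace ℝ (Fin d), -‖z‖ ^ 2 / 2 = -(1 / 2) * ‖z‖ ^ 2 := fun z => by ring
  simp only [h2]
  rw [h]
  simp only [finrank_euclideanSpace, Fintype.card_fin]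
  have h3 : π / (1 / 2) = 2 * π := by ring
  rw [h3, ← Real.rpow_add (by positivity)]
  have : -(d : ℝ) / 2 + d / 2 = 0 := by ring
  rw [this, Real.rpow_zero]

lemma sbGauss_integrable {d : ℕ} (f : EuclideanSpace ℝ (Fin d) → ℝ) (hf : Continuous f) (C : ℝ)
    (h : ∀ z, |f z| ≤ C * (1 + ‖z‖ ^ 2)) :
    Integrable (fun z => f z * stdGaussianDensity d z) := by
  have hC : 0 ≤ C := by
    have := (abs_nonneg _).trans (h 0)
    simpa using this
  refine Integrable.mono' (g := fun z => C * 5 * (2 * π) ^ (-(d : ℝ) / 2) *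
    Real.exp (-(1 / 4) * ‖z‖ ^ 2)) ((sbGauss_integrable_exp _ (by norm_num)).const_mul _)
    (hf.mul sbGauss_cont).aestronglyMeasurable (ae_of_all _ fun z => ?_)
  rw [norm_mul, Real.norm_eq_abs, Real.norm_eq_abs, abs_of_pos (sbGauss_pos z)]
  refine (mul_le_mul_of_nonneg_right (h z) (sbGauss_pos z).le).trans ?_
  unfold stdGaussianDensity
  have h1 : Real.exp (-‖z‖ ^ 2 / 2) =
      Real.exp (-(1 / 4) * ‖z‖ ^ 2) * Real.exp (-(1 / 4) * ‖z‖ ^ 2) := by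
    rw [← Real.exp_add]; ring_nf
  have h2 : (1 + ‖z‖ ^ 2) * Real.exp (-(1 / 4) * ‖z‖ ^ 2) ≤ 5 := by
    have h3 : 1 + ‖z‖ ^ 2 ≤ 5 * Real.exp ((1 / 4) * ‖z‖ ^ 2) := by
      have := Real.add_one_le_exp ((1 / 4) * ‖z‖ ^ 2)
      nlinarith [sq_nonneg ‖z‖]
    calc _ ≤ 5 * Real.exp ((1 / 4) * ‖z‖ ^ 2) * Real.exp (-(1 / 4) * ‖z‖ ^ 2) := by gcongr
      _ = 5 := by rw [mul_assoc, ← Real.exp_add]; simp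
  have h4 : 0 ≤ (2 * π) ^ (-(d : ℝ) / 2) := by positivity
  rw [h1]
  calc _ = C * (2 * π) ^ (-(d : ℝ) / 2) * Real.exp (-(1 / 4) * ‖z‖ ^ 2) *
        ((1 + ‖z‖ ^ 2) * Real.exp (-(1 / 4) * ‖z‖ ^ 2)) := by ring
    _ ≤ C * (2 * π) ^ (-(d : ℝ) / 2) * Real.exp (-(1 / 4) * ‖z‖ ^ 2) * 5 := by gcongr
    _ = _ := by ring

lemma sbGauss_hasFDerivAt {d : ℕ} (z : EuclideanSpace ℝ (Fin d)) :
    HasFDerivAt (stdGaussianDensity d) ((-stdGaussianDensity d z) • innerSL ℝ z) z := by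
  have h := (((hasStrictFDerivAt_norm_sq z).hasFDerivAt.const_mul (-(1 / 2) : ℝ)).exp).const_mul
    ((2 * π) ^ (-(d : ℝ) / 2))
  have h2 : stdGaussianDensity d = fun z : EuclideanSpace ℝ (Fin d) =>
      (2 * π) ^ (-(d : ℝ) / 2) * Real.exp (-(1 / 2) * ‖z‖ ^ 2) := by
    funext z; unfold stdGaussianDensity; congr 2; ring
  rw [h2]
  refine h.congr_fderiv ?_
  ext v
  simp
  ring

lemma sbQ_cont {d : ℕ} (ν : Measure (EuclideanSpace ℝ (Fin d))) [IsProbabilityMeasure ν]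
    (i : Fin d) (a : ℝ) (ha : 0 < a) : Continuous (sbQ ν i a) :=
  (sbJ_continuous ν _ (sbG_coord i) a ha).div (sbJ_continuous ν _ sbG_one a ha)
    fun z => (sbK_pos ν a ha z).ne'

lemma sbJ_coord_sq_le {d : ℕ} (ν : Measure (EuclideanSpace ℝ (Fin d))) [IsProbabilityMeasure ν]
    (i : Fin d) (a : ℝ) (ha : 0 < a) (z : EuclideanSpace ℝ (Fin d)) :
    |sbJ ν (fun w => w i * w i) a z| ≤ sbJ ν (fun w => ‖w‖ ^ 2) a z := by
  unfold sbJ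
  refine abs_integral_le_integral_abs.trans (integral_mono
    (sbJ_integrable ν _ (sbG_coord_sq i) a ha z).abs (sbJ_integrable ν _ sbG_norm_sq a ha z)
    fun w => ?_)
  simp only [abs_mul, abs_of_pos (sbE_pos a w z)]
  refine mul_le_mul_of_nonneg_right ?_ (sbE_pos a w z).le
  rw [← sq]
  exact pow_le_pow_left₀ (abs_nonneg _) (sb_coord w i) 2

lemma sbJ_sum_sq {d : ℕ} (ν : Measure (EuclideanSpace ℝ (Fin d))) [IsProbabilityMeasure ν]
    (a : ℝ) (ha : 0 < a) (z : EuclideanSpace ℝ (Fin d)) :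
    sbJ ν (fun w => ‖w‖ ^ 2) a z = ∑ i, sbJ ν (fun w => w i * w i) a z := by
  unfold sbJ
  rw [← integral_finsetSum _ fun i _ => sbJ_integrable ν _ (sbG_coord_sq i) a ha z]
  congr 1
  ext w
  beta_reduce
  rw [EuclideanSpace.norm_sq_eq, Finset.sum_mul]
  simp [sq]

lemma sb_ii_bound {d : ℕ} (ν : Measure (EuclideanSpace ℝ (Fin d))) [IsProbabilityMeasure ν]
    (i : Fin d) (a : ℝ) (ha : 0 < a) (z : EuclideanSpace ℝ (Fin d)) (S : ℝ)
    (h : sbJ ν (fun w => ‖w‖ ^ 2) a z ≤ S * sbJ ν (fun _ => 1) a z) :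
    |sbJ ν (fun w => w i * w i) a z / sbJ ν (fun _ => 1) a z| ≤ S := by
  have hK := sbK_pos ν a ha z
  rw [abs_div, abs_of_pos hK, div_le_iff₀ hK]
  exact (sbJ_coord_sq_le ν i a ha z).trans h

lemma sb_zq_bound {d : ℕ} (i : Fin d) (z : EuclideanSpace ℝ (Fin d)) (C q : ℝ) (hC : 1 ≤ C)
    (h : q ^ 2 ≤ C * (1 + ‖z‖ ^ 2)) : |z i * q| ≤ C * (1 + ‖z‖ ^ 2) := by
  have h1 := pow_le_pow_left₀ (abs_nonneg _) (sb_coord z i) 2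
  rw [abs_mul]
  have h2 := sq_abs q
  nlinarith [sq_nonneg (|z i| - |q|), sq_nonneg ‖z‖]

lemma sb_ibp {d : ℕ} (ν : Measure (EuclideanSpace ℝ (Fin d))) [IsProbabilityMeasure ν]
    (i : Fin d) (a : ℝ) (ha : 0 < a) :
    Integrable (fun z => sbJ ν (fun w => w i * w i) a z / sbJ ν (fun _ => 1) a z *
        stdGaussianDensity d z) ∧
    Integrable (fun z => sbQ ν i a z ^ 2 * stdGaussianDensity d z) ∧
    Integrable (fun z => z i * sbQ ν i a z * stdGaussianDensity d z) ∧
    a * ∫ z, sbJ ν (fun w => w i * w i) a z / sbJ ν (fun _ => 1) a z * stdGaussianDensity d z =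
      (a * ∫ z, sbQ ν i a z ^ 2 * stdGaussianDensity d z)
        - ∫ z, z i * sbQ ν i a z * stdGaussianDensity d z := by
  obtain ⟨C, hC, hb⟩ := sb_bounds ν a a ha
  have hQ2 : ∀ z, sbQ ν i a z ^ 2 ≤ C * (1 + ‖z‖ ^ 2) := fun z =>
    sbQ_sq_le ν i a ha z _ (by positivity) (hb a le_rfl le_rfl z).1
  have hQc := sbQ_cont ν i a ha
  have hIc : Continuous (fun z => sbJ ν (fun w => w i * w i) a z / sbJ ν (fun _ => 1) a z) :=
    (sbJ_continuous ν _ (sbG_coord_sq i) a ha).div (sbJ_continuous ν _ sbG_one a ha)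
      fun z => (sbK_pos ν a ha z).ne'
  have i1 := sbGauss_integrable _ hIc C
    fun z => sb_ii_bound ν i a ha z _ (hb a le_rfl le_rfl z).1
  have i2 := sbGauss_integrable (fun z => sbQ ν i a z ^ 2) (hQc.pow 2) C fun z => by
    rw [abs_of_nonneg (sq_nonneg _)]; exact hQ2 z
  have i3 := sbGauss_integrable (fun z => z i * sbQ ν i a z) (by fun_prop) C fun z =>
    sb_zq_bound i z C _ hC (hQ2 z)
  have i4 := sbGauss_integrable _ hQc C fun z => by
    have := hQ2 z
    rw [← sq_abs] at this
    have h0 : 0 ≤ ‖z‖ ^ 2 := by positivity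
    have h1 : 1 ≤ C * (1 + ‖z‖ ^ 2) := by nlinarith
    by_contra! h2
    nlinarith
  refine ⟨i1, i2, i3, ?_⟩
  have hibp := integral_bilinear_hasLineDerivAt_right_eq_neg_left_of_integrable
    (μ := (volume : Measure (EuclideanSpace ℝ (Fin d))))
    (f := sbQ ν i a)
    (f' := fun z => -a * (sbJ ν (fun w => w i * w i) a z / sbJ ν (fun _ => 1) a z)
      + a * sbQ ν i a z ^ 2)
    (g := stdGaussianDensity d) (g' := fun z => -(z i) * stdGaussianDensity d z)
    (v := EuclideanSpace.single i 1) (B := ContinuousLinearMap.mul ℝ ℝ)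
    (by
      simp only [ContinuousLinearMap.mul_apply']
      refine ((i1.const_mul (-a)).add (i2.const_mul a)).congr (ae_of_all _ fun z => ?_)
      simp only [Pi.add_apply]
      ring)
    (by
      simp only [ContinuousLinearMap.mul_apply']
      refine i3.neg.congr (ae_of_all _ fun z => ?_)
      simp only [Pi.neg_apply]
      ring)
    i4
    (fun z _ => by
      obtain ⟨L1, hL1, e1⟩ := sbJ_hasFDerivAt ν _ (sbG_coord i) a ha z
      obtain ⟨L0, hL0, e0⟩ := sbJ_hasFDerivAt ν _ sbG_one a ha z
      have hK := (sbK_pos ν a ha z).ne'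
      have h1 := hL1.hasLineDerivAt (EuclideanSpace.single i 1)
      have h0 := hL0.hasLineDerivAt (EuclideanSpace.single i 1)
      unfold HasLineDerivAt at h1 h0 ⊢
      have h := h1.div h0 (by simpa using hK)
      refine h.congr_deriv ?_
      simp only [zero_smul, add_zero, e1, e0, sbQ, one_mul]
      field_simp
      ring)
    (fun z _ => by
      have h := (sbGauss_hasFDerivAt z).hasLineDerivAt (EuclideanSpace.single i 1)
      convert! h using 1
      have h1 : inner ℝ z (EuclideanSpace.single i 1) = z i := by
        simp [EuclideanSpace.inner_single_right]
      simp only [smul_apply, innerSL_apply_apply, h1, smul_eq_mul]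
      ring)
  simp only [ContinuousLinearMap.mul_apply'] at hibp
  have e1 : ∫ z, sbQ ν i a z * (-(z i) * stdGaussianDensity d z) =
      -∫ z, z i * sbQ ν i a z * stdGaussianDensity d z := by
    rw [← integral_neg]; congr 1; ext z; ring
  have e2 : ∫ z, (-a * (sbJ ν (fun w => w i * w i) a z / sbJ ν (fun _ => 1) a z)
      + a * sbQ ν i a z ^ 2) * stdGaussianDensity d z =
      -a * (∫ z, sbJ ν (fun w => w i * w i) a z / sbJ ν (fun _ => 1) a z
        * stdGaussianDensity d z) + a * ∫ z, sbQ ν i a z ^ 2 * stdGaussianDensity d z := by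
    rw [← integral_const_mul, ← integral_const_mul,
      ← integral_add (i1.const_mul _) (i2.const_mul _)]
    congr 1; ext z; ring
  rw [e1, e2] at hibp
  linarith

lemma sb_main {d : ℕ} (ν : Measure (EuclideanSpace ℝ (Fin d))) [IsProbabilityMeasure ν]
    (a : ℝ) (ha : 0 < a) :
    HasDerivAt (fun a => ∫ z, Real.log (sbJ ν (fun _ => 1) a z) * stdGaussianDensity d z)
      (-a * ∫ z, (∑ i, sbQ ν i a z ^ 2) * stdGaussianDensity d z) a := by
  obtain ⟨C, hC, hb⟩ := sb_bounds ν (a / 2) (2 * a) (by positivity)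
  have hlogc : ∀ b, 0 < b → Continuous (fun z => Real.log (sbJ ν (fun _ => 1) b z)) := fun b hb' =>
    (sbJ_continuous ν _ sbG_one b hb').log fun z => (sbK_pos ν b hb' z).ne'
  have hJc := fun i => sbJ_continuous ν _ (sbG_coord (d := d) i) a ha
  have hJ1c := sbJ_continuous ν _ sbG_one a ha
  have hJ2c := sbJ_continuous ν _ sbG_norm_sq a ha
  have hD := (hasDerivAt_integral_of_dominated_loc_of_deriv_le
      (μ := (volume : Measure (EuclideanSpace ℝ (Fin d)))) (x₀ := a)
      (F := fun a z => Real.log (sbJ ν (fun _ => 1) a z) * stdGaussianDensity d z)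
      (F' := fun a z => ((-a * sbJ ν (fun w => ‖w‖ ^ 2) a z
        - ∑ i, z i * sbJ ν (fun w => w i) a z) / sbJ ν (fun _ => 1) a z) * stdGaussianDensity d z)
      (bound := fun z => ((2 * a * C + d * C) * (1 + ‖z‖ ^ 2)) * stdGaussianDensity d z)
      (Ioo_mem_nhds (show a / 2 < a by linarith) (show a < 2 * a by linarith)) ?_
      ?_ ?_ (ae_of_all _ ?_) ?_ (ae_of_all _ ?_)).2
  · refine hD.congr_deriv ?_
    have hi := fun i => sb_ibp ν i a ha
    have e1 : ∀ z, ((-a * sbJ ν (fun w => ‖w‖ ^ 2) a z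
        - ∑ i, z i * sbJ ν (fun w => w i) a z) / sbJ ν (fun _ => 1) a z) * stdGaussianDensity d z
        = ∑ i, (-a * (sbJ ν (fun w => w i * w i) a z / sbJ ν (fun _ => 1) a z
            * stdGaussianDensity d z) - z i * sbQ ν i a z * stdGaussianDensity d z) := by
      intro z
      rw [sbJ_sum_sq ν a ha z, Finset.mul_sum, ← Finset.sum_sub_distrib, Finset.sum_div,
        Finset.sum_mul]
      refine Finset.sum_congr rfl fun i _ => ?_
      rw [sbQ]; ring
    simp only [e1, Finset.sum_mul]
    have hs : ∀ i ∈ Finset.univ, Integrable (fun z => (-a * (sbJ ν (fun w => w i * w i) a z /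
        sbJ ν (fun _ => 1) a z * stdGaussianDensity d z)
        - z i * sbQ ν i a z * stdGaussianDensity d z)) :=
      fun i _ => ((hi i).1.const_mul (-a)).sub (hi i).2.2.1
    rw [integral_finsetSum _ hs,
      integral_finsetSum _ fun i _ => (hi i).2.1, Finset.mul_sum]
    refine Finset.sum_congr rfl fun i _ => ?_
    rw [integral_sub ((hi i).1.const_mul _) (hi i).2.2.1, integral_const_mul]
    linarith [(hi i).2.2.2]
  · filter_upwards [lt_mem_nhds ha] with b hb'
    exact ((hlogc b hb').mul sbGauss_cont).aestronglyMeasurable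
  · exact sbGauss_integrable _ (hlogc a ha) C
      fun z => (hb a (by linarith) (by linarith) z).2
  · refine Continuous.aestronglyMeasurable (Continuous.mul (Continuous.div ?_ hJ1c
      fun z => (sbK_pos ν a ha z).ne') sbGauss_cont)
    fun_prop
  · rintro z b ⟨hb1, hb2⟩
    have hb0 : 0 < b := by linarith
    have hK := sbK_pos ν b hb0 z
    have hB := (hb b hb1.le hb2.le z).1
    rw [norm_mul, Real.norm_eq_abs, Real.norm_eq_abs, abs_of_pos (sbGauss_pos z)]
    refine mul_le_mul_of_nonneg_right ?_ (sbGauss_pos z).le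
    have e1 : (-b * sbJ ν (fun w => ‖w‖ ^ 2) b z
        - ∑ i, z i * sbJ ν (fun w => w i) b z) / sbJ ν (fun _ => 1) b z =
        -b * (sbJ ν (fun w => ‖w‖ ^ 2) b z / sbJ ν (fun _ => 1) b z) -
          ∑ i, z i * sbQ ν i b z := by
      rw [sub_div, Finset.sum_div, mul_div_assoc]
      simp only [sbQ, mul_div_assoc]
    rw [e1]
    refine (abs_sub _ _).trans ?_
    have hM : 0 ≤ sbJ ν (fun w => ‖w‖ ^ 2) b z :=
      integral_nonneg fun w => mul_nonneg (by positivity) (sbE_pos _ _ _).le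
    have e2 : |-b * (sbJ ν (fun w => ‖w‖ ^ 2) b z / sbJ ν (fun _ => 1) b z)| ≤
        2 * a * (C * (1 + ‖z‖ ^ 2)) := by
      rw [abs_mul, abs_neg, abs_of_pos hb0, abs_of_nonneg (by positivity)]
      have : sbJ ν (fun w => ‖w‖ ^ 2) b z / sbJ ν (fun _ => 1) b z ≤ C * (1 + ‖z‖ ^ 2) := by
        rw [div_le_iff₀ hK]; exact hB
      gcongr
    have e3 : |∑ i, z i * sbQ ν i b z| ≤ d * (C * (1 + ‖z‖ ^ 2)) := by
      refine (Finset.abs_sum_le_sum_abs _ _).trans ?_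
      refine (Finset.sum_le_card_nsmul _ _ (C * (1 + ‖z‖ ^ 2)) fun i _ => ?_).trans ?_
      · exact sb_zq_bound i z C _ hC (sbQ_sq_le ν i b hb0 z _ (by positivity) hB)
      · simp
    linarith
  · exact sbGauss_integrable _ (by fun_prop) (2 * a * C + d * C) fun z => by
      rw [abs_of_nonneg (by positivity)]
  · rintro z b ⟨hb1, hb2⟩
    have hb0 : 0 < b := by linarith
    exact ((sbK_hasDerivAt ν b hb0 z).log (sbK_pos ν b hb0 z).ne').mul_const _

/-- law of `x₀ - X₀` -/
def sbNu {d : ℕ} (μ : Measure (EuclideanSpace ℝ (Fin d))) (x₀ : EuclideanSpace ℝ (Fin d)) :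
    Measure (EuclideanSpace ℝ (Fin d)) := μ.map (fun y => x₀ - y)

lemma sbNu_prob {d : ℕ} (μ : Measure (EuclideanSpace ℝ (Fin d))) [IsProbabilityMeasure μ]
    (x₀ : EuclideanSpace ℝ (Fin d)) : IsProbabilityMeasure (sbNu μ x₀) :=
  Measure.isProbabilityMeasure_map (by fun_prop)

/-- rescaled time -/
def sbA (t : ℝ) : ℝ := Real.sqrt ((1 - t) / t)

lemma sbA_pos (t : ℝ) (h0 : 0 < t) (h1 : t < 1) : 0 < sbA t :=
  Real.sqrt_pos.mpr (div_pos (by linarith) h0)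

lemma sbA_sq (t : ℝ) (h0 : 0 < t) (h1 : t < 1) : sbA t ^ 2 = (1 - t) / t :=
  Real.sq_sqrt (div_pos (by linarith) h0).le

lemma sbA_hasDerivAt (t : ℝ) (h0 : 0 < t) (h1 : t < 1) :
    HasDerivAt sbA (-(1 / (2 * t ^ 2 * sbA t))) t := by
  have hne : (1 - t) / t ≠ 0 := (div_pos (by linarith) h0).ne'
  have h := (((hasDerivAt_id t).const_sub 1).div (hasDerivAt_id t) h0.ne').sqrt hne
  refine h.congr_deriv ?_
  have : sbA t ≠ 0 := (sbA_pos t h0 h1).ne'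
  simp only [id, Pi.div_apply]
  change _ / (2 * sbA t) = _
  field_simp
  ring

lemma sb_rho_eq {d : ℕ} (μ : Measure (EuclideanSpace ℝ (Fin d))) [IsProbabilityMeasure μ]
    (x₀ : EuclideanSpace ℝ (Fin d)) (t : ℝ) (h0 : 0 < t) (h1 : t < 1)
    (z : EuclideanSpace ℝ (Fin d)) :
    rho d μ t (Real.sqrt (1 - t) • x₀ + Real.sqrt t • z) =
      (2 * π * t) ^ (-(d : ℝ) / 2) * Real.exp (-(‖z‖ ^ 2 / 2)) *
        sbJ (sbNu μ x₀) (fun _ => 1) (sbA t) z := by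
  unfold rho sbJ sbNu
  have hc : AEStronglyMeasurable (fun w => (1 : ℝ) * sbE (sbA t) w z)
      (μ.map (fun y => x₀ - y)) :=
    (continuous_const.mul (sbE_cont (sbA t) z)).aestronglyMeasurable
  rw [integral_map (by fun_prop) hc, ← integral_const_mul]
  congr 1
  ext y
  have hst : Real.sqrt t ≠ 0 := (Real.sqrt_pos.mpr h0).ne'
  have hA : Real.sqrt t * sbA t = Real.sqrt (1 - t) := by
    unfold sbA
    rw [Real.sqrt_div (by linarith)]
    field_simp
  have e1 : Real.sqrt (1 - t) • x₀ + Real.sqrt t • z - Real.sqrt (1 - t) • y =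
      Real.sqrt t • (z + sbA t • (x₀ - y)) := by
    rw [smul_add, smul_smul, hA]; module
  have e2 : ‖Real.sqrt t • (z + sbA t • (x₀ - y))‖ ^ 2 =
      t * (‖z‖ ^ 2 + 2 * (sbA t * inner ℝ (x₀ - y) z) + sbA t ^ 2 * ‖x₀ - y‖ ^ 2) := by
    rw [norm_smul, mul_pow, norm_add_sq_real, norm_smul, mul_pow, inner_smul_right,
      real_inner_comm, Real.norm_eq_abs, Real.norm_eq_abs, sq_abs, sq_abs, Real.sq_sqrt h0.le]
  unfold heatKernel sbE
  rw [e1, e2, one_mul, mul_assoc ((2 * π * t) ^ (-(d : ℝ) / 2)), ← Real.exp_add]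
  congr 2
  field_simp
  ring

lemma sb_log_rho {d : ℕ} (μ : Measure (EuclideanSpace ℝ (Fin d))) [IsProbabilityMeasure μ]
    (x₀ : EuclideanSpace ℝ (Fin d)) (t : ℝ) (h0 : 0 < t) (h1 : t < 1)
    (z : EuclideanSpace ℝ (Fin d)) :
    Real.log (rho d μ t (Real.sqrt (1 - t) • x₀ + Real.sqrt t • z)) =
      (-(d / 2) * Real.log (2 * π * t) - ‖z‖ ^ 2 / 2) +
        Real.log (sbJ (sbNu μ x₀) (fun _ => 1) (sbA t) z) := by
  have := sbNu_prob μ x₀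
  have hK := sbK_pos (sbNu μ x₀) (sbA t) (sbA_pos t h0 h1) z
  have hp : 0 < 2 * π * t := by positivity
  rw [sb_rho_eq μ x₀ t h0 h1, Real.log_mul (by positivity) hK.ne',
    Real.log_mul (by positivity) (by positivity), Real.log_exp, Real.log_rpow hp]
  ring

lemma sb_condExp {d : ℕ} (μ : Measure (EuclideanSpace ℝ (Fin d))) [IsProbabilityMeasure μ]
    (x₀ : EuclideanSpace ℝ (Fin d)) (t : ℝ) (h0 : 0 < t) (h1 : t < 1) :
    condExpX0 d t x₀ (fun x => Real.log (rho d μ t x)) =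
      -(d / 2) * Real.log (2 * π * t) - (∫ z, ‖z‖ ^ 2 / 2 * stdGaussianDensity d z) +
      ∫ z, Real.log (sbJ (sbNu μ x₀) (fun _ => 1) (sbA t) z) * stdGaussianDensity d z := by
  have := sbNu_prob μ x₀
  have hA := sbA_pos t h0 h1
  obtain ⟨C, hC, hb⟩ := sb_bounds (sbNu μ x₀) (sbA t) (sbA t) hA
  have i1 := sbGauss_integrable (fun z => Real.log (sbJ (sbNu μ x₀) (fun _ => 1) (sbA t) z))
    ((sbJ_continuous _ _ sbG_one _ hA).log fun z => (sbK_pos _ _ hA z).ne') C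
    fun z => (hb _ le_rfl le_rfl z).2
  have i2 := sbGauss_integrable (fun z : EuclideanSpace ℝ (Fin d) => ‖z‖ ^ 2 / 2)
    (by fun_prop) 1 fun z => by
      rw [abs_of_nonneg (by positivity)]
      nlinarith [sq_nonneg ‖z‖]
  have i3 := sbGauss_integrable
    (fun _ : EuclideanSpace ℝ (Fin d) => -(d / 2) * Real.log (2 * π * t)) continuous_const
    |(-(d / 2) * Real.log (2 * π * t))| fun z => by
      have : 0 ≤ ‖z‖ ^ 2 := by positivity
      nlinarith [abs_nonneg (-(d / 2) * Real.log (2 * π * t))]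
  unfold condExpX0
  have e : ∀ z, Real.log (rho d μ t (Real.sqrt (1 - t) • x₀ + Real.sqrt t • z)) *
      stdGaussianDensity d z =
      ((-(d / 2) * Real.log (2 * π * t)) * stdGaussianDensity d z
        - ‖z‖ ^ 2 / 2 * stdGaussianDensity d z) +
        Real.log (sbJ (sbNu μ x₀) (fun _ => 1) (sbA t) z) * stdGaussianDensity d z := fun z => by
    rw [sb_log_rho μ x₀ t h0 h1]; ring
  simp only [e]
  have i4 : Integrable (fun z : EuclideanSpace ℝ (Fin d) =>
      (-(d / 2) * Real.log (2 * π * t)) * stdGaussianDensity d z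
        - ‖z‖ ^ 2 / 2 * stdGaussianDensity d z) := i3.sub i2
  rw [integral_add i4 i1, integral_sub i3 i2, integral_const_mul, sbGauss_integral,
    mul_one]

lemma sb_gradient {d : ℕ} (μ : Measure (EuclideanSpace ℝ (Fin d))) [IsProbabilityMeasure μ]
    (x₀ : EuclideanSpace ℝ (Fin d)) (t : ℝ) (h0 : 0 < t) (h1 : t < 1)
    (z : EuclideanSpace ℝ (Fin d)) (i : Fin d) :
    gradient (fun y => Real.log (rho d μ t y)) (Real.sqrt (1 - t) • x₀ + Real.sqrt t • z) i =
      (Real.sqrt t)⁻¹ * (-z i - sbA t * sbQ (sbNu μ x₀) i (sbA t) z) := by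
  have := sbNu_prob μ x₀
  have hA := sbA_pos t h0 h1
  have hst : Real.sqrt t ≠ 0 := (Real.sqrt_pos.mpr h0).ne'
  set x := Real.sqrt (1 - t) • x₀ + Real.sqrt t • z with hx
  have hK := sbK_pos (sbNu μ x₀) (sbA t) hA z
  obtain ⟨L, hL, e⟩ := sbJ_hasFDerivAt (sbNu μ x₀) _ sbG_one (sbA t) hA z
  -- derivative in the rescaled variable
  have hd1 := ((hasStrictFDerivAt_norm_sq z).hasFDerivAt.const_mul (1 / 2 : ℝ)).const_sub
    (-(d / 2) * Real.log (2 * π * t))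
  have hd2 := hd1.add (hL.log hK.ne')
  have hz : z = (Real.sqrt t)⁻¹ • (x - Real.sqrt (1 - t) • x₀) := by
    rw [hx, add_sub_cancel_left, smul_smul, inv_mul_cancel₀ hst, one_smul]
  have hζ : HasFDerivAt (fun y : EuclideanSpace ℝ (Fin d) =>
      (Real.sqrt t)⁻¹ • (y - Real.sqrt (1 - t) • x₀))
      ((Real.sqrt t)⁻¹ • ContinuousLinearMap.id ℝ (EuclideanSpace ℝ (Fin d))) x :=
    ((hasFDerivAt_id x).sub_const (Real.sqrt (1 - t) • x₀)).const_smul (Real.sqrt t)⁻¹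
  rw [show z = (fun y : EuclideanSpace ℝ (Fin d) =>
      (Real.sqrt t)⁻¹ • (y - Real.sqrt (1 - t) • x₀)) x from hz] at hd2
  have hd3 := HasFDerivAt.comp x hd2 hζ
  have hfun : (fun y => Real.log (rho d μ t y)) =
      ((fun z : EuclideanSpace ℝ (Fin d) => -(d / 2) * Real.log (2 * π * t) - 1 / 2 * ‖z‖ ^ 2) +
        fun z => Real.log (sbJ (sbNu μ x₀) (fun _ => 1) (sbA t) z)) ∘
      fun y : EuclideanSpace ℝ (Fin d) => (Real.sqrt t)⁻¹ • (y - Real.sqrt (1 - t) • x₀) := by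
    funext y
    have hy : y = Real.sqrt (1 - t) • x₀ +
        Real.sqrt t • ((Real.sqrt t)⁻¹ • (y - Real.sqrt (1 - t) • x₀)) := by
      rw [smul_smul, mul_inv_cancel₀ hst, one_smul]; abel
    conv_lhs => rw [hy]
    rw [sb_log_rho μ x₀ t h0 h1]
    simp only [Function.comp, Pi.add_apply]
    ring
  rw [hfun]
  have hg : ∀ v : EuclideanSpace ℝ (Fin d), v i = inner ℝ v (EuclideanSpace.single i 1) :=
    fun v => by simp [EuclideanSpace.inner_single_right]
  have hg2 := hd3.fderiv
  rw [← toDual_gradient] at hg2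
  have hg3 := DFunLike.congr_fun hg2 (EuclideanSpace.single i 1)
  rw [InnerProductSpace.toDual_apply_apply, ← hg] at hg3
  rw [hg3]
  beta_reduce
  rw [← hz]
  have e' := e i
  simp only [one_mul] at e'
  simp [e', sbQ, ← hg]
  field_simp
  ring

lemma sb_condExp2 {d : ℕ} (μ : Measure (EuclideanSpace ℝ (Fin d))) [IsProbabilityMeasure μ]
    (x₀ : EuclideanSpace ℝ (Fin d)) (t : ℝ) (h0 : 0 < t) (h1 : t < 1) :
    condExpX0 d t x₀ (fun x => ‖t⁻¹ • (x - Real.sqrt (1 - t) • x₀)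
        + gradient (fun y => Real.log (rho d μ t y)) x‖ ^ 2) =
      t⁻¹ * sbA t ^ 2 * ∫ z, (∑ i, sbQ (sbNu μ x₀) i (sbA t) z ^ 2) * stdGaussianDensity d z := by
  unfold condExpX0
  rw [← integral_const_mul]
  congr 1
  ext z
  rw [← mul_assoc]
  congr 1
  have hst : Real.sqrt t ≠ 0 := (Real.sqrt_pos.mpr h0).ne'
  have hss : Real.sqrt t ^ 2 = t := Real.sq_sqrt h0.le
  beta_reduce
  rw [EuclideanSpace.norm_sq_eq, Finset.mul_sum]
  refine Finset.sum_congr rfl fun i _ => ?_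
  rw [PiLp.add_apply, sb_gradient μ x₀ t h0 h1, add_sub_cancel_left, PiLp.smul_apply,
    PiLp.smul_apply, Real.norm_eq_abs, sq_abs, smul_eq_mul, smul_eq_mul]
  have hti : t⁻¹ = (Real.sqrt t)⁻¹ ^ 2 := by rw [inv_pow, hss]
  have : t⁻¹ * (Real.sqrt t * z i) = (Real.sqrt t)⁻¹ * z i := by
    rw [hti]
    field_simp
  rw [this, hti]
  ring

lemma sb_intervalIntegral {d : ℕ} (G g : ℝ → ℝ) (t₁ t₂ : ℝ) (ht₁ : 0 < t₁) (ht₁₂ : t₁ < t₂)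
    (hG : ∀ t ∈ Set.Icc t₁ t₂, HasDerivAt G (g t) t) (hg : ∀ t ∈ Set.Icc t₁ t₂, 0 ≤ g t) :
    ∫ t in t₁..t₂, (g t - d / (2 * t)) =
      (-(d / 2) * Real.log (2 * π * t₂) + G t₂) - (-(d / 2) * Real.log (2 * π * t₁) + G t₁) := by
  have hu : Set.uIcc t₁ t₂ = Set.Icc t₁ t₂ := Set.uIcc_of_le ht₁₂.le
  have hpos : ∀ t ∈ Set.Icc t₁ t₂, 0 < t := fun t ht => ht₁.trans_le ht.1
  have i1 : IntervalIntegrable g volume t₁ t₂ := by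
    refine intervalIntegral.intervalIntegrable_deriv_of_nonneg (g := G) ?_ ?_ ?_
    · rw [hu]; exact fun t ht => (hG t ht).continuousAt.continuousWithinAt
    · rw [min_eq_left ht₁₂.le, max_eq_right ht₁₂.le]
      exact fun t ht => hG t (Set.Ioo_subset_Icc_self ht)
    · rw [min_eq_left ht₁₂.le, max_eq_right ht₁₂.le]
      exact fun t ht => hg t (Set.Ioo_subset_Icc_self ht)
  have i2 : IntervalIntegrable (fun t : ℝ => d / (2 * t)) volume t₁ t₂ := by
    refine ContinuousOn.intervalIntegrable ?_
    rw [hu]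
    exact continuousOn_const.div (by fun_prop) fun t ht => by
      have := hpos t ht
      positivity
  refine intervalIntegral.integral_eq_sub_of_hasDerivAt
    (f := fun t => -(d / 2) * Real.log (2 * π * t) + G t) ?_ (i1.sub i2)
  intro t ht
  rw [hu] at ht
  have ht0 := hpos t ht
  have h := ((((hasDerivAt_id t).const_mul (2 * π)).log
    (by simp only [id]; positivity)).const_mul (-(d / 2 : ℝ))).add (hG t ht)
  refine h.congr_deriv ?_
  simp only [id]
  field_simp
  ring

/-- **Score-based density formula (Theorem 1).** For `0 < t₁ < t₂ < 1`, and `ρ₀`-almost every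
`x₀`, the conditional expectation `E[log ρ_{t₂}(X_{t₂}) − log ρ_{t₁}(X_{t₁}) | X₀ = x₀]` equals
`∫_{t₁}^{t₂} ( (1/(2(1−t))) E[‖(X_t − √(1−t)X₀)/t + ∇log ρ_t(X_t)‖² | X₀ = x₀] − d/(2t) ) dt`. -/
theorem score_based_density_evolution
    (d : ℕ) (hd : 1 ≤ d) (μ : Measure (EuclideanSpace ℝ (Fin d))) [IsProbabilityMeasure μ]
    (t₁ t₂ : ℝ) (ht₁ : 0 < t₁) (ht₁₂ : t₁ < t₂) (ht₂ : t₂ < 1) :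
    ∀ᵐ x₀ ∂μ,
      condExpX0 d t₂ x₀ (fun x => Real.log (rho d μ t₂ x))
          - condExpX0 d t₁ x₀ (fun x => Real.log (rho d μ t₁ x))
        = ∫ t in t₁..t₂,
            ((1 / (2 * (1 - t))) *
              condExpX0 d t x₀ (fun x =>
                ‖t⁻¹ • (x - Real.sqrt (1 - t) • x₀)
                    + gradient (fun y => Real.log (rho d μ t y)) x‖ ^ 2)
              - d / (2 * t)) := by
  refine ae_of_all _ fun x₀ => ?_
  have := sbNu_prob μ x₀
  have hI : ∀ t ∈ Set.Icc t₁ t₂, 0 < t ∧ t < 1 := fun t ht =>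
    ⟨ht₁.trans_le ht.1, ht.2.trans_lt ht₂⟩
  have h1 := hI t₁ ⟨le_rfl, ht₁₂.le⟩
  have h2 := hI t₂ ⟨ht₁₂.le, le_rfl⟩
  rw [sb_condExp μ x₀ t₁ h1.1 h1.2, sb_condExp μ x₀ t₂ h2.1 h2.2]
  rw [sb_intervalIntegral (d := d) (fun t => ∫ z, Real.log (sbJ (sbNu μ x₀) (fun _ => 1) (sbA t) z) *
    stdGaussianDensity d z) _ t₁ t₂ ht₁ ht₁₂]
  · ring
  · intro t ht
    obtain ⟨t0, t1⟩ := hI t ht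
    have hA := sbA_pos t t0 t1
    have h := (sb_main (sbNu μ x₀) (sbA t) hA).comp t (sbA_hasDerivAt t t0 t1)
    refine h.congr_deriv ?_
    rw [sb_condExp2 μ x₀ t t0 t1, sbA_sq t t0 t1]
    have h3 : 1 - t ≠ 0 := by linarith
    field_simp
  · intro t ht
    obtain ⟨t0, t1⟩ := hI t ht
    rw [sb_condExp2 μ x₀ t t0 t1]
    have h3 : 0 < 1 - t := by linarith
    refine mul_nonneg (by positivity) (mul_nonneg (by positivity) (integral_nonneg fun z => ?_))
    exact mul_nonneg (Finset.sum_nonneg fun i _ => sq_nonneg _) (sbGauss_pos z).le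
end
end

section
/- Suppose E[‖X₀‖₂²] < ∞. Then for every x₀ ∈ ℝ^d, lim_{t→1⁻} E[log ρ_t(X_t) | X₀ = x₀] = −(1 + log(2π)) d / 2. -/
open MeasureTheory Real Filter
open scoped ENNReal

noncomputable section

/-- The polar-coordinate identity `∫ ‖z‖² exp(-‖z‖²/2) = d ∫ exp(-‖z‖²/2)`. -/
lemma aux_second_moment (d : ℕ) (hd : 1 ≤ d) :
    ∫ z : EuclideanSpace ℝ (Fin d), ‖z‖ ^ 2 * Real.exp (-‖z‖ ^ 2 / 2)
      = d * ∫ z : EuclideanSpace ℝ (Fin d), Real.exp (-‖z‖ ^ 2 / 2) := by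
  have : Nonempty (Fin d) := ⟨⟨0, hd⟩⟩
  have hd0 : (0 : ℝ) < d := by exact_mod_cast hd
  have e1 := integral_fun_norm_addHaar (volume : Measure (EuclideanSpace ℝ (Fin d)))
    (fun r : ℝ => r ^ 2 * Real.exp (-r ^ 2 / 2))
  have e2 := integral_fun_norm_addHaar (volume : Measure (EuclideanSpace ℝ (Fin d)))
    (fun r : ℝ => Real.exp (-r ^ 2 / 2))
  rw [finrank_euclideanSpace_fin] at e1 e2
  rw [e1, e2]
  have hA : ∫ y in Set.Ioi (0 : ℝ), y ^ (d - 1) • Real.exp (-y ^ 2 / 2)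
      = ∫ y in Set.Ioi (0 : ℝ), y ^ ((d : ℝ) - 1) * Real.exp (-(1 / 2) * y ^ (2 : ℝ)) := by
    refine setIntegral_congr_fun measurableSet_Ioi (fun y hy => ?_)
    have : y ^ ((d : ℝ) - 1) = y ^ (d - 1) := by
      rw [← Real.rpow_natCast, Nat.cast_sub hd, Nat.cast_one]
    simp only [smul_eq_mul, this, Real.rpow_two]
    congr 2
    ring
  have hB : ∫ y in Set.Ioi (0 : ℝ), y ^ (d - 1) • (y ^ 2 * Real.exp (-y ^ 2 / 2))
      = ∫ y in Set.Ioi (0 : ℝ), y ^ ((d : ℝ) + 1) * Real.exp (-(1 / 2) * y ^ (2 : ℝ)) := by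
    refine setIntegral_congr_fun measurableSet_Ioi (fun y hy => ?_)
    have : y ^ ((d : ℝ) + 1) = y ^ (d - 1) * y ^ 2 := by
      rw [← pow_add, ← Real.rpow_natCast]
      congr 1
      have : d - 1 + 2 = d + 1 := by omega
      rw [this]; push_cast; ring
    simp only [smul_eq_mul, this, Real.rpow_two]
    rw [mul_assoc]
    congr 3
    ring
  have hAB : ∫ y in Set.Ioi (0 : ℝ), y ^ (d - 1) • (y ^ 2 * Real.exp (-y ^ 2 / 2))
      = d * ∫ y in Set.Ioi (0 : ℝ), y ^ (d - 1) • Real.exp (-y ^ 2 / 2) := by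
    rw [hA, hB, integral_rpow_mul_exp_neg_mul_rpow (by norm_num) (by linarith) (by norm_num),
      integral_rpow_mul_exp_neg_mul_rpow (by norm_num) (by linarith) (by norm_num)]
    have h1 : ((d : ℝ) + 1 + 1) / 2 = d / 2 + 1 := by ring
    have h2 : ((d : ℝ) - 1 + 1) / 2 = d / 2 := by ring
    have h3 : -((d : ℝ) + 1 + 1) / 2 = -(d / 2) - 1 := by ring
    have h4 : -((d : ℝ) - 1 + 1) / 2 = -(d / 2) := by ring
    rw [h1, h2, h3, h4, Real.Gamma_add_one (by positivity), Real.rpow_sub_one (by norm_num)]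
    ring
  rw [hAB]
  simp only [nsmul_eq_mul, smul_eq_mul]
  ring

lemma aux_gauss_integral (d : ℕ) :
    ∫ z : EuclideanSpace ℝ (Fin d), Real.exp (-‖z‖ ^ 2 / 2) = (2 * π) ^ ((d : ℝ) / 2) := by
  have h := GaussianFourier.integral_rexp_neg_mul_sq_norm
    (V := EuclideanSpace ℝ (Fin d)) (b := 1 / 2) (by norm_num)
  have e : (fun z : EuclideanSpace ℝ (Fin d) => Real.exp (-‖z‖ ^ 2 / 2))
      = fun z => Real.exp (-(1 / 2) * ‖z‖ ^ 2) := by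
    funext z; congr 1; ring
  rw [e, h, finrank_euclideanSpace_fin]
  congr 1
  field_simp

lemma aux_total (d : ℕ) :
    ∫ z : EuclideanSpace ℝ (Fin d), stdGaussianDensity d z = 1 := by
  simp only [stdGaussianDensity]
  rw [integral_const_mul, aux_gauss_integral, ← Real.rpow_add (by positivity)]
  rw [show -(d : ℝ) / 2 + d / 2 = 0 by ring, Real.rpow_zero]

lemma aux_moment (d : ℕ) (hd : 1 ≤ d) :
    ∫ z : EuclideanSpace ℝ (Fin d), ‖z‖ ^ 2 * stdGaussianDensity d z = d := by
  have h : ∀ z : EuclideanSpace ℝ (Fin d), ‖z‖ ^ 2 * stdGaussianDensity d z =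
      (2 * π) ^ (-(d : ℝ) / 2) * (‖z‖ ^ 2 * Real.exp (-‖z‖ ^ 2 / 2)) := fun z => by
    simp only [stdGaussianDensity]; ring
  simp only [h]
  rw [integral_const_mul, aux_second_moment d hd, mul_left_comm, ← integral_const_mul]
  have := aux_total d
  simp only [stdGaussianDensity] at this
  rw [this, mul_one]

lemma aux_int0 (d : ℕ) :
    Integrable (fun z : EuclideanSpace ℝ (Fin d) => stdGaussianDensity d z) :=
  .of_integral_ne_zero (by rw [aux_total]; norm_num)

lemma aux_int2 (d : ℕ) (hd : 1 ≤ d) :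
    Integrable (fun z : EuclideanSpace ℝ (Fin d) => ‖z‖ ^ 2 * stdGaussianDensity d z) :=
  .of_integral_ne_zero (by rw [aux_moment d hd]; exact_mod_cast (by omega))

/-- The unnormalised mixture integral. -/
def auxI (d : ℕ) (μ : Measure (EuclideanSpace ℝ (Fin d))) (t : ℝ)
    (x : EuclideanSpace ℝ (Fin d)) : ℝ :=
  ∫ y, Real.exp (-‖x - Real.sqrt (1 - t) • y‖ ^ 2 / (2 * t)) ∂μ

lemma aux_exp_le_one (d : ℕ) {t : ℝ} (ht : 0 < t) (x y : EuclideanSpace ℝ (Fin d)) :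
    Real.exp (-‖x - Real.sqrt (1 - t) • y‖ ^ 2 / (2 * t)) ≤ 1 := by
  rw [Real.exp_le_one_iff]
  exact div_nonpos_of_nonpos_of_nonneg (neg_nonpos.2 (sq_nonneg _)) (by positivity)

lemma aux_integrable (d : ℕ) (μ : Measure (EuclideanSpace ℝ (Fin d))) [IsProbabilityMeasure μ]
    {t : ℝ} (ht : 0 < t) (x : EuclideanSpace ℝ (Fin d)) :
    Integrable (fun y => Real.exp (-‖x - Real.sqrt (1 - t) • y‖ ^ 2 / (2 * t))) μ := by
  refine Integrable.of_bound (C := 1) (Continuous.aestronglyMeasurable (by fun_prop)) ?_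
  filter_upwards with y
  rw [Real.norm_of_nonneg (Real.exp_pos _).le]
  exact aux_exp_le_one d ht x y

lemma auxI_pos (d : ℕ) (μ : Measure (EuclideanSpace ℝ (Fin d))) [IsProbabilityMeasure μ]
    {t : ℝ} (ht : 0 < t) (x : EuclideanSpace ℝ (Fin d)) : 0 < auxI d μ t x :=
  integral_exp_pos (aux_integrable d μ ht x)

lemma auxI_le_one (d : ℕ) (μ : Measure (EuclideanSpace ℝ (Fin d))) [IsProbabilityMeasure μ]
    {t : ℝ} (ht : 0 < t) (x : EuclideanSpace ℝ (Fin d)) : auxI d μ t x ≤ 1 := by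
  have := integral_mono (aux_integrable d μ ht x) (integrable_const (1 : ℝ))
    (fun y => aux_exp_le_one d ht x y)
  simpa [auxI] using this

lemma auxI_continuous (d : ℕ) (μ : Measure (EuclideanSpace ℝ (Fin d))) [IsProbabilityMeasure μ]
    {t : ℝ} (ht : 0 < t) : Continuous (auxI d μ t) := by
  refine continuous_of_dominated (bound := fun _ => (1 : ℝ))
    (fun x => (aux_integrable d μ ht x).aestronglyMeasurable) (fun x => ?_)
    (integrable_const _) ?_
  · filter_upwards with y
    rw [Real.norm_of_nonneg (Real.exp_pos _).le]
    exact aux_exp_le_one d ht x y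
  · filter_upwards with y
    fun_prop

lemma aux_log_rho (d : ℕ) (μ : Measure (EuclideanSpace ℝ (Fin d))) [IsProbabilityMeasure μ]
    {t : ℝ} (ht : 0 < t) (x : EuclideanSpace ℝ (Fin d)) :
    Real.log (rho d μ t x) = -(d : ℝ) / 2 * Real.log (2 * π * t) + Real.log (auxI d μ t x) := by
  have h : rho d μ t x = (2 * π * t) ^ (-(d : ℝ) / 2) * auxI d μ t x := by
    simp only [rho, heatKernel, auxI]
    rw [integral_const_mul]
  rw [h, Real.log_mul (by positivity) (auxI_pos d μ ht x).ne', Real.log_rpow (by positivity)]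

/-- Lower bound constant. -/
def auxC (d : ℕ) (μ : Measure (EuclideanSpace ℝ (Fin d))) (x₀ : EuclideanSpace ℝ (Fin d)) : ℝ :=
  ∫ y, Real.exp (-‖x₀ - y‖ ^ 2) ∂μ

lemma auxC_integrable (d : ℕ) (μ : Measure (EuclideanSpace ℝ (Fin d))) [IsProbabilityMeasure μ]
    (x₀ : EuclideanSpace ℝ (Fin d)) : Integrable (fun y => Real.exp (-‖x₀ - y‖ ^ 2)) μ := by
  refine Integrable.of_bound (C := 1) (Continuous.aestronglyMeasurable (by fun_prop)) ?_
  filter_upwards with y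
  rw [Real.norm_of_nonneg (Real.exp_pos _).le, Real.exp_le_one_iff]
  exact neg_nonpos.2 (sq_nonneg _)

lemma aux_lower (d : ℕ) (μ : Measure (EuclideanSpace ℝ (Fin d))) [IsProbabilityMeasure μ]
    {t : ℝ} (ht : 1 / 2 < t) (ht1 : t < 1) (x₀ z : EuclideanSpace ℝ (Fin d)) :
    -‖z‖ ^ 2 + Real.log (auxC d μ x₀)
      ≤ Real.log (auxI d μ t (Real.sqrt (1 - t) • x₀ + Real.sqrt t • z)) := by
  have ht0 : 0 < t := by linarith
  have hC : 0 < auxC d μ x₀ := integral_exp_pos (auxC_integrable d μ x₀)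
  have key : Real.exp (-‖z‖ ^ 2) * auxC d μ x₀
      ≤ auxI d μ t (Real.sqrt (1 - t) • x₀ + Real.sqrt t • z) := by
    rw [auxC, ← integral_const_mul]
    refine integral_mono ((auxC_integrable d μ x₀).const_mul _) (aux_integrable d μ ht0 _)
      (fun y => ?_)
    simp only
    rw [← Real.exp_add, Real.exp_le_exp]
    have e : Real.sqrt (1 - t) • x₀ + Real.sqrt t • z - Real.sqrt (1 - t) • y
        = Real.sqrt (1 - t) • (x₀ - y) + Real.sqrt t • z := by
      rw [smul_sub]; abel
    have n1 : ‖Real.sqrt (1 - t) • (x₀ - y)‖ ^ 2 = (1 - t) * ‖x₀ - y‖ ^ 2 := by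
      rw [norm_smul, mul_pow, Real.norm_of_nonneg (Real.sqrt_nonneg _),
        Real.sq_sqrt (by linarith)]
    have n2 : ‖Real.sqrt t • z‖ ^ 2 = t * ‖z‖ ^ 2 := by
      rw [norm_smul, mul_pow, Real.norm_of_nonneg (Real.sqrt_nonneg _), Real.sq_sqrt ht0.le]
    have tri := norm_add_le (Real.sqrt (1 - t) • (x₀ - y)) (Real.sqrt t • z)
    have sq : ‖Real.sqrt (1 - t) • (x₀ - y) + Real.sqrt t • z‖ ^ 2
        ≤ 2 * ((1 - t) * ‖x₀ - y‖ ^ 2) + 2 * (t * ‖z‖ ^ 2) := by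
      rw [← n1, ← n2]
      have := pow_le_pow_left₀ (norm_nonneg _) tri 2
      nlinarith [sq_nonneg (‖Real.sqrt (1 - t) • (x₀ - y)‖ - ‖Real.sqrt t • z‖)]
    rw [e, le_div_iff₀ (by positivity)]
    nlinarith [sq_nonneg ‖x₀ - y‖, mul_nonneg (sq_nonneg ‖x₀ - y‖) (by linarith : 0 ≤ 2 * t - 1)]
  have := Real.log_le_log (by positivity) key
  rwa [Real.log_mul (Real.exp_pos _).ne' hC.ne', Real.log_exp] at this

lemma aux_tendsto (d : ℕ) (μ : Measure (EuclideanSpace ℝ (Fin d))) [IsProbabilityMeasure μ]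
    (x₀ z : EuclideanSpace ℝ (Fin d)) :
    Tendsto (fun t => auxI d μ t (Real.sqrt (1 - t) • x₀ + Real.sqrt t • z))
      (nhdsWithin 1 (Set.Iio 1)) (nhds (Real.exp (-‖z‖ ^ 2 / 2))) := by
  have hpos : ∀ᶠ t : ℝ in nhdsWithin 1 (Set.Iio 1), 0 < t :=
    nhdsWithin_le_nhds (lt_mem_nhds one_pos)
  have : Real.exp (-‖z‖ ^ 2 / 2) = ∫ _y, Real.exp (-‖z‖ ^ 2 / 2) ∂μ := by simp
  rw [this]
  refine tendsto_integral_filter_of_dominated_convergence (fun _ => (1 : ℝ)) ?_ ?_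
    (integrable_const _) ?_
  · filter_upwards [hpos] with t ht
    exact (aux_integrable d μ ht _).aestronglyMeasurable
  · filter_upwards [hpos] with t ht
    filter_upwards with y
    rw [Real.norm_of_nonneg (Real.exp_pos _).le]
    exact aux_exp_le_one d ht _ y
  · filter_upwards with y
    have hc : ContinuousAt (fun t : ℝ => Real.exp (-‖Real.sqrt (1 - t) • x₀ + Real.sqrt t • z
        - Real.sqrt (1 - t) • y‖ ^ 2 / (2 * t))) 1 := by
      refine ContinuousAt.rexp (ContinuousAt.div ?_ ?_ (by norm_num))
      · exact Continuous.continuousAt (by fun_prop)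
      · exact Continuous.continuousAt (by fun_prop)
    have h := hc.tendsto.mono_left (nhdsWithin_le_nhds (s := Set.Iio 1))
    simpa using h

/-- **Proposition 1.** If `E[‖X₀‖²] < ∞`, then for every `x₀ ∈ ℝ^d`,
`lim_{t→1⁻} E[log ρ_t(X_t) | X₀ = x₀] = −(1 + log(2π))·d/2`. -/
theorem limit_condExp_log_density_at_one
    (d : ℕ) (hd : 1 ≤ d) (μ : Measure (EuclideanSpace ℝ (Fin d))) [IsProbabilityMeasure μ]
    (hmom : Integrable (fun x₀ : EuclideanSpace ℝ (Fin d) => ‖x₀‖ ^ 2) μ)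
    (x₀ : EuclideanSpace ℝ (Fin d)) :
    Tendsto (fun t => condExpX0 d t x₀ (fun x => Real.log (rho d μ t x)))
      (nhdsWithin 1 (Set.Iio 1)) (nhds (-((1 + Real.log (2 * π)) / 2 * d))) := by
  have hmem : ∀ᶠ t : ℝ in nhdsWithin 1 (Set.Iio 1), 1 / 2 < t ∧ t < 1 := by
    filter_upwards [nhdsWithin_le_nhds (lt_mem_nhds (by norm_num : (1 / 2 : ℝ) < 1)),
      self_mem_nhdsWithin] with t h1 h2 using ⟨h1, h2⟩
  have hgpos : ∀ z : EuclideanSpace ℝ (Fin d), 0 ≤ stdGaussianDensity d z := fun z => by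
    unfold stdGaussianDensity; positivity
  have hgcont : Continuous (stdGaussianDensity d) := by
    unfold stdGaussianDensity; fun_prop
  have hlim : -((1 + Real.log (2 * π)) / 2 * d) = ∫ z : EuclideanSpace ℝ (Fin d),
      (-(d : ℝ) / 2 * Real.log (2 * π * 1) + -‖z‖ ^ 2 / 2) * stdGaussianDensity d z := by
    have e : ∀ z : EuclideanSpace ℝ (Fin d),
        (-(d : ℝ) / 2 * Real.log (2 * π * 1) + -‖z‖ ^ 2 / 2) * stdGaussianDensity d z
        = (-(d : ℝ) / 2 * Real.log (2 * π)) * stdGaussianDensity d z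
          + (-1 / 2) * (‖z‖ ^ 2 * stdGaussianDensity d z) := fun z => by
      rw [mul_one]; ring
    simp only [e]
    rw [integral_add ((aux_int0 d).const_mul _) ((aux_int2 d hd).const_mul _),
      integral_const_mul, integral_const_mul, aux_total, aux_moment d hd]
    ring
  rw [hlim]
  unfold condExpX0
  refine tendsto_integral_filter_of_dominated_convergence
    (fun z => ((d : ℝ) / 2 * Real.log (2 * π) + |Real.log (auxC d μ x₀)|) * stdGaussianDensity d z
      + ‖z‖ ^ 2 * stdGaussianDensity d z) ?_ ?_
    (((aux_int0 d).const_mul _).add (aux_int2 d hd)) ?_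
  · filter_upwards [hmem] with t ht
    have ht0 : 0 < t := by linarith [ht.1]
    simp only [aux_log_rho d μ ht0]
    refine Continuous.aestronglyMeasurable (Continuous.mul (continuous_const.add ?_) hgcont)
    exact Continuous.log ((auxI_continuous d μ ht0).comp (by fun_prop))
      (fun z => (auxI_pos d μ ht0 _).ne')
  · filter_upwards [hmem] with t ht
    have ht0 : 0 < t := by linarith [ht.1]
    filter_upwards with z
    rw [aux_log_rho d μ ht0, norm_mul, Real.norm_of_nonneg (hgpos z), ← add_mul]
    refine mul_le_mul_of_nonneg_right ?_ (hgpos z)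
    have hlo := aux_lower d μ ht.1 ht.2 x₀ z
    have hhi := Real.log_nonpos (auxI_pos d μ ht0 (Real.sqrt (1 - t) • x₀ + Real.sqrt t • z)).le
      (auxI_le_one d μ ht0 _)
    have hl0 : 0 ≤ Real.log (2 * π * t) :=
      Real.log_nonneg (by nlinarith [Real.pi_gt_three, ht.1])
    have hl1 : Real.log (2 * π * t) ≤ Real.log (2 * π) :=
      Real.log_le_log (by positivity) (by nlinarith [Real.pi_pos, ht.2])
    have hdn : (0 : ℝ) ≤ (d : ℝ) / 2 := by positivity
    have p0 := mul_nonneg hdn hl0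
    have p1 := mul_le_mul_of_nonneg_left hl1 hdn
    have hab := neg_abs_le (Real.log (auxC d μ x₀))
    have hab2 := abs_nonneg (Real.log (auxC d μ x₀))
    have hz := sq_nonneg ‖z‖
    have e : -(d : ℝ) / 2 * Real.log (2 * π * t) = -((d : ℝ) / 2 * Real.log (2 * π * t)) := by ring
    rw [Real.norm_eq_abs, abs_le, e]
    constructor <;> linarith
  · filter_upwards with z
    have h1 : Tendsto (fun t : ℝ => -(d : ℝ) / 2 * Real.log (2 * π * t))
        (nhdsWithin 1 (Set.Iio 1)) (nhds (-(d : ℝ) / 2 * Real.log (2 * π * 1))) := by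
      have hc : ContinuousAt (fun t : ℝ => -(d : ℝ) / 2 * Real.log (2 * π * t)) 1 :=
        continuousAt_const.mul (ContinuousAt.log (by fun_prop) (by positivity))
      exact hc.tendsto.mono_left nhdsWithin_le_nhds
    have h2 := (aux_tendsto d μ x₀ z).log (Real.exp_pos _).ne'
    rw [Real.log_exp] at h2
    refine Tendsto.congr' ?_ ((h1.add h2).mul_const (stdGaussianDensity d z))
    filter_upwards [hmem] with t ht
    rw [aux_log_rho d μ (by linarith [ht.1])]
end
end

section
/- Suppose X₀ has a smooth density ρ₀ with E[‖X₀‖₂²] < ∞ and sup_x ‖∇² log ρ₀(x)‖ < ∞. Then for every x₀ ∈ ℝ^d, log ρ₀(x₀) = −(1 + log(2π)) d / 2 − ∫₀¹ D(t, x₀) dt, where D(t, x) := (1/(2(1−t))) · E[ ‖(X_t − √(1−t) X₀)/t + ∇log ρ_t(X_t)‖₂² | X₀ = x ] − d/(2t). -/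
open MeasureTheory Real Filter
open scoped ENNReal

noncomputable section

/-- The integrand `D(t, x) := (1/(2(1−t))) · E[‖(X_t − √(1−t)X₀)/t + ∇log ρ_t(X_t)‖² | X₀ = x]
− d/(2t)` appearing in the score-based density formula. -/
def scoreIntegrand (d : ℕ) (μ : Measure (EuclideanSpace ℝ (Fin d))) (t : ℝ)
    (x : EuclideanSpace ℝ (Fin d)) : ℝ :=
  (1 / (2 * (1 - t))) *
      condExpX0 d t x (fun xt =>
        ‖t⁻¹ • (xt - Real.sqrt (1 - t) • x)
            + gradient (fun y => Real.log (rho d μ t y)) xt‖ ^ 2)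
    - d / (2 * t)

namespace SBD

set_option linter.unusedSectionVars false

variable {E : Type*} [NormedAddCommGroup E] [InnerProductSpace ℝ E] [FiniteDimensional ℝ E]
  [MeasurableSpace E] [BorelSpace E]

/-- Gaussian density on `E`. -/
def gd (z : E) : ℝ :=
  (2 * π) ^ (-(Module.finrank ℝ E : ℝ) / 2) * Real.exp (-‖z‖ ^ 2 / 2)

/-- tilting kernel -/
def kap (u : ℝ) (z v : E) : ℝ := Real.exp (u * inner ℝ z v - u ^ 2 * ‖v‖ ^ 2 / 2)

/-- unnormalised posterior integral -/
def Pm (ν : Measure E) (φ : E → ℝ) (u : ℝ) (z : E) : ℝ := ∫ v, φ v * kap u z v ∂ν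

/-- normalisation -/
def Mm (ν : Measure E) (u : ℝ) (z : E) : ℝ := ∫ v, kap u z v ∂ν

/-- unnormalised posterior mean -/
def Bv (ν : Measure E) (u : ℝ) (z : E) : E := ∫ v, kap u z v • v ∂ν

lemma gd_pos (z : E) : 0 < gd z := by unfold gd; positivity

lemma gd_cont : Continuous (gd : E → ℝ) := by unfold gd; fun_prop

lemma integrable_gauss (b : ℝ) (hb : 0 < b) : Integrable (fun z : E => Real.exp (-b * ‖z‖ ^ 2)) := by
  by_contra h
  have h1 := GaussianFourier.integral_rexp_neg_mul_sq_norm (V := E) hb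
  rw [integral_undef h] at h1
  have : 0 < (π / b) ^ ((Module.finrank ℝ E : ℝ) / 2) := by positivity
  linarith

lemma integral_exp_half : ∫ z : E, Real.exp (-‖z‖ ^ 2 / 2) = (2 * π) ^ ((Module.finrank ℝ E : ℝ) / 2) := by
  have h1 := GaussianFourier.integral_rexp_neg_mul_sq_norm (V := E) (b := 1/2) (by norm_num)
  rw [show (2 * π) = π / (1/2) by ring, ← h1]
  congr 1; ext z; congr 1; ring

lemma integral_gd : ∫ z : E, gd z = 1 := by
  unfold gd
  rw [integral_const_mul, integral_exp_half, ← Real.rpow_add (by positivity)]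
  rw [show -(Module.finrank ℝ E : ℝ) / 2 + (Module.finrank ℝ E : ℝ) / 2 = 0 by ring, Real.rpow_zero]

lemma integrable_gd : Integrable (gd : E → ℝ) := by
  unfold gd
  apply Integrable.const_mul
  refine (integrable_gauss (E := E) (1/2) (by norm_num)).congr (ae_of_all _ fun z => ?_)
  dsimp only; congr 1; ring

lemma integrable_sq_gd : Integrable (fun z : E => ‖z‖ ^ 2 * gd z) := by
  have h := ((integrable_gauss (E := E) (1/4) (by norm_num)).const_mul
    (4 * (2 * π) ^ (-(Module.finrank ℝ E : ℝ) / 2)))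
  refine h.mono' (by have := gd_cont (E := E); fun_prop) (ae_of_all _ fun z => ?_)
  have h0 := gd_pos z
  rw [Real.norm_of_nonneg (by positivity)]
  unfold gd
  have h1 : ‖z‖ ^ 2 ≤ 4 * Real.exp (‖z‖ ^ 2 / 4) := by
    have := Real.add_one_le_exp (‖z‖ ^ 2 / 4); linarith
  have h2 : Real.exp (-‖z‖ ^ 2 / 2) = Real.exp (-(‖z‖^2/4)) * Real.exp (-(1/4) * ‖z‖^2) := by
    rw [← Real.exp_add]; congr 1; ring
  have h3 : Real.exp (‖z‖ ^ 2 / 4) * Real.exp (-(‖z‖^2/4)) = 1 := by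
    rw [← Real.exp_add]; simp
  rw [h2]
  set c := (2 * π) ^ (-(Module.finrank ℝ E : ℝ) / 2)
  have hc : 0 < c := by positivity
  calc ‖z‖ ^ 2 * (c * (Real.exp (-(‖z‖^2/4)) * Real.exp (-(1/4) * ‖z‖^2)))
      ≤ (4 * Real.exp (‖z‖ ^ 2 / 4)) * (c * (Real.exp (-(‖z‖^2/4)) * Real.exp (-(1/4) * ‖z‖^2))) := by
        gcongr
    _ = 4 * c * (Real.exp (‖z‖ ^ 2 / 4) * Real.exp (-(‖z‖^2/4))) * Real.exp (-(1/4) * ‖z‖^2) := by ring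
    _ = _ := by rw [h3]; ring

/-- domination by quadratics -/
lemma integrable_quad_gd {f : E → ℝ} (hf : AEStronglyMeasurable f volume) (a b : ℝ)
    (h : ∀ z, |f z| ≤ a + b * ‖z‖ ^ 2) : Integrable (fun z : E => f z * gd z) := by
  have h1 := ((integrable_gd (E := E)).const_mul a).add ((integrable_sq_gd (E := E)).const_mul b)
  refine h1.mono' (hf.mul gd_cont.aestronglyMeasurable) (ae_of_all _ fun z => ?_)
  rw [norm_mul, Real.norm_eq_abs, Real.norm_of_nonneg (gd_pos z).le]
  simp only [Pi.add_apply]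
  have := mul_le_mul_of_nonneg_right (h z) (gd_pos z).le
  linarith

lemma gd_hasFDerivAt (z : E) : HasFDerivAt (gd : E → ℝ) (-(gd z) • innerSL ℝ z) z := by
  have h1 : HasFDerivAt (fun z : E => ‖z‖ ^ 2) (2 • (innerSL ℝ z)) z := by
    simpa using (hasStrictFDerivAt_norm_sq z).hasFDerivAt
  have h2 := ((h1.const_mul (-1/2 : ℝ)).exp).const_mul ((2 * π) ^ (-(Module.finrank ℝ E : ℝ) / 2))
  have h3 : (gd : E → ℝ) = fun z => (2 * π) ^ (-(Module.finrank ℝ E : ℝ) / 2) * Real.exp (-1/2 * ‖z‖ ^ 2) := by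
    ext z; unfold gd; congr 2; ring
  have h4 : gd z = (2 * π) ^ (-(Module.finrank ℝ E : ℝ) / 2) * Real.exp (-1/2 * ‖z‖ ^ 2) := by
    rw [h3]
  rw [h4, h3]
  refine h2.congr_fderiv ?_
  ext w
  simp
  ring

/-- one-directional Stein identity -/
lemma stein_dir {f f' : E → ℝ} (e : E)
    (hf : ∀ z, HasLineDerivAt ℝ f (f' z) z e)
    (h1 : Integrable (fun z => f' z * gd z)) (h2 : Integrable (fun z => f z * (inner ℝ z e * gd z)))
    (h3 : Integrable (fun z => f z * gd z)) :
    ∫ z, f z * (inner ℝ z e * gd z) = ∫ z, f' z * gd z := by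
  have := integral_bilinear_hasLineDerivAt_right_eq_neg_left_of_integrable (μ := (volume : Measure E))
    (f := f) (f' := f') (g := gd) (g' := fun z => -(inner ℝ z e * gd z)) (v := e)
    (B := ContinuousLinearMap.mul ℝ ℝ) (by simpa using h1) (by simpa using h2.neg) (by simpa using h3)
    (fun z _ => hf z) (fun z _ => by
      have := (gd_hasFDerivAt z).hasLineDerivAt e
      convert this using 1
      simp; ring)
  simp only [ContinuousLinearMap.mul_apply', mul_neg, integral_neg] at this
  linarith

lemma gd_neg (z : E) : gd (-z) = gd z := by unfold gd; simp

lemma integral_inner_gd (e : E) : ∫ z : E, inner ℝ z e * gd z = 0 := by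
  have := integral_neg_eq_self (fun z : E => inner ℝ z e * gd z) volume
  simp only [gd_neg, inner_neg_left, neg_mul, integral_neg] at this
  linarith

lemma inner_bd (z e : E) : |inner ℝ z e| ≤ ‖e‖ ^ 2 + 1 * ‖z‖ ^ 2 := by
  have := abs_real_inner_le_norm z e
  nlinarith [sq_nonneg (‖z‖ - ‖e‖), sq_nonneg ‖z‖, sq_nonneg ‖e‖]

lemma integral_sq_gd : ∫ z : E, ‖z‖ ^ 2 * gd z = Module.finrank ℝ E := by
  let bs := stdOrthonormalBasis ℝ E
  have key : ∀ i, Integrable (fun z : E => inner ℝ z (bs i) * (inner ℝ z (bs i) * gd z)) ∧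
      ∫ z : E, inner ℝ z (bs i) * (inner ℝ z (bs i) * gd z) = 1 := by
    intro i
    have hn : ‖bs i‖ = 1 := bs.orthonormal.1 i
    have hintg : Integrable (fun z : E => inner ℝ z (bs i) * (inner ℝ z (bs i) * gd z)) := by
      have := integrable_quad_gd (f := fun z : E => inner ℝ z (bs i) * inner ℝ z (bs i))
        (by fun_prop) 0 1 (fun z => by
          rw [abs_mul]
          have := abs_real_inner_le_norm z (bs i)
          rw [hn] at this
          nlinarith [abs_nonneg (inner ℝ z (bs i))])
      simpa only [mul_assoc] using this
    refine ⟨hintg, ?_⟩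
    rw [stein_dir (f' := fun _ => 1) (bs i) (fun z => ?_) (by simpa using integrable_gd) hintg
      (integrable_quad_gd (by fun_prop) _ _ (fun z => inner_bd z (bs i)))]
    · simpa using integral_gd
    · have : HasFDerivAt (fun z : E => inner ℝ z (bs i)) (innerSL ℝ (bs i)) z := by
        have := (innerSL ℝ (bs i)).hasFDerivAt (x := z)
        refine this.congr_of_eventuallyEq (Eventually.of_forall fun y => ?_)
        simp [real_inner_comm]
      convert this.hasLineDerivAt (bs i) using 1
      simp [hn]
  have h2 : ∀ z : E, ‖z‖ ^ 2 * gd z = ∑ i, inner ℝ z (bs i) * (inner ℝ z (bs i) * gd z) := by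
    intro z
    rw [← bs.sum_sq_norm_inner_left z, Finset.sum_mul]
    refine Finset.sum_congr rfl fun i _ => ?_
    rw [Real.norm_eq_abs, sq_abs, ]
    ring
  simp_rw [h2]
  rw [integral_finsetSum _ (fun i _ => (key i).1)]
  simp [(key _).2]


lemma kap_eq (u : ℝ) (z v : E) :
    kap u z v = Real.exp (‖z‖ ^ 2 / 2 - ‖z - u • v‖ ^ 2 / 2) := by
  unfold kap
  congr 1
  rw [norm_sub_sq_real, inner_smul_right, norm_smul, mul_pow, Real.norm_eq_abs, sq_abs]
  ring

lemma kap_pos (u : ℝ) (z v : E) : 0 < kap u z v := Real.exp_pos _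

lemma kap_le (u : ℝ) (z v : E) : kap u z v ≤ Real.exp (‖z‖ ^ 2 / 2) := by
  rw [kap_eq]
  apply Real.exp_le_exp.2
  nlinarith [sq_nonneg ‖z - u • v‖]

lemma kap_cont (u : ℝ) (z : E) : Continuous (kap u z) := by unfold kap; fun_prop

lemma kap_cont2 (u : ℝ) : Continuous (Function.uncurry (kap u : E → E → ℝ)) := by
  unfold kap Function.uncurry; fun_prop

lemma integrable_mul_kap {ν : Measure E} {φ : E → ℝ} (hφ : Integrable φ ν) (u : ℝ) (z : E) :
    Integrable (fun v => φ v * kap u z v) ν := by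
  refine (hφ.norm.mul_const (Real.exp (‖z‖ ^ 2 / 2))).mono'
    (hφ.1.mul (kap_cont u z).aestronglyMeasurable) (ae_of_all _ fun v => ?_)
  rw [norm_mul, Real.norm_of_nonneg (kap_pos u z v).le]
  exact mul_le_mul_of_nonneg_left (kap_le u z v) (norm_nonneg _)

lemma integrable_kap (ν : Measure E) [IsProbabilityMeasure ν] (u : ℝ) (z : E) :
    Integrable (kap u z) ν := by
  simpa using integrable_mul_kap (integrable_const (1:ℝ) (μ := ν)) u z

lemma Mm_pos (ν : Measure E) [IsProbabilityMeasure ν] (u : ℝ) (z : E) : 0 < Mm ν u z := by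
  unfold Mm
  rw [integral_pos_iff_support_of_nonneg (fun v => (kap_pos u z v).le) (integrable_kap ν u z)]
  have : Function.support (kap u z) = Set.univ := by
    ext v; simpa using (kap_pos u z v).ne'
  rw [this]; simp

lemma Mm_eq_Pm (ν : Measure E) : Mm ν = Pm ν (fun _ => 1) := by
  ext u z; simp [Mm, Pm]

lemma int_norm {ν : Measure E} [IsProbabilityMeasure ν] (hm : Integrable (fun v => ‖v‖ ^ 2) ν) :
    Integrable (fun v => ‖v‖) ν := by
  refine ((integrable_const (1:ℝ)).add hm).mono' (by fun_prop) (ae_of_all _ fun v => ?_)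
  simp only [norm_norm, Pi.add_apply]
  nlinarith [sq_nonneg (‖v‖ - 1), sq_nonneg ‖v‖]

lemma int_inner {ν : Measure E} [IsProbabilityMeasure ν] (hm : Integrable (fun v => ‖v‖ ^ 2) ν)
    (e : E) : Integrable (fun v => inner ℝ v e) ν := by
  refine ((int_norm hm).mul_const ‖e‖).mono' (by fun_prop) (ae_of_all _ fun v => ?_)
  exact norm_inner_le_norm v e

lemma int_inner_norm {ν : Measure E} [IsProbabilityMeasure ν] (hm : Integrable (fun v => ‖v‖ ^ 2) ν)
    (e : E) : Integrable (fun v => inner ℝ v e * ‖v‖) ν := by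
  refine (hm.mul_const ‖e‖).mono' (by fun_prop) (ae_of_all _ fun v => ?_)
  rw [norm_mul, norm_norm]
  have := norm_inner_le_norm (𝕜 := ℝ) v e
  nlinarith [norm_nonneg v, norm_nonneg e]

lemma kap_hasFDerivAt (u : ℝ) (z v : E) :
    HasFDerivAt (fun z => kap u z v) ((kap u z v * u) • innerSL ℝ v) z := by
  have h1 : HasFDerivAt (fun z : E => inner ℝ z v) (innerSL ℝ v) z := by
    have := (innerSL ℝ v).hasFDerivAt (x := z)
    refine this.congr_of_eventuallyEq (Eventually.of_forall fun y => ?_)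
    simp [real_inner_comm]
  have h2 := ((h1.const_mul u).sub_const (u ^ 2 * ‖v‖ ^ 2 / 2)).exp
  refine h2.congr_fderiv ?_
  rw [smul_smul]
  rfl

lemma Pm_hasFDerivAt {ν : Measure E} {φ : E → ℝ} (hφ : Integrable φ ν)
    (hφ1 : Integrable (fun v => φ v * ‖v‖) ν) (u : ℝ) (z : E) :
    HasFDerivAt (Pm ν φ u) (∫ v, (φ v * (kap u z v * u)) • innerSL ℝ v ∂ν) z := by
  unfold Pm
  refine hasFDerivAt_integral_of_dominated_of_fderiv_le (s := Metric.ball z 1)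
    (bound := fun v => Real.exp ((‖z‖ + 1) ^ 2 / 2) * |u| * ‖φ v * ‖v‖‖)
    (F' := fun z v => (φ v * (kap u z v * u)) • innerSL ℝ v)
    (Metric.ball_mem_nhds z one_pos) ?_ ?_ ?_ ?_ ?_ ?_
  · exact Eventually.of_forall fun z => hφ.1.mul (kap_cont u z).aestronglyMeasurable
  · exact integrable_mul_kap hφ u z
  · refine (hφ.1.mul ?_).smul ?_
    · exact ((kap_cont u z).mul continuous_const).aestronglyMeasurable
    · exact (innerSL ℝ).continuous.aestronglyMeasurable
  · refine ae_of_all _ fun v y hy => ?_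
    have hy' : ‖y‖ ≤ ‖z‖ + 1 := by
      have := norm_sub_norm_le y z
      rw [Metric.mem_ball, dist_eq_norm] at hy
      linarith
    have hk : kap u y v ≤ Real.exp ((‖z‖ + 1) ^ 2 / 2) := by
      refine (kap_le u y v).trans (Real.exp_le_exp.2 ?_)
      have := norm_nonneg y
      gcongr
    rw [norm_smul, innerSL_apply_norm, norm_mul, norm_mul, norm_mul, norm_norm,
      Real.norm_of_nonneg (kap_pos u y v).le, Real.norm_eq_abs u]
    calc ‖φ v‖ * (kap u y v * |u|) * ‖v‖ ≤ ‖φ v‖ * (Real.exp ((‖z‖ + 1) ^ 2 / 2) * |u|) * ‖v‖ := by gcongr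
      _ = _ := by ring
  · exact hφ1.norm.const_mul _
  · refine ae_of_all _ fun v y _ => ?_
    refine ((kap_hasFDerivAt u y v).const_mul (φ v)).congr_fderiv ?_
    rw [smul_smul]

lemma Pm_hasLineDerivAt {ν : Measure E} {φ : E → ℝ} (hφ : Integrable φ ν)
    (hφ1 : Integrable (fun v => φ v * ‖v‖) ν) (u : ℝ) (z e : E) :
    HasLineDerivAt ℝ (Pm ν φ u) (u * Pm ν (fun v => φ v * inner ℝ v e) u z) z e := by
  convert (Pm_hasFDerivAt hφ hφ1 u z).hasLineDerivAt e using 1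
  rw [ContinuousLinearMap.integral_apply]
  · unfold Pm
    rw [← integral_const_mul]
    congr 1; ext v
    simp
    ring
  · have h := (integrable_mul_kap hφ1 u z).norm.mul_const |u|
    refine h.mono' ?_ (ae_of_all _ fun v => ?_)
    · refine (hφ.1.mul ?_).smul ?_
      · exact ((kap_cont u z).mul continuous_const).aestronglyMeasurable
      · exact (innerSL ℝ).continuous.aestronglyMeasurable
    · rw [norm_smul, innerSL_apply_norm, norm_mul, norm_mul, norm_mul, norm_mul, norm_norm, Real.norm_eq_abs u]
      apply le_of_eq; ring

lemma int_kap_smul {ν : Measure E} [IsProbabilityMeasure ν] (hm : Integrable (fun v => ‖v‖ ^ 2) ν)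
    (u : ℝ) (z : E) : Integrable (fun v => kap u z v • v) ν := by
  refine (integrable_mul_kap (int_norm hm) u z).mono'
    ((kap_cont u z).smul continuous_id).aestronglyMeasurable (ae_of_all _ fun v => ?_)
  rw [norm_smul, Real.norm_of_nonneg (kap_pos u z v).le, mul_comm]

lemma inner_Bv {ν : Measure E} [IsProbabilityMeasure ν] (hm : Integrable (fun v => ‖v‖ ^ 2) ν)
    (u : ℝ) (z e : E) : inner ℝ (Bv ν u z) e = Pm ν (fun v => inner ℝ v e) u z := by
  unfold Bv Pm
  rw [real_inner_comm, ← integral_inner (int_kap_smul hm u z)]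
  congr 1; ext v
  rw [inner_smul_right, real_inner_comm]; ring

lemma Mm_hasGradientAt {ν : Measure E} [IsProbabilityMeasure ν]
    (hm : Integrable (fun v => ‖v‖ ^ 2) ν) (u : ℝ) (z : E) :
    HasGradientAt (Mm ν u) (u • Bv ν u z) z := by
  rw [hasGradientAt_iff_hasFDerivAt, Mm_eq_Pm]
  have h := Pm_hasFDerivAt (φ := fun _ => (1:ℝ)) (integrable_const _)
    (by simpa using int_norm hm) u z
  have h2 := fun e => (Pm_hasLineDerivAt (φ := fun _ => (1:ℝ)) (integrable_const _)
    (by simpa using int_norm hm) u z e).unique (h.hasLineDerivAt e)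
  refine h.congr_fderiv ?_
  ext e
  rw [← h2 e]
  simp [inner_smul_left, inner_Bv hm]

lemma Mm_hasDerivAt {ν : Measure E} [IsProbabilityMeasure ν]
    (hm : Integrable (fun v => ‖v‖ ^ 2) ν) (u : ℝ) (z : E) :
    HasDerivAt (fun u => Mm ν u z)
      (inner ℝ (Bv ν u z) z - u * Pm ν (fun v => ‖v‖ ^ 2) u z) u := by
  have key := hasDerivAt_integral_of_dominated_loc_of_deriv_le (μ := ν) (x₀ := u)
    (F := fun u v => kap u z v) (s := Metric.ball u 1)
    (F' := fun u v => inner ℝ v z * kap u z v - u * (‖v‖ ^ 2 * kap u z v))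
    (bound := fun v => Real.exp (‖z‖ ^ 2 / 2) * (‖z‖ * ‖v‖ + (|u| + 1) * ‖v‖ ^ 2))
    (Metric.ball_mem_nhds u one_pos) (Eventually.of_forall fun u => (kap_cont u z).aestronglyMeasurable)
    (integrable_kap ν u z) ?_ ?_ ?_ ?_
  · refine key.2.congr_deriv ?_
    rw [integral_sub (integrable_mul_kap (int_inner hm z) u z)
      ((integrable_mul_kap hm u z).const_mul u), integral_const_mul, inner_Bv hm]
    rfl
  · have := kap_cont u z
    fun_prop
  · refine ae_of_all _ fun v w hw => ?_
    have hw' : |w| ≤ |u| + 1 := by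
      have := abs_sub_abs_le_abs_sub w u
      rw [Metric.mem_ball, Real.dist_eq] at hw
      linarith
    have h1 : |inner ℝ v z| ≤ ‖z‖ * ‖v‖ := by
      rw [mul_comm]; exact abs_real_inner_le_norm v z
    rw [show inner ℝ v z * kap w z v - w * (‖v‖ ^ 2 * kap w z v) =
      kap w z v * (inner ℝ v z - w * ‖v‖ ^ 2) by ring, norm_mul, Real.norm_of_nonneg (kap_pos w z v).le]
    have h2 : ‖inner ℝ v z - w * ‖v‖ ^ 2‖ ≤ ‖z‖ * ‖v‖ + (|u| + 1) * ‖v‖ ^ 2 := by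
      refine (norm_sub_le _ _).trans ?_
      rw [norm_mul, Real.norm_eq_abs, Real.norm_eq_abs, norm_pow, norm_norm]
      gcongr
    exact mul_le_mul (kap_le w z v) h2 (norm_nonneg _) (Real.exp_pos _).le
  · exact (((int_norm hm).const_mul _).add (hm.const_mul _)).const_mul _
  · refine ae_of_all _ fun v w _ => ?_
    unfold kap
    have h1 : HasDerivAt (fun w : ℝ => w * inner ℝ z v - w ^ 2 * ‖v‖ ^ 2 / 2)
        (1 * inner ℝ z v - (2 * w) * ‖v‖ ^ 2 / 2) w := by
      refine ((hasDerivAt_id w).mul_const _).sub (((HasDerivAt.mul_const ?_ _)).div_const _)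
      simpa using hasDerivAt_pow 2 w
    refine h1.exp.congr_deriv ?_
    rw [real_inner_comm z v]; ring

lemma exists_R (ν : Measure E) [IsProbabilityMeasure ν] :
    ∃ R : ℝ, 0 ≤ R ∧ 1 / 2 ≤ ν.real (Metric.closedBall 0 R) := by
  have h1 : Tendsto (fun n : ℕ => ν (Metric.closedBall (0:E) n)) atTop (nhds (ν (⋃ n : ℕ, Metric.closedBall (0:E) n))) :=
    tendsto_measure_iUnion_atTop (fun a b hab => Metric.closedBall_subset_closedBall (by exact_mod_cast hab))
  rw [Metric.iUnion_closedBall_nat, measure_univ] at h1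
  have h2 := (h1.eventually_const_le (u := ENNReal.ofReal (1/2)) (by
    rw [← ENNReal.ofReal_one]; exact (ENNReal.ofReal_lt_ofReal_iff one_pos).2 (by norm_num))).exists
  obtain ⟨n, hn⟩ := h2
  exact ⟨n, by positivity, by
    rw [Measure.real]
    exact (ENNReal.ofReal_le_iff_le_toReal (measure_ne_top _ _)).1 hn⟩

lemma Mm_lower {ν : Measure E} [IsProbabilityMeasure ν] {R : ℝ} (hR : 0 ≤ R)
    (hR2 : 1 / 2 ≤ ν.real (Metric.closedBall 0 R)) {u : ℝ} (hu : 0 ≤ u) (z : E) :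
    1 / 2 * Real.exp (‖z‖ ^ 2 / 2 - (‖z‖ + u * R) ^ 2 / 2) ≤ Mm ν u z := by
  set c := Real.exp (‖z‖ ^ 2 / 2 - (‖z‖ + u * R) ^ 2 / 2)
  have h1 : ∫ v in Metric.closedBall 0 R, c ∂ν ≤ ∫ v in Metric.closedBall 0 R, kap u z v ∂ν := by
    refine setIntegral_mono_on (integrable_const _) (integrable_kap ν u z).integrableOn
      measurableSet_closedBall (fun v hv => ?_)
    rw [kap_eq]
    apply Real.exp_le_exp.2
    have hv' : ‖v‖ ≤ R := by simpa using hv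
    have h3 : ‖z - u • v‖ ≤ ‖z‖ + u * R := by
      refine (norm_sub_le _ _).trans ?_
      rw [norm_smul, Real.norm_of_nonneg hu]
      gcongr
    have := norm_nonneg (z - u • v)
    gcongr
  have h2 : ∫ v in Metric.closedBall 0 R, kap u z v ∂ν ≤ Mm ν u z :=
    setIntegral_le_integral (integrable_kap ν u z) (ae_of_all _ fun v => (kap_pos u z v).le)
  rw [setIntegral_const, smul_eq_mul] at h1
  have : 0 < c := Real.exp_pos _
  nlinarith

lemma Mm_upper (ν : Measure E) [IsProbabilityMeasure ν] (u : ℝ) (z : E) :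
    Mm ν u z ≤ Real.exp (‖z‖ ^ 2 / 2) := by
  have := integral_mono (integrable_kap ν u z) (integrable_const (Real.exp (‖z‖ ^ 2 / 2))) (kap_le u z)
  simpa [Mm] using this

/-- posterior moment bound -/
lemma moment_bound {ν : Measure E} [IsProbabilityMeasure ν] {R : ℝ} (hR : 0 ≤ R)
    (hR2 : 1 / 2 ≤ ν.real (Metric.closedBall 0 R)) {u : ℝ} (hu : 0 < u) (z : E) (k : ℕ)
    (hk : Integrable (fun v => ‖v‖ ^ k) ν) :
    Pm ν (fun v => ‖v‖ ^ k) u z ≤ (((2 * ‖z‖ + u * R) / u) ^ k + 2 * ∫ v, ‖v‖ ^ k ∂ν) * Mm ν u z := by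
  set c := Real.exp (‖z‖ ^ 2 / 2 - (‖z‖ + u * R) ^ 2 / 2) with hc
  set T := (2 * ‖z‖ + u * R) / u with hT
  have hc0 : 0 < c := Real.exp_pos _
  have hz := norm_nonneg z
  have hT0 : 0 ≤ T := by positivity
  have h1 : ∀ v : E, ‖v‖ ^ k * kap u z v ≤ T ^ k * kap u z v + c * ‖v‖ ^ k := by
    intro v
    have hkp := kap_pos u z v
    have hv := norm_nonneg v
    rcases le_total ‖v‖ T with h | h
    · have : ‖v‖ ^ k ≤ T ^ k := by gcongr
      have h3 : 0 ≤ c * ‖v‖ ^ k := by positivity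
      nlinarith
    · have h4 : kap u z v ≤ c := by
        rw [kap_eq]
        apply Real.exp_le_exp.2
        have h5 : ‖z‖ + u * R ≤ ‖z - u • v‖ := by
          have h6 := norm_sub_norm_le (u • v) z
          rw [norm_smul, Real.norm_of_nonneg hu.le, norm_sub_rev] at h6
          have h7 : 2 * ‖z‖ + u * R ≤ u * ‖v‖ := by
            rw [hT, div_le_iff₀ hu] at h; linarith
          linarith
        gcongr
      have h3 : 0 ≤ T ^ k * kap u z v := by positivity
      have h8 : 0 ≤ ‖v‖ ^ k := by positivity
      nlinarith
  have h2 := integral_mono (integrable_mul_kap hk u z)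
    (((integrable_kap ν u z).const_mul (T ^ k)).add (hk.const_mul c)) h1
  simp only [Pi.add_apply] at h2
  rw [integral_add ((integrable_kap ν u z).const_mul (T ^ k)) (hk.const_mul c), integral_const_mul,
    integral_const_mul] at h2
  have h3 := Mm_lower hR hR2 hu.le z
  have h4 : 0 ≤ ∫ v, ‖v‖ ^ k ∂ν := integral_nonneg fun v => by positivity
  unfold Pm
  change _ ≤ T ^ k * Mm ν u z + _ at h2
  rw [← hc] at h3
  nlinarith

lemma Pm_meas (ν : Measure E) [IsProbabilityMeasure ν] {φ : E → ℝ} (hφ : Continuous φ) (u : ℝ) :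
    AEStronglyMeasurable (Pm ν φ u) volume := by
  unfold Pm
  apply StronglyMeasurable.aestronglyMeasurable
  apply StronglyMeasurable.integral_prod_right (f := fun z v => φ v * kap u z v)
  apply Continuous.stronglyMeasurable
  unfold kap Function.uncurry
  fun_prop

lemma Mm_cont {ν : Measure E} [IsProbabilityMeasure ν]
    (hm : Integrable (fun v => ‖v‖ ^ 2) ν) (u : ℝ) : Continuous (Mm ν u) :=
  continuous_iff_continuousAt.2 fun z => (Mm_hasGradientAt hm u z).continuousAt

lemma Bv_meas (ν : Measure E) [IsProbabilityMeasure ν] (u : ℝ) :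
    AEStronglyMeasurable (Bv ν u) volume := by
  unfold Bv
  apply StronglyMeasurable.aestronglyMeasurable
  apply StronglyMeasurable.integral_prod_right (f := fun z v => kap u z v • v)
  apply Continuous.stronglyMeasurable
  unfold kap Function.uncurry
  fun_prop

lemma Bv_le {ν : Measure E} [IsProbabilityMeasure ν]
    (u : ℝ) (z : E) : ‖Bv ν u z‖ ≤ Pm ν (fun v => ‖v‖ ^ 1) u z := by
  refine (norm_integral_le_integral_norm _).trans (le_of_eq ?_)
  unfold Pm
  congr 1; ext v
  rw [norm_smul, Real.norm_of_nonneg (kap_pos u z v).le]; ring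


/-- posterior mean -/
def pb (ν : Measure E) (u : ℝ) (z : E) : E := (Mm ν u z)⁻¹ • Bv ν u z

/-- posterior second moment -/
def pq (ν : Measure E) (u : ℝ) (z : E) : ℝ := Pm ν (fun v => ‖v‖ ^ 2) u z / Mm ν u z

/-- the main functional -/
def Gt (ν : Measure E) (u : ℝ) : ℝ := ∫ z, Real.log (Mm ν u z) * gd z

lemma pb_bound {ν : Measure E} [IsProbabilityMeasure ν] (hm : Integrable (fun v => ‖v‖ ^ 2) ν) :
    ∃ K : ℝ, 0 ≤ K ∧ ∀ u : ℝ, 0 < u → ∀ z : E, ‖pb ν u z‖ ≤ 2 * ‖z‖ / u + K := by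
  obtain ⟨R, hR, hR2⟩ := exists_R ν
  have hn : Integrable (fun v : E => ‖v‖ ^ 1) ν := by simpa using int_norm hm
  have h4 : 0 ≤ ∫ v, ‖v‖ ^ 1 ∂ν := integral_nonneg fun v => by positivity
  refine ⟨R + 2 * ∫ v, ‖v‖ ^ 1 ∂ν, by positivity, fun u hu z => ?_⟩
  have hM := Mm_pos ν u z
  have h1 := moment_bound hR hR2 hu z 1 hn
  have h2 := Bv_le (ν := ν) u z
  unfold pb
  rw [norm_smul, norm_inv, Real.norm_of_nonneg hM.le, inv_mul_le_iff₀ hM]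
  have h3 : ((2 * ‖z‖ + u * R) / u) ^ 1 = 2 * ‖z‖ / u + R := by field_simp
  rw [h3] at h1
  linarith

lemma pq_bound {ν : Measure E} [IsProbabilityMeasure ν] (hm : Integrable (fun v => ‖v‖ ^ 2) ν) :
    ∃ K : ℝ, 0 ≤ K ∧ ∀ u : ℝ, 0 < u → ∀ z : E, pq ν u z ≤ (2 * ‖z‖ / u + K) ^ 2 + K := by
  obtain ⟨R, hR, hR2⟩ := exists_R ν
  have h4 : 0 ≤ ∫ v, ‖v‖ ^ 2 ∂ν := integral_nonneg fun v => by positivity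
  refine ⟨R + 2 * ∫ v, ‖v‖ ^ 2 ∂ν, by positivity, fun u hu z => ?_⟩
  have hM := Mm_pos ν u z
  have h1 := moment_bound hR hR2 hu z 2 hm
  unfold pq
  rw [div_le_iff₀ hM]
  refine h1.trans (mul_le_mul_of_nonneg_right ?_ hM.le)
  have h3 : ((2 * ‖z‖ + u * R) / u) = 2 * ‖z‖ / u + R := by field_simp
  rw [h3]
  have := norm_nonneg z
  have : 0 ≤ 2 * ‖z‖ / u + R := by positivity
  gcongr
  · linarith
  · linarith

lemma pq_nonneg (ν : Measure E) [IsProbabilityMeasure ν] (u : ℝ) (z : E) : 0 ≤ pq ν u z := by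
  unfold pq
  refine div_nonneg (integral_nonneg fun v => ?_) (Mm_pos ν u z).le
  have := kap_pos u z v
  positivity

/-- both bounds, with quadratic majorant, uniform for `u ≥ a` -/
lemma post_bound {ν : Measure E} [IsProbabilityMeasure ν] (hm : Integrable (fun v => ‖v‖ ^ 2) ν)
    {a : ℝ} (ha : 0 < a) :
    ∃ K : ℝ, 0 ≤ K ∧ ∀ u : ℝ, a ≤ u → ∀ z : E, ‖pb ν u z‖ ^ 2 ≤ K + K * ‖z‖ ^ 2 ∧
      pq ν u z ≤ K + K * ‖z‖ ^ 2 := by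
  obtain ⟨K1, hK1, h1⟩ := pb_bound hm
  obtain ⟨K2, hK2, h2⟩ := pq_bound hm
  refine ⟨8 / a ^ 2 + 2 * K1 ^ 2 + 2 * K2 ^ 2 + K2, by positivity, fun u hu z => ?_⟩
  have hu0 : 0 < u := ha.trans_le hu
  have hz := norm_nonneg z
  have h3 : 2 * ‖z‖ / u ≤ 2 * ‖z‖ / a := by gcongr
  have h0 : 0 ≤ 2 * ‖z‖ / u := by positivity
  have h4 : ∀ K : ℝ, 0 ≤ K → (2 * ‖z‖ / u + K) ^ 2 ≤ 8 / a ^ 2 * ‖z‖ ^ 2 + 2 * K ^ 2 := by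
    intro K hK
    calc (2 * ‖z‖ / u + K) ^ 2 ≤ (2 * ‖z‖ / a + K) ^ 2 := by gcongr
      _ ≤ 2 * (2 * ‖z‖ / a) ^ 2 + 2 * K ^ 2 := by nlinarith [sq_nonneg (2 * ‖z‖ / a - K)]
      _ = _ := by field_simp; ring
  have h8 : 0 ≤ 8 / a ^ 2 := by positivity
  have hz2 : 0 ≤ ‖z‖ ^ 2 := by positivity
  constructor
  · have h5 : ‖pb ν u z‖ ^ 2 ≤ (2 * ‖z‖ / u + K1) ^ 2 := by
      have := h1 u hu0 z
      gcongr
    have := h4 K1 hK1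
    nlinarith [mul_nonneg (sq_nonneg K1) hz2, mul_nonneg (sq_nonneg K2) hz2, mul_nonneg hK2 hz2]
  · have := h2 u hu0 z
    have := h4 K2 hK2
    nlinarith [mul_nonneg (sq_nonneg K1) hz2, mul_nonneg (sq_nonneg K2) hz2, mul_nonneg hK2 hz2]

lemma pb_meas {ν : Measure E} [IsProbabilityMeasure ν] (hm : Integrable (fun v => ‖v‖ ^ 2) ν)
    (u : ℝ) : AEStronglyMeasurable (pb ν u) volume := by
  refine AEStronglyMeasurable.smul ?_ (Bv_meas ν u)
  exact ((Mm_cont hm u).inv₀ fun z => (Mm_pos ν u z).ne').aestronglyMeasurable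

lemma pq_meas {ν : Measure E} [IsProbabilityMeasure ν] (hm : Integrable (fun v => ‖v‖ ^ 2) ν)
    (u : ℝ) : AEStronglyMeasurable (pq ν u) volume := by
  exact AEStronglyMeasurable.div₀ (Pm_meas ν (φ := fun v => ‖v‖ ^ 2) (by fun_prop) u)
    (Mm_cont hm u).aestronglyMeasurable

lemma int_pb_sq {ν : Measure E} [IsProbabilityMeasure ν] (hm : Integrable (fun v => ‖v‖ ^ 2) ν)
    {u : ℝ} (hu : 0 < u) : Integrable (fun z => ‖pb ν u z‖ ^ 2 * gd z) := by
  obtain ⟨K, hK, h⟩ := post_bound hm hu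
  refine integrable_quad_gd ((pb_meas hm u).norm.pow 2) K K fun z => ?_
  rw [abs_of_nonneg (by positivity)]
  exact (h u le_rfl z).1

lemma int_pq {ν : Measure E} [IsProbabilityMeasure ν] (hm : Integrable (fun v => ‖v‖ ^ 2) ν)
    {u : ℝ} (hu : 0 < u) : Integrable (fun z => pq ν u z * gd z) := by
  obtain ⟨K, hK, h⟩ := post_bound hm hu
  refine integrable_quad_gd (pq_meas hm u) K K fun z => ?_
  rw [abs_of_nonneg (pq_nonneg ν u z)]
  exact (h u le_rfl z).2

lemma int_pb_inner {ν : Measure E} [IsProbabilityMeasure ν] (hm : Integrable (fun v => ‖v‖ ^ 2) ν)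
    {u : ℝ} (hu : 0 < u) : Integrable (fun z => inner ℝ (pb ν u z) z * gd z) := by
  obtain ⟨K, hK, h⟩ := post_bound hm hu
  refine integrable_quad_gd ((pb_meas hm u).inner aestronglyMeasurable_id) K (K + 1) fun z => ?_
  have h1 := abs_real_inner_le_norm (pb ν u z) z
  have h2 := (h u le_rfl z).1
  nlinarith [sq_nonneg (‖pb ν u z‖ - ‖z‖)]

lemma inner_pb {ν : Measure E} [IsProbabilityMeasure ν] (hm : Integrable (fun v => ‖v‖ ^ 2) ν)
    (u : ℝ) (z e : E) : inner ℝ (pb ν u z) e = Pm ν (fun v => inner ℝ v e) u z / Mm ν u z := by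
  unfold pb
  rw [real_inner_smul_left, inner_Bv hm, div_eq_inv_mul]

lemma pb_lineDeriv {ν : Measure E} [IsProbabilityMeasure ν] (hm : Integrable (fun v => ‖v‖ ^ 2) ν)
    (u : ℝ) (z e : E) : HasLineDerivAt ℝ (fun z => inner ℝ (pb ν u z) e)
      (u * (Pm ν (fun v => inner ℝ v e * inner ℝ v e) u z / Mm ν u z - inner ℝ (pb ν u z) e ^ 2)) z e := by
  have h1 := Pm_hasLineDerivAt (int_inner hm e) (int_inner_norm hm e) u z e
  have h2 := Pm_hasLineDerivAt (ν := ν) (φ := fun _ => (1:ℝ)) (integrable_const _)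
    (by simpa using int_norm hm) u z e
  rw [← Mm_eq_Pm] at h2
  simp only [one_mul] at h2
  have hM := Mm_pos ν u z
  simp_rw [inner_pb hm]
  unfold HasLineDerivAt at *
  have h3 := h1.div h2 (by simpa using hM.ne')
  refine h3.congr_deriv ?_
  simp only [zero_smul, add_zero]
  field_simp

lemma stein_pb {ν : Measure E} [IsProbabilityMeasure ν] (hm : Integrable (fun v => ‖v‖ ^ 2) ν)
    {u : ℝ} (hu : 0 < u) :
    ∫ z, inner ℝ (pb ν u z) z * gd z = u * ∫ z, (pq ν u z - ‖pb ν u z‖ ^ 2) * gd z := by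
  let bs := stdOrthonormalBasis ℝ E
  obtain ⟨K, hK, hb⟩ := post_bound hm hu
  set qe : Fin (Module.finrank ℝ E) → E → ℝ :=
    fun i z => Pm ν (fun v => inner ℝ v (bs i) * inner ℝ v (bs i)) u z / Mm ν u z with hqe
  have hn : ∀ i, ‖bs i‖ = 1 := fun i => bs.orthonormal.1 i
  have hintg : ∀ i, Integrable (fun v : E => inner ℝ v (bs i) * inner ℝ v (bs i)) ν := by
    intro i
    refine hm.mono' (by fun_prop) (ae_of_all _ fun v => ?_)
    have := abs_real_inner_le_norm v (bs i)
    rw [hn, mul_one] at this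
    rw [norm_mul, Real.norm_eq_abs]
    nlinarith [abs_nonneg (inner ℝ v (bs i))]
  have hq0 : ∀ i z, 0 ≤ qe i z ∧ qe i z ≤ pq ν u z := by
    intro i z
    have hM := Mm_pos ν u z
    constructor
    · refine div_nonneg (integral_nonneg fun v => ?_) hM.le
      exact mul_nonneg (mul_self_nonneg _) (kap_pos u z v).le
    · refine div_le_div_of_nonneg_right ?_ hM.le
      refine integral_mono (integrable_mul_kap (hintg i) u z) (integrable_mul_kap hm u z) fun v => ?_
      refine mul_le_mul_of_nonneg_right ?_ (kap_pos u z v).le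
      have := abs_real_inner_le_norm v (bs i)
      rw [hn, mul_one] at this
      have h2 := abs_mul_abs_self (inner ℝ v (bs i))
      nlinarith [abs_nonneg (inner ℝ v (bs i))]
  have hbe : ∀ i z, inner ℝ (pb ν u z) (bs i) ^ 2 ≤ ‖pb ν u z‖ ^ 2 := by
    intro i z
    have := abs_real_inner_le_norm (pb ν u z) (bs i)
    rw [hn, mul_one] at this
    rw [← sq_abs]; gcongr
  have hbm : ∀ i, AEStronglyMeasurable (fun z => inner ℝ (pb ν u z) (bs i)) volume := fun i =>
    (pb_meas hm u).inner aestronglyMeasurable_const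
  have hqm : ∀ i, AEStronglyMeasurable (qe i) volume := fun i =>
    AEStronglyMeasurable.div₀
      (Pm_meas ν (φ := fun v => inner ℝ v (bs i) * inner ℝ v (bs i)) (by fun_prop) u)
      (Mm_cont hm u).aestronglyMeasurable
  have i1 : ∀ i, Integrable (fun z => (u * (qe i z - inner ℝ (pb ν u z) (bs i) ^ 2)) * gd z) := by
    intro i
    refine integrable_quad_gd (((hqm i).sub ((hbm i).pow 2)).const_mul u) (u * (2 * K)) (u * (2 * K)) fun z => ?_
    rw [abs_mul, abs_of_pos hu]
    have h1 := (hb u le_rfl z)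
    have h2 := hq0 i z
    have h3 := hbe i z
    have h4 : |qe i z - inner ℝ (pb ν u z) (bs i) ^ 2| ≤ 2 * K + 2 * K * ‖z‖ ^ 2 := by
      rw [abs_le]
      constructor <;> nlinarith [sq_nonneg (inner ℝ (pb ν u z) (bs i)), sq_nonneg ‖z‖]
    nlinarith
  have i2 : ∀ i, Integrable (fun z => inner ℝ (pb ν u z) (bs i) * (inner ℝ z (bs i) * gd z)) := by
    intro i
    have := integrable_quad_gd (f := fun z => inner ℝ (pb ν u z) (bs i) * inner ℝ z (bs i))
      ((hbm i).mul (by fun_prop)) K (K + 1) fun z => by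
        have h1 := (hb u le_rfl z).1
        have h3 := hbe i z
        have h4 := abs_real_inner_le_norm z (bs i)
        rw [hn, mul_one] at h4
        rw [abs_mul]
        rw [← sq_abs] at h3
        nlinarith [sq_nonneg (|inner ℝ (pb ν u z) (bs i)| - ‖z‖), abs_nonneg (inner ℝ (pb ν u z) (bs i)),
          abs_nonneg (inner ℝ z (bs i))]
    simpa only [mul_assoc] using this
  have i3 : ∀ i, Integrable (fun z => inner ℝ (pb ν u z) (bs i) * gd z) := by
    intro i
    refine integrable_quad_gd (hbm i) (K + 1) K fun z => ?_
    have h1 := (hb u le_rfl z).1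
    have h3 := hbe i z
    rw [← sq_abs] at h3
    nlinarith [sq_nonneg (|inner ℝ (pb ν u z) (bs i)| - 1)]
  have key : ∀ i, ∫ z, inner ℝ (pb ν u z) (bs i) * (inner ℝ z (bs i) * gd z) =
      ∫ z, (u * (qe i z - inner ℝ (pb ν u z) (bs i) ^ 2)) * gd z := fun i =>
    stein_dir (bs i) (fun z => pb_lineDeriv hm u z (bs i)) (i1 i) (i2 i) (i3 i)
  have e1 : ∀ z, inner ℝ (pb ν u z) z * gd z =
      ∑ i, inner ℝ (pb ν u z) (bs i) * (inner ℝ z (bs i) * gd z) := by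
    intro z
    rw [← bs.sum_inner_mul_inner, Finset.sum_mul]
    refine Finset.sum_congr rfl fun i _ => ?_
    rw [real_inner_comm (bs i) z]; ring
  have e2 : ∀ z, pq ν u z = ∑ i, qe i z := by
    intro z
    simp only [hqe, pq]
    rw [← Finset.sum_div]
    congr 1
    unfold Pm
    rw [← integral_finsetSum _ (fun i _ => integrable_mul_kap (hintg i) u z)]
    congr 1; ext v
    dsimp only
    rw [← bs.sum_sq_norm_inner_left v, Finset.sum_mul]
    refine Finset.sum_congr rfl fun i _ => ?_
    rw [Real.norm_eq_abs, sq_abs, sq]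
  have e3 : ∀ z, u * ((pq ν u z - ‖pb ν u z‖ ^ 2) * gd z) =
      ∑ i, (u * (qe i z - inner ℝ (pb ν u z) (bs i) ^ 2)) * gd z := by
    intro z
    rw [← Finset.sum_mul, ← Finset.mul_sum, Finset.sum_sub_distrib, ← e2,
      ← bs.sum_sq_norm_inner_left (pb ν u z)]
    simp only [Real.norm_eq_abs, sq_abs]
    ring
  rw [← integral_const_mul]
  simp_rw [e1, e3]
  rw [integral_finsetSum _ (fun i _ => i2 i), integral_finsetSum _ (fun i _ => i1 i)]
  exact Finset.sum_congr rfl fun i _ => key i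

/-- bounds on `log M` -/
lemma logM_bound {ν : Measure E} [IsProbabilityMeasure ν] (c : ℝ) (hc : 0 ≤ c) :
    ∃ K : ℝ, 0 ≤ K ∧ ∀ u : ℝ, 0 ≤ u → u ≤ c → ∀ z : E, |Real.log (Mm ν u z)| ≤ K + K * ‖z‖ ^ 2 := by
  obtain ⟨R, hR, hR2⟩ := exists_R ν
  refine ⟨Real.log 2 + c * R + (c * R) ^ 2 + 1, by have := Real.log_nonneg (one_le_two); positivity,
    fun u hu huc z => ?_⟩
  have h1 := Mm_lower hR hR2 hu z
  have h2 := Mm_upper ν u z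
  have hM := Mm_pos ν u z
  have h3 := Real.log_le_log hM h2
  have h4 := Real.log_le_log (by positivity) h1
  rw [Real.log_mul (by norm_num) (Real.exp_ne_zero _), Real.log_exp, Real.log_div (by norm_num) (by norm_num),
    Real.log_one] at h4
  rw [Real.log_exp] at h3
  have hl2 := Real.log_nonneg (one_le_two)
  have hz := norm_nonneg z
  have hz2 := sq_nonneg ‖z‖
  have huR : u * R ≤ c * R := by gcongr
  have huR0 : 0 ≤ u * R := by positivity
  have hz3 : ‖z‖ ≤ 1 + ‖z‖ ^ 2 := by nlinarith [sq_nonneg (‖z‖ - 1)]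
  have hcR : 0 ≤ c * R := by positivity
  have h5 : (u * R) ^ 2 ≤ (c * R) ^ 2 := by gcongr
  have h6 : u * R * ‖z‖ ≤ c * R * (1 + ‖z‖ ^ 2) := by gcongr
  rw [abs_le]
  constructor
  · nlinarith [mul_nonneg hl2 hz2, mul_nonneg (sq_nonneg (c * R)) hz2]
  · nlinarith [mul_nonneg hl2 hz2, mul_nonneg (sq_nonneg (c * R)) hz2, mul_nonneg hcR hz2]

lemma logM_cont {ν : Measure E} [IsProbabilityMeasure ν] (hm : Integrable (fun v => ‖v‖ ^ 2) ν)
    (u : ℝ) : Continuous fun z => Real.log (Mm ν u z) :=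
  (Mm_cont hm u).log fun z => (Mm_pos ν u z).ne'

lemma Gt_hasDerivAt {ν : Measure E} [IsProbabilityMeasure ν] (hm : Integrable (fun v => ‖v‖ ^ 2) ν)
    {u : ℝ} (hu : 0 < u) : HasDerivAt (Gt ν) (-u * ∫ z, ‖pb ν u z‖ ^ 2 * gd z) u := by
  obtain ⟨K, hK, hb⟩ := post_bound hm (half_pos hu)
  obtain ⟨K', hK', hl⟩ := logM_bound (ν := ν) u hu.le
  have key := hasDerivAt_integral_of_dominated_loc_of_deriv_le (μ := (volume : Measure E)) (x₀ := u)
    (F := fun u z => Real.log (Mm ν u z) * gd z) (s := Metric.ball u (u / 2))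
    (F' := fun u z => (inner ℝ (pb ν u z) z - u * pq ν u z) * gd z)
    (bound := fun z => (K + 2 * u * K) * gd z + (K + 1 + 2 * u * K) * (‖z‖ ^ 2 * gd z))
    (Metric.ball_mem_nhds u (half_pos hu))
    (Eventually.of_forall fun u => ((logM_cont hm u).mul gd_cont).aestronglyMeasurable)
    (integrable_quad_gd (logM_cont hm u).aestronglyMeasurable K' K' (hl u hu.le le_rfl)) ?_ ?_ ?_ ?_
  · refine key.2.congr_deriv ?_
    have h1 := stein_pb hm hu
    simp only [sub_mul] at h1 ⊢
    simp only [mul_assoc] at h1 ⊢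
    rw [integral_sub (int_pq hm hu) (int_pb_sq hm hu)] at h1
    rw [integral_sub (int_pb_inner hm hu) ((int_pq hm hu).const_mul u), integral_const_mul, h1]
    ring
  · exact (((pb_meas hm u).inner aestronglyMeasurable_id).sub ((pq_meas hm u).const_mul u)).mul
      gd_cont.aestronglyMeasurable
  · refine ae_of_all _ fun z w hw => ?_
    rw [Metric.mem_ball, Real.dist_eq, abs_lt] at hw
    have hw1 : u / 2 ≤ w := by linarith
    have hw2 : w ≤ 2 * u := by linarith
    have hw0 : 0 < w := by linarith
    have h2 := hb w hw1 z
    have hq := pq_nonneg ν w z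
    rw [norm_mul, Real.norm_of_nonneg (gd_pos z).le, Real.norm_eq_abs]
    have h3 : |inner ℝ (pb ν w z) z - w * pq ν w z| ≤ (K + 2 * u * K) + (K + 1 + 2 * u * K) * ‖z‖ ^ 2 := by
      refine (abs_sub _ _).trans ?_
      have h4 := abs_real_inner_le_norm (pb ν w z) z
      rw [abs_mul, abs_of_pos hw0, abs_of_nonneg hq]
      have h5 : w * pq ν w z ≤ 2 * u * (K + K * ‖z‖ ^ 2) := by
        apply mul_le_mul hw2 h2.2 hq (by positivity)
      nlinarith [sq_nonneg (‖pb ν w z‖ - ‖z‖)]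
    have := mul_le_mul_of_nonneg_right h3 (gd_pos z).le
    linarith
  · exact (integrable_gd.const_mul _).add (integrable_sq_gd.const_mul _)
  · refine ae_of_all _ fun z w _ => ?_
    have hM := Mm_pos ν w z
    refine (((Mm_hasDerivAt hm w z).log hM.ne').mul_const (gd z)).congr_deriv ?_
    unfold pb pq
    rw [real_inner_smul_left]
    field_simp

lemma Gt_tendsto_zero {ν : Measure E} [IsProbabilityMeasure ν] (hm : Integrable (fun v => ‖v‖ ^ 2) ν) :
    Tendsto (Gt ν) (nhdsWithin 0 (Set.Ioi 0)) (nhds 0) := by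
  obtain ⟨K', hK', hl⟩ := logM_bound (ν := ν) 1 zero_le_one
  have hev : ∀ᶠ u : ℝ in nhdsWithin 0 (Set.Ioi 0), u ∈ Set.Ioo (0:ℝ) 1 :=
    Ioo_mem_nhdsGT one_pos
  have := tendsto_integral_filter_of_dominated_convergence (μ := (volume : Measure E))
    (l := nhdsWithin (0:ℝ) (Set.Ioi 0)) (F := fun u z => Real.log (Mm ν u z) * gd z) (f := fun _ => 0)
    (fun z => K' * gd z + K' * (‖z‖ ^ 2 * gd z))
    (Eventually.of_forall fun u => ((logM_cont hm u).mul gd_cont).aestronglyMeasurable) ?_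
    ((integrable_gd.const_mul _).add (integrable_sq_gd.const_mul _)) ?_
  · simp only [integral_zero] at this
    exact this
  · filter_upwards [hev] with u hu
    refine ae_of_all _ fun z => ?_
    rw [norm_mul, Real.norm_of_nonneg (gd_pos z).le, Real.norm_eq_abs]
    have := mul_le_mul_of_nonneg_right (hl u hu.1.le hu.2.le z) (gd_pos z).le
    linarith
  · refine ae_of_all _ fun z => ?_
    have h1 : Tendsto (fun u => Mm ν u z) (nhdsWithin 0 (Set.Ioi 0)) (nhds (Mm ν 0 z)) :=
      (Mm_hasDerivAt hm 0 z).continuousAt.tendsto.mono_left nhdsWithin_le_nhds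
    have h2 : Mm ν 0 z = 1 := by simp [Mm, kap]
    rw [h2] at h1
    have := (h1.log one_ne_zero).mul_const (gd z)
    simpa using this


/-- rescaled Gaussian average of the density -/
def Fm (f : E → ℝ) (u : ℝ) (z : E) : ℝ := ∫ ξ, Real.exp (-‖ξ‖ ^ 2 / 2) * f (u⁻¹ • (z + ξ))

lemma Mm_eq_Fm {ν : Measure E} {f : E → ℝ} (hν : ∀ u z, Mm ν u z = ∫ v, kap u z v * f v)
    {u : ℝ} (hu : 0 < u) (z : E) :
    Mm ν u z = Real.exp (‖z‖ ^ 2 / 2) * (u ^ Module.finrank ℝ E)⁻¹ * Fm f u z := by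
  rw [hν]
  have h1 := Measure.integral_comp_smul (volume : Measure E)
    (fun w => Real.exp (-‖z - w‖ ^ 2 / 2) * f (u⁻¹ • w)) u
  have h2 := integral_add_right_eq_self (μ := (volume : Measure E))
    (fun w => Real.exp (-‖z - w‖ ^ 2 / 2) * f (u⁻¹ • w)) z
  unfold Fm
  have h3 : ∀ ξ : E, Real.exp (-‖ξ‖ ^ 2 / 2) * f (u⁻¹ • (z + ξ)) =
      Real.exp (-‖z - (ξ + z)‖ ^ 2 / 2) * f (u⁻¹ • (ξ + z)) := by
    intro ξ
    rw [show z - (ξ + z) = -ξ by abel, norm_neg, add_comm]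
  simp_rw [h3]
  rw [h2, mul_assoc]
  rw [abs_of_nonneg (by positivity), smul_eq_mul] at h1
  rw [← h1, ← integral_const_mul]
  congr 1; ext v
  rw [kap_eq, smul_smul, inv_mul_cancel₀ hu.ne', one_smul, ← mul_assoc, ← Real.exp_add]
  congr 2; ring

/-- growth hypothesis on the density -/
def Growth (f : E → ℝ) (A L : ℝ) : Prop :=
  ∀ v, |Real.log (f v) - Real.log (f 0)| ≤ A * ‖v‖ + L * ‖v‖ ^ 2

lemma growth_bd {f : E → ℝ} (hf0 : ∀ v, 0 < f v) {A L : ℝ} (hA : 0 ≤ A) (hL : 0 ≤ L)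
    (hg : Growth f A L) {u : ℝ} (hu : 1 + 32 * L ≤ u) (z ξ : E) :
    f (u⁻¹ • (z + ξ)) ≤ f 0 * Real.exp (8 * A ^ 2 + ‖z‖ ^ 2 / 8 + ‖ξ‖ ^ 2 / 8) ∧
    f 0 * Real.exp (-(8 * A ^ 2 + ‖z‖ ^ 2 / 8 + ‖ξ‖ ^ 2 / 8)) ≤ f (u⁻¹ • (z + ξ)) := by
  have hu1 : 1 ≤ u := by linarith
  have hu0 : 0 < u := by linarith
  have h := hg (u⁻¹ • (z + ξ))
  have hw : ‖z + ξ‖ ^ 2 ≤ 2 * ‖z‖ ^ 2 + 2 * ‖ξ‖ ^ 2 := by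
    have h1 : ‖z + ξ‖ ^ 2 ≤ (‖z‖ + ‖ξ‖) ^ 2 := by gcongr; exact norm_add_le _ _
    nlinarith [sq_nonneg (‖z‖ - ‖ξ‖)]
  rw [norm_smul, norm_inv, Real.norm_of_nonneg hu0.le] at h
  set w := ‖z + ξ‖ with hwdef
  have hw0 : 0 ≤ w := norm_nonneg _
  have hi : u⁻¹ ≤ 1 := inv_le_one_of_one_le₀ hu1
  have hi0 : 0 ≤ u⁻¹ := by positivity
  have h1 : A * (u⁻¹ * w) ≤ 8 * A ^ 2 + w ^ 2 / 32 := by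
    have : u⁻¹ * w ≤ w := by nlinarith
    have : A * (u⁻¹ * w) ≤ A * w := by gcongr
    nlinarith [sq_nonneg (16 * A - w)]
  have h2 : L * (u⁻¹ * w) ^ 2 ≤ w ^ 2 / 32 := by
    have h3 : L * u⁻¹ ≤ 1 / 32 := by
      rw [← div_eq_mul_inv, div_le_iff₀ hu0]; linarith
    have h4 : L * u⁻¹ * u⁻¹ ≤ 1 / 32 := by nlinarith [mul_nonneg hL hi0]
    nlinarith [sq_nonneg w]
  have hb : |Real.log (f (u⁻¹ • (z + ξ))) - Real.log (f 0)| ≤ 8 * A ^ 2 + ‖z‖ ^ 2 / 8 + ‖ξ‖ ^ 2 / 8 := by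
    linarith
  rw [abs_le] at hb
  constructor
  · rw [← Real.log_le_log_iff (hf0 _) (mul_pos (hf0 _) (Real.exp_pos _)),
      Real.log_mul (hf0 _).ne' (Real.exp_ne_zero _), Real.log_exp]
    linarith
  · rw [← Real.log_le_log_iff (mul_pos (hf0 _) (Real.exp_pos _)) (hf0 _),
      Real.log_mul (hf0 _).ne' (Real.exp_ne_zero _), Real.log_exp]
    linarith

lemma Fm_integrand_le {f : E → ℝ} (hf0 : ∀ v, 0 < f v) {A L : ℝ} (hA : 0 ≤ A) (hL : 0 ≤ L)
    (hg : Growth f A L) {u : ℝ} (hu : 1 + 32 * L ≤ u) (z ξ : E) :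
    Real.exp (-‖ξ‖ ^ 2 / 2) * f (u⁻¹ • (z + ξ)) ≤
      f 0 * Real.exp (8 * A ^ 2 + ‖z‖ ^ 2 / 8) * Real.exp (-(3/8) * ‖ξ‖ ^ 2) ∧
    f 0 * Real.exp (-(8 * A ^ 2 + ‖z‖ ^ 2 / 8)) * Real.exp (-(5/8) * ‖ξ‖ ^ 2) ≤
      Real.exp (-‖ξ‖ ^ 2 / 2) * f (u⁻¹ • (z + ξ)) := by
  obtain ⟨h1, h2⟩ := growth_bd hf0 hA hL hg hu z ξ
  constructor
  · refine (mul_le_mul_of_nonneg_left h1 (Real.exp_pos _).le).trans (le_of_eq ?_)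
    rw [mul_left_comm, ← Real.exp_add, mul_assoc, ← Real.exp_add]
    congr 2; ring
  · refine (le_of_eq ?_).trans (mul_le_mul_of_nonneg_left h2 (Real.exp_pos _).le)
    rw [mul_left_comm, ← Real.exp_add, mul_assoc, ← Real.exp_add]
    congr 2; ring

lemma Fm_integrable {f : E → ℝ} (hfc : Continuous f) (hf0 : ∀ v, 0 < f v) {A L : ℝ} (hA : 0 ≤ A)
    (hL : 0 ≤ L) (hg : Growth f A L) {u : ℝ} (hu : 1 + 32 * L ≤ u) (z : E) :
    Integrable (fun ξ => Real.exp (-‖ξ‖ ^ 2 / 2) * f (u⁻¹ • (z + ξ))) := by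
  refine ((integrable_gauss (E := E) (3/8) (by norm_num)).const_mul
    (f 0 * Real.exp (8 * A ^ 2 + ‖z‖ ^ 2 / 8))).mono' (by fun_prop) (ae_of_all _ fun ξ => ?_)
  rw [Real.norm_of_nonneg (mul_pos (Real.exp_pos _) (hf0 _)).le]
  exact (Fm_integrand_le hf0 hA hL hg hu z ξ).1

lemma Fm_log_bound {f : E → ℝ} (hfc : Continuous f) (hf0 : ∀ v, 0 < f v) {A L : ℝ} (hA : 0 ≤ A)
    (hL : 0 ≤ L) (hg : Growth f A L) :
    ∃ K : ℝ, 0 ≤ K ∧ ∀ u : ℝ, 1 + 32 * L ≤ u → ∀ z : E, 0 < Fm f u z ∧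
      |Real.log (Fm f u z)| ≤ K + K * ‖z‖ ^ 2 := by
  set c3 := ∫ ξ : E, Real.exp (-(3/8) * ‖ξ‖ ^ 2) with hc3
  set c5 := ∫ ξ : E, Real.exp (-(5/8) * ‖ξ‖ ^ 2) with hc5
  have p3 : 0 < c3 := by
    rw [hc3, GaussianFourier.integral_rexp_neg_mul_sq_norm (by norm_num)]; positivity
  have p5 : 0 < c5 := by
    rw [hc5, GaussianFourier.integral_rexp_neg_mul_sq_norm (by norm_num)]; positivity
  refine ⟨|Real.log (f 0)| + 8 * A ^ 2 + |Real.log c3| + |Real.log c5| + 1, by positivity, fun u hu z => ?_⟩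
  have hup : Fm f u z ≤ f 0 * Real.exp (8 * A ^ 2 + ‖z‖ ^ 2 / 8) * c3 := by
    rw [hc3, ← integral_const_mul]
    exact integral_mono (Fm_integrable hfc hf0 hA hL hg hu z)
      ((integrable_gauss (E := E) (3/8) (by norm_num)).const_mul _)
      fun ξ => (Fm_integrand_le hf0 hA hL hg hu z ξ).1
  have hlo : f 0 * Real.exp (-(8 * A ^ 2 + ‖z‖ ^ 2 / 8)) * c5 ≤ Fm f u z := by
    rw [hc5, ← integral_const_mul]
    exact integral_mono ((integrable_gauss (E := E) (5/8) (by norm_num)).const_mul _)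
      (Fm_integrable hfc hf0 hA hL hg hu z)
      fun ξ => (Fm_integrand_le hf0 hA hL hg hu z ξ).2
  have hf := hf0 0
  have hpos : 0 < Fm f u z := lt_of_lt_of_le (by positivity) hlo
  refine ⟨hpos, ?_⟩
  have l1 := Real.log_le_log hpos hup
  have l2 := Real.log_le_log (by positivity) hlo
  rw [Real.log_mul (by positivity) p3.ne', Real.log_mul hf.ne' (Real.exp_ne_zero _), Real.log_exp] at l1
  rw [Real.log_mul (by positivity) p5.ne', Real.log_mul hf.ne' (Real.exp_ne_zero _), Real.log_exp] at l2
  have a1 := neg_abs_le (Real.log (f 0))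
  have a2 := le_abs_self (Real.log (f 0))
  have a3 := neg_abs_le (Real.log c5)
  have a4 := le_abs_self (Real.log c3)
  have a5 := abs_nonneg (Real.log (f 0))
  have a6 := abs_nonneg (Real.log c3)
  have a7 := abs_nonneg (Real.log c5)
  have hz2 := sq_nonneg ‖z‖
  have b1 := mul_nonneg a5 hz2
  have b2 := mul_nonneg a6 hz2
  have b3 := mul_nonneg a7 hz2
  have b4 := mul_nonneg (sq_nonneg A) hz2
  rw [abs_le]
  constructor <;> nlinarith

lemma Fm_tendsto {f : E → ℝ} (hfc : Continuous f) (hf0 : ∀ v, 0 < f v) {A L : ℝ} (hA : 0 ≤ A)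
    (hL : 0 ≤ L) (hg : Growth f A L) (z : E) :
    Tendsto (fun u => Fm f u z) atTop (nhds ((2 * π) ^ ((Module.finrank ℝ E : ℝ) / 2) * f 0)) := by
  rw [← integral_exp_half, ← integral_mul_const]
  refine tendsto_integral_filter_of_dominated_convergence
    (fun ξ => f 0 * Real.exp (8 * A ^ 2 + ‖z‖ ^ 2 / 8) * Real.exp (-(3/8) * ‖ξ‖ ^ 2)) ?_ ?_ ?_ ?_
  · exact Eventually.of_forall fun u => by fun_prop
  · filter_upwards [eventually_ge_atTop (1 + 32 * L)] with u hu
    refine ae_of_all _ fun ξ => ?_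
    rw [Real.norm_of_nonneg (mul_pos (Real.exp_pos _) (hf0 _)).le]
    exact (Fm_integrand_le hf0 hA hL hg hu z ξ).1
  · exact (integrable_gauss (E := E) (3/8) (by norm_num)).const_mul _
  · refine ae_of_all _ fun ξ => ?_
    refine Tendsto.const_mul _ ?_
    have h1 : Tendsto (fun u : ℝ => u⁻¹ • (z + ξ)) atTop (nhds ((0:ℝ) • (z + ξ))) :=
      tendsto_inv_atTop_zero.smul_const _
    rw [zero_smul] at h1
    exact (hfc.tendsto 0).comp h1

lemma Gt_tendsto_top {ν : Measure E} [IsProbabilityMeasure ν] (hm : Integrable (fun v => ‖v‖ ^ 2) ν)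
    {f : E → ℝ} (hν : ∀ u z, Mm ν u z = ∫ v, kap u z v * f v)
    (hfc : Continuous f) (hf0 : ∀ v, 0 < f v) {A L : ℝ} (hA : 0 ≤ A)
    (hL : 0 ≤ L) (hg : Growth f A L) :
    Tendsto (fun u => Gt ν u + Module.finrank ℝ E * Real.log u) atTop
      (nhds ((Module.finrank ℝ E : ℝ) / 2 + (Module.finrank ℝ E : ℝ) / 2 * Real.log (2 * π) + Real.log (f 0))) := by
  obtain ⟨K, hK, hb⟩ := Fm_log_bound hfc hf0 hA hL hg
  set n := (Module.finrank ℝ E : ℝ) with hn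
  have hlog : ∀ u : ℝ, 1 + 32 * L ≤ u → ∀ z : E,
      Real.log (Mm ν u z) = ‖z‖ ^ 2 / 2 - n * Real.log u + Real.log (Fm f u z) := by
    intro u hu z
    have hu0 : 0 < u := by linarith
    rw [Mm_eq_Fm hν hu0 z, Real.log_mul (by positivity) (hb u hu z).1.ne',
      Real.log_mul (Real.exp_ne_zero _) (by positivity), Real.log_exp, Real.log_inv, Real.log_pow]
    ring
  have hmeas : ∀ u : ℝ, 1 + 32 * L ≤ u → Continuous (fun z : E => Real.log (Fm f u z)) := by
    intro u hu
    have : (fun z : E => Real.log (Fm f u z)) =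
        fun z => Real.log (Mm ν u z) - ‖z‖ ^ 2 / 2 + n * Real.log u := by
      ext z; rw [hlog u hu z]; ring
    rw [this]
    have := logM_cont hm u
    fun_prop
  have hlim : Tendsto (fun u => ∫ z : E, Real.log (Fm f u z) * gd z) atTop
      (nhds (∫ z : E, Real.log ((2 * π) ^ (n / 2) * f 0) * gd z)) := by
    refine tendsto_integral_filter_of_dominated_convergence
      (fun z => K * gd z + K * (‖z‖ ^ 2 * gd z)) ?_ ?_ ?_ ?_
    · filter_upwards [eventually_ge_atTop (1 + 32 * L)] with u hu
      exact ((hmeas u hu).mul gd_cont).aestronglyMeasurable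
    · filter_upwards [eventually_ge_atTop (1 + 32 * L)] with u hu
      refine ae_of_all _ fun z => ?_
      rw [norm_mul, Real.norm_of_nonneg (gd_pos z).le, Real.norm_eq_abs]
      have := mul_le_mul_of_nonneg_right (hb u hu z).2 (gd_pos z).le
      linarith
    · exact (integrable_gd.const_mul _).add (integrable_sq_gd.const_mul _)
    · refine ae_of_all _ fun z => ?_
      have hp : (2 * π) ^ (n / 2) * f 0 ≠ 0 := by
        have := hf0 0; positivity
      exact ((Fm_tendsto hfc hf0 hA hL hg z).log hp).mul_const _
  rw [integral_const_mul, integral_gd, mul_one, Real.log_mul (by positivity) (hf0 0).ne',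
    Real.log_rpow (by positivity)] at hlim
  have hlim2 := hlim.const_add (n / 2)
  rw [← add_assoc] at hlim2
  refine hlim2.congr' ?_
  filter_upwards [eventually_ge_atTop (1 + 32 * L)] with u hu
  unfold Gt
  have i1 : Integrable (fun z : E => Real.log (Fm f u z) * gd z) :=
    integrable_quad_gd (hmeas u hu).aestronglyMeasurable K K fun z => (hb u hu z).2
  have e1 : ∀ z : E, Real.log (Mm ν u z) * gd z =
      (1 / 2 * (‖z‖ ^ 2 * gd z) - (n * Real.log u) * gd z) + Real.log (Fm f u z) * gd z := by
    intro z; rw [hlog u hu z]; ring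
  simp_rw [e1]
  have i2 : Integrable (fun z : E => 1 / 2 * (‖z‖ ^ 2 * gd z) - (n * Real.log u) * gd z) :=
    (integrable_sq_gd.const_mul _).sub (integrable_gd.const_mul _)
  rw [integral_add i2 i1,
    integral_sub (integrable_sq_gd.const_mul _) (integrable_gd.const_mul _), integral_const_mul,
    integral_const_mul, integral_gd, integral_sq_gd]
  ring

/-- logs of mixtures of log-convex functions are convex -/
lemma log_integral_convex {w : E → ℝ} {k : ℝ → E → ℝ} (hw : ∀ ξ, 0 ≤ w ξ)
    (hk : ∀ ξ, ConvexOn ℝ Set.univ (fun s => k s ξ))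
    (hi : ∀ s, Integrable (fun ξ => w ξ * Real.exp (k s ξ)))
    (hp : ∀ s, 0 < ∫ ξ, w ξ * Real.exp (k s ξ)) :
    ConvexOn ℝ Set.univ (fun s => Real.log (∫ ξ, w ξ * Real.exp (k s ξ))) := by
  refine ⟨convex_univ, fun x _ y _ a b ha hb hab => ?_⟩
  set X := ∫ ξ, w ξ * Real.exp (k x ξ) with hX
  set Y := ∫ ξ, w ξ * Real.exp (k y ξ) with hY
  have hX0 : 0 < X := hp x
  have hY0 : 0 < Y := hp y
  set c := Real.exp (a * Real.log X + b * Real.log Y) with hc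
  have h1 : ∀ ξ, w ξ * Real.exp (k (a • x + b • y) ξ) ≤
      c * (a / X * (w ξ * Real.exp (k x ξ)) + b / Y * (w ξ * Real.exp (k y ξ))) := by
    intro ξ
    have h2 := (hk ξ).2 (Set.mem_univ x) (Set.mem_univ y) ha hb hab
    have h3 := convexOn_exp.2 (Set.mem_univ (k x ξ - Real.log X)) (Set.mem_univ (k y ξ - Real.log Y)) ha hb hab
    simp only [smul_eq_mul] at h2 h3 ⊢
    rw [Real.exp_sub, Real.exp_sub, Real.exp_log hX0, Real.exp_log hY0] at h3
    have h4 : Real.exp (k (a * x + b * y) ξ) ≤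
        c * Real.exp (a * (k x ξ - Real.log X) + b * (k y ξ - Real.log Y)) := by
      rw [hc, ← Real.exp_add]
      apply Real.exp_le_exp.2
      linarith
    have hc0 : 0 < c := Real.exp_pos _
    calc w ξ * Real.exp (k (a * x + b * y) ξ)
        ≤ w ξ * (c * (a * (Real.exp (k x ξ) / X) + b * (Real.exp (k y ξ) / Y))) := by
          refine mul_le_mul_of_nonneg_left (h4.trans ?_) (hw ξ)
          exact mul_le_mul_of_nonneg_left h3 hc0.le
      _ = _ := by ring
  have h2 := integral_mono (hi _) ((((hi x).const_mul (a / X)).add ((hi y).const_mul (b / Y))).const_mul c) h1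
  simp only [Pi.add_apply] at h2
  rw [integral_const_mul, integral_add ((hi x).const_mul (a / X)) ((hi y).const_mul (b / Y)),
    integral_const_mul, integral_const_mul, ← hX, ← hY, div_mul_cancel₀ _ hX0.ne',
    div_mul_cancel₀ _ hY0.ne', hab, mul_one] at h2
  have h3 := Real.log_le_log (hp _) h2
  rw [hc, Real.log_exp] at h3
  exact h3

lemma pb_inner_lower {ν : Measure E} [IsProbabilityMeasure ν] (hm : Integrable (fun v => ‖v‖ ^ 2) ν)
    {f : E → ℝ} (hν : ∀ u z, Mm ν u z = ∫ v, kap u z v * f v)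
    (hfc : Continuous f) (hf0 : ∀ v, 0 < f v) {A L : ℝ} (hA : 0 ≤ A)
    (hL : 0 ≤ L) (hg : Growth f A L)
    (hconv : ∀ a c : E, ConvexOn ℝ Set.univ
      (fun s : ℝ => Real.log (f (a + s • c)) + L * ‖c‖ ^ 2 / 2 * s ^ 2))
    {u : ℝ} (hu : 1 + 32 * L ≤ u) (z : E) :
    u * inner ℝ (pb ν u 0) z + (1 - L / u ^ 2) * ‖z‖ ^ 2 ≤ u * inner ℝ (pb ν u z) z := by
  have hu0 : 0 < u := by linarith
  obtain ⟨K, hK, hb⟩ := Fm_log_bound hfc hf0 hA hL hg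
  set c := L * ‖u⁻¹ • z‖ ^ 2 / 2 with hcdef
  have e1 : ∀ s : ℝ, ∀ ξ : E, Real.exp (-‖ξ‖ ^ 2 / 2) *
      Real.exp (Real.log (f (u⁻¹ • ξ + s • (u⁻¹ • z))) + c * s ^ 2) =
      (Real.exp (-‖ξ‖ ^ 2 / 2) * f (u⁻¹ • (s • z + ξ))) * Real.exp (c * s ^ 2) := by
    intro s ξ
    rw [Real.exp_add, Real.exp_log (hf0 _), smul_comm s, ← smul_add, add_comm ξ]
    ring
  have e2 : ∀ s : ℝ, ∫ ξ : E, Real.exp (-‖ξ‖ ^ 2 / 2) *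
      Real.exp (Real.log (f (u⁻¹ • ξ + s • (u⁻¹ • z))) + c * s ^ 2) =
      Fm f u (s • z) * Real.exp (c * s ^ 2) := by
    intro s
    simp_rw [e1]
    rw [integral_mul_const]; rfl
  have hcv := log_integral_convex (w := fun ξ : E => Real.exp (-‖ξ‖ ^ 2 / 2))
    (k := fun s ξ => Real.log (f (u⁻¹ • ξ + s • (u⁻¹ • z))) + c * s ^ 2)
    (fun ξ => (Real.exp_pos _).le) (fun ξ => hconv _ _)
    (fun s => by
      simp_rw [e1]
      exact (Fm_integrable hfc hf0 hA hL hg hu (s • z)).mul_const _)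
    (fun s => by
      rw [e2]; exact mul_pos (hb u hu _).1 (Real.exp_pos _))
  have e3 : (fun s : ℝ => Real.log (∫ ξ : E, Real.exp (-‖ξ‖ ^ 2 / 2) *
      Real.exp (Real.log (f (u⁻¹ • ξ + s • (u⁻¹ • z))) + c * s ^ 2))) =
      fun s => Real.log (Mm ν u (s • z)) + (c - ‖z‖ ^ 2 / 2) * s ^ 2 +
        Module.finrank ℝ E * Real.log u := by
    ext s
    rw [e2, Real.log_mul (hb u hu _).1.ne' (Real.exp_ne_zero _), Real.log_exp, Mm_eq_Fm hν hu0,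
      Real.log_mul (by positivity) (hb u hu _).1.ne',
      Real.log_mul (Real.exp_ne_zero _) (by positivity), Real.log_exp, Real.log_inv, Real.log_pow,
      norm_smul, mul_pow, Real.norm_eq_abs, sq_abs]
    ring
  rw [e3] at hcv
  have hd : ∀ s : ℝ, HasDerivAt (fun s : ℝ => Real.log (Mm ν u (s • z)) + (c - ‖z‖ ^ 2 / 2) * s ^ 2 +
        Module.finrank ℝ E * Real.log u)
      (u * inner ℝ (pb ν u (s • z)) z + (c - ‖z‖ ^ 2 / 2) * (2 * s)) s := by
    intro s
    have h1 := (Mm_hasGradientAt hm u (s • z)).hasFDerivAt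
    have h2 : HasDerivAt (fun s : ℝ => s • z) z s := by
      simpa using (hasDerivAt_id s).smul_const z
    have h3 := (h1.comp_hasDerivAt s h2).log (Mm_pos ν u (s • z)).ne'
    have h4 : HasDerivAt (fun s : ℝ => (c - ‖z‖ ^ 2 / 2) * s ^ 2) ((c - ‖z‖ ^ 2 / 2) * (2 * s)) s := by
      simpa using (hasDerivAt_pow 2 s).const_mul (c - ‖z‖ ^ 2 / 2)
    refine ((h3.add h4).add_const _).congr_deriv ?_
    simp [pb, real_inner_smul_left]
    ring
  have hmono := hcv.monotoneOn_deriv (fun s _ => (hd s).differentiableAt)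
    (Set.mem_univ 0) (Set.mem_univ 1) zero_le_one
  rw [(hd 0).deriv, (hd 1).deriv] at hmono
  simp only [zero_smul, one_smul, mul_zero, mul_one, add_zero] at hmono
  have hc2 : c * 2 = L / u ^ 2 * ‖z‖ ^ 2 := by
    rw [hcdef, norm_smul, norm_inv, Real.norm_of_nonneg hu0.le]
    field_simp
  linarith

lemma pb_sq_lower {ν : Measure E} [IsProbabilityMeasure ν] (hm : Integrable (fun v => ‖v‖ ^ 2) ν)
    {f : E → ℝ} (hν : ∀ u z, Mm ν u z = ∫ v, kap u z v * f v)
    (hfc : Continuous f) (hf0 : ∀ v, 0 < f v) {A L : ℝ} (hA : 0 ≤ A)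
    (hL : 0 ≤ L) (hg : Growth f A L)
    (hconv : ∀ a c : E, ConvexOn ℝ Set.univ
      (fun s : ℝ => Real.log (f (a + s • c)) + L * ‖c‖ ^ 2 / 2 * s ^ 2))
    {u : ℝ} (hu : 1 + 32 * L ≤ u) :
    Module.finrank ℝ E * (1 - 2 * L / u ^ 2) ≤ u ^ 2 * ∫ z, ‖pb ν u z‖ ^ 2 * gd z := by
  have hu0 : 0 < u := by linarith
  have i0 : Integrable (fun z : E => inner ℝ z (pb ν u 0) * gd z) :=
    integrable_quad_gd (by fun_prop) _ _ (fun z => inner_bd z _)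
  have hpt : ∀ z : E, (2 * u) * (inner ℝ z (pb ν u 0) * gd z) +
      (1 - 2 * L / u ^ 2) * (‖z‖ ^ 2 * gd z) ≤ u ^ 2 * (‖pb ν u z‖ ^ 2 * gd z) := by
    intro z
    have h1 := pb_inner_lower hm hν hfc hf0 hA hL hg hconv hu z
    have h2 : 0 ≤ ‖u • pb ν u z - z‖ ^ 2 := by positivity
    rw [norm_sub_sq_real, norm_smul, mul_pow, Real.norm_eq_abs, sq_abs, real_inner_smul_left] at h2
    have h3 : (2 * u) * inner ℝ z (pb ν u 0) + (1 - 2 * L / u ^ 2) * ‖z‖ ^ 2 ≤ u ^ 2 * ‖pb ν u z‖ ^ 2 := by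
      rw [real_inner_comm]
      have : (1 - 2 * L / u ^ 2) * ‖z‖ ^ 2 = 2 * ((1 - L / u ^ 2) * ‖z‖ ^ 2) - ‖z‖ ^ 2 := by ring
      linarith
    have := mul_le_mul_of_nonneg_right h3 (gd_pos z).le
    linarith
  have h := integral_mono ((i0.const_mul (2 * u)).add ((integrable_sq_gd (E := E)).const_mul (1 - 2 * L / u ^ 2)))
    ((int_pb_sq hm hu0).const_mul (u ^ 2)) hpt
  simp only [Pi.add_apply] at h
  rw [integral_add (i0.const_mul (2 * u)) ((integrable_sq_gd (E := E)).const_mul (1 - 2 * L / u ^ 2)),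
    integral_const_mul, integral_const_mul, integral_const_mul, integral_inner_gd, integral_sq_gd] at h
  linarith


lemma smooth_log {d : ℕ} {ρ₀ : EuclideanSpace ℝ (Fin d) → ℝ} (hpos : ∀ x, 0 < ρ₀ x)
    (hsmooth : ContDiff ℝ (⊤ : ℕ∞) ρ₀) :
    (∀ x, HasGradientAt (fun y => Real.log (ρ₀ y)) (gradient (fun y => Real.log (ρ₀ y)) x) x) ∧
    Differentiable ℝ (gradient (fun y => Real.log (ρ₀ y))) := by
  have h1 : ContDiff ℝ (⊤ : ℕ∞) (fun y => Real.log (ρ₀ y)) := hsmooth.log fun x => (hpos x).ne'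
  have h2 : Differentiable ℝ (fun y => Real.log (ρ₀ y)) := h1.differentiable (by simp)
  refine ⟨fun x => (h2 x).hasGradientAt, ?_⟩
  have h3 : Differentiable ℝ (fderiv ℝ (fun y => Real.log (ρ₀ y))) :=
    (h1.fderiv_right (m := 1) (WithTop.coe_le_coe.2 (le_top : (1 + 1 : ℕ∞) ≤ ⊤))).differentiable (by simp)
  exact ((InnerProductSpace.toDual ℝ (EuclideanSpace ℝ (Fin d))).symm.toContinuousLinearEquiv.differentiable).comp h3

lemma lip_grad {d : ℕ} {ρ₀ : EuclideanSpace ℝ (Fin d) → ℝ} (hpos : ∀ x, 0 < ρ₀ x)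
    (hsmooth : ContDiff ℝ (⊤ : ℕ∞) ρ₀) {L : ℝ}
    (hL : ∀ x, ‖fderiv ℝ (gradient (fun y => Real.log (ρ₀ y))) x‖ ≤ L) (x y : EuclideanSpace ℝ (Fin d)) :
    ‖gradient (fun y => Real.log (ρ₀ y)) y - gradient (fun y => Real.log (ρ₀ y)) x‖ ≤ L * ‖y - x‖ :=
  convex_univ.norm_image_sub_le_of_norm_fderiv_le
    (fun x _ => (smooth_log hpos hsmooth).2 x) (fun x _ => hL x) (Set.mem_univ x) (Set.mem_univ y)

lemma growth_of_hess {d : ℕ} {ρ₀ : EuclideanSpace ℝ (Fin d) → ℝ} (hpos : ∀ x, 0 < ρ₀ x)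
    (hsmooth : ContDiff ℝ (⊤ : ℕ∞) ρ₀) {L : ℝ} (hL0 : 0 ≤ L)
    (hL : ∀ x, ‖fderiv ℝ (gradient (fun y => Real.log (ρ₀ y))) x‖ ≤ L)
    (x₀ : EuclideanSpace ℝ (Fin d)) :
    Growth (fun v => ρ₀ (x₀ + v)) ‖gradient (fun y => Real.log (ρ₀ y)) x₀‖ L := by
  intro v
  have hg := (smooth_log hpos hsmooth).1
  have := (convex_closedBall x₀ ‖v‖).norm_image_sub_le_of_norm_fderiv_le (𝕜 := ℝ)
    (f := fun y => Real.log (ρ₀ y)) (x := x₀) (y := x₀ + v)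
    (C := ‖gradient (fun y => Real.log (ρ₀ y)) x₀‖ + L * ‖v‖)
    (fun x _ => (hg x).differentiableAt) (fun x hx => by
      rw [(hg x).hasFDerivAt.fderiv, LinearIsometryEquiv.norm_map]
      have h1 := lip_grad hpos hsmooth hL x₀ x
      have h2 := norm_sub_norm_le (gradient (fun y => Real.log (ρ₀ y)) x) (gradient (fun y => Real.log (ρ₀ y)) x₀)
      have h3 : ‖x - x₀‖ ≤ ‖v‖ := by simpa [dist_eq_norm] using hx
      have h4 : L * ‖x - x₀‖ ≤ L * ‖v‖ := by gcongr
      linarith) (by simp) (by simp)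
  simp only [add_sub_cancel_left, Real.norm_eq_abs] at this
  simp only [add_zero]
  refine this.trans (le_of_eq ?_)
  ring

lemma convex_of_hess {d : ℕ} {ρ₀ : EuclideanSpace ℝ (Fin d) → ℝ} (hpos : ∀ x, 0 < ρ₀ x)
    (hsmooth : ContDiff ℝ (⊤ : ℕ∞) ρ₀) {L : ℝ}
    (hL : ∀ x, ‖fderiv ℝ (gradient (fun y => Real.log (ρ₀ y))) x‖ ≤ L)
    (x₀ a c : EuclideanSpace ℝ (Fin d)) :
    ConvexOn ℝ Set.univ
      (fun s : ℝ => Real.log (ρ₀ (x₀ + (a + s • c))) + L * ‖c‖ ^ 2 / 2 * s ^ 2) := by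
  have hg := (smooth_log hpos hsmooth).1
  set G := gradient (fun y => Real.log (ρ₀ y)) with hG
  have hd : ∀ s : ℝ, HasDerivAt
      (fun s : ℝ => Real.log (ρ₀ (x₀ + (a + s • c))) + L * ‖c‖ ^ 2 / 2 * s ^ 2)
      (inner ℝ (G (x₀ + (a + s • c))) c + L * ‖c‖ ^ 2 * s) s := by
    intro s
    have h2 : HasDerivAt (fun s : ℝ => x₀ + (a + s • c)) c s := by
      simpa using (((hasDerivAt_id s).smul_const c).const_add a).const_add x₀
    have h3 := (hg (x₀ + (a + s • c))).hasFDerivAt.comp_hasDerivAt s h2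
    have h4 : HasDerivAt (fun s : ℝ => L * ‖c‖ ^ 2 / 2 * s ^ 2) (L * ‖c‖ ^ 2 / 2 * (2 * s)) s := by
      simpa using (hasDerivAt_pow 2 s).const_mul (L * ‖c‖ ^ 2 / 2)
    refine (h3.add h4).congr_deriv ?_
    simp
    ring
  have hdiff : Differentiable ℝ
      (fun s : ℝ => Real.log (ρ₀ (x₀ + (a + s • c))) + L * ‖c‖ ^ 2 / 2 * s ^ 2) :=
    fun s => (hd s).differentiableAt
  refine MonotoneOn.convexOn_of_deriv convex_univ hdiff.continuous.continuousOn
    hdiff.differentiableOn ?_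
  intro s _ r _ hsr
  rw [(hd s).deriv, (hd r).deriv]
  have h1 := lip_grad hpos hsmooth hL (x₀ + (a + s • c)) (x₀ + (a + r • c))
  rw [← hG] at h1
  have h2 : x₀ + (a + r • c) - (x₀ + (a + s • c)) = (r - s) • c := by
    rw [sub_smul]; abel
  rw [h2, norm_smul, Real.norm_of_nonneg (by linarith)] at h1
  have h3 := abs_real_inner_le_norm (G (x₀ + (a + r • c)) - G (x₀ + (a + s • c))) c
  have h4 := neg_abs_le (inner ℝ (G (x₀ + (a + r • c)) - G (x₀ + (a + s • c))) c)
  rw [inner_sub_left] at h3 h4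
  nlinarith [mul_le_mul_of_nonneg_right h1 (norm_nonneg c)]

lemma Mm_density {d : ℕ} {μ : Measure (EuclideanSpace ℝ (Fin d))}
    {ρ₀ : EuclideanSpace ℝ (Fin d) → ℝ}
    (hdensity : μ = volume.withDensity (fun x => ENNReal.ofReal (ρ₀ x)))
    (hpos : ∀ x, 0 < ρ₀ x) (hc : Continuous ρ₀) (x₀ : EuclideanSpace ℝ (Fin d)) (u : ℝ)
    (z : EuclideanSpace ℝ (Fin d)) :
    Mm (μ.map (fun y => y - x₀)) u z = ∫ v, kap u z v * ρ₀ (x₀ + v) := by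
  unfold Mm
  rw [integral_map (by fun_prop) (kap_cont u z).aestronglyMeasurable, hdensity,
    integral_withDensity_eq_integral_toReal_smul (by fun_prop) (by simp)]
  rw [← integral_add_right_eq_self _ x₀]
  congr 1; ext v
  rw [ENNReal.toReal_ofReal (hpos _).le, add_sub_cancel_right, smul_eq_mul, mul_comm, add_comm]

lemma moment_shift {d : ℕ} {μ : Measure (EuclideanSpace ℝ (Fin d))} [IsProbabilityMeasure μ]
    (hmom : Integrable (fun x₀ : EuclideanSpace ℝ (Fin d) => ‖x₀‖ ^ 2) μ)
    (x₀ : EuclideanSpace ℝ (Fin d)) :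
    Integrable (fun v => ‖v‖ ^ 2) (μ.map (fun y => y - x₀)) := by
  rw [integrable_map_measure (by fun_prop) (by fun_prop)]
  refine ((hmom.const_mul 2).add (integrable_const (2 * ‖x₀‖ ^ 2))).mono' (by fun_prop)
    (ae_of_all _ fun y => ?_)
  simp only [Function.comp, norm_pow, norm_norm, Pi.add_apply]
  have h1 : ‖y - x₀‖ ^ 2 ≤ (‖y‖ + ‖x₀‖) ^ 2 := by gcongr; exact norm_sub_le _ _
  nlinarith [sq_nonneg (‖y‖ - ‖x₀‖)]

lemma rho_eq {d : ℕ} {μ : Measure (EuclideanSpace ℝ (Fin d))}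
    (x₀ : EuclideanSpace ℝ (Fin d)) {t : ℝ} (ht : 0 < t) (ht1 : t < 1)
    (y : EuclideanSpace ℝ (Fin d)) :
    rho d μ t y = (2 * π * t) ^ (-(d : ℝ) / 2) *
      (Real.exp (-‖(√t)⁻¹ • (y - √(1 - t) • x₀)‖ ^ 2 / 2) *
        Mm (μ.map (fun y => y - x₀)) (√(1 - t) / √t) ((√t)⁻¹ • (y - √(1 - t) • x₀))) := by
  unfold rho Mm heatKernel
  rw [integral_map (by fun_prop) (kap_cont _ _).aestronglyMeasurable, ← integral_const_mul,
    ← integral_const_mul]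
  congr 1; ext x'
  have hst : 0 < √t := Real.sqrt_pos.2 ht
  have hsq : √t ^ 2 = t := Real.sq_sqrt ht.le
  congr 1
  rw [kap_eq, ← Real.exp_add]
  congr 1
  have h1 : (√t)⁻¹ • (y - √(1 - t) • x₀) - (√(1 - t) / √t) • (x' - x₀) =
      (√t)⁻¹ • (y - √(1 - t) • x') := by
    rw [div_eq_inv_mul, mul_smul, ← smul_sub]
    congr 1
    rw [smul_sub]; abel
  rw [h1, norm_smul ((√t)⁻¹) (y - √(1 - t) • x'), mul_pow, norm_inv, Real.norm_of_nonneg hst.le, inv_pow, hsq]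
  field_simp
  ring

lemma grad_rho {d : ℕ} {μ : Measure (EuclideanSpace ℝ (Fin d))} [IsProbabilityMeasure μ]
    (hmom : Integrable (fun x₀ : EuclideanSpace ℝ (Fin d) => ‖x₀‖ ^ 2) μ)
    (x₀ : EuclideanSpace ℝ (Fin d)) {t : ℝ} (ht : 0 < t) (ht1 : t < 1)
    (z : EuclideanSpace ℝ (Fin d)) :
    gradient (fun y => Real.log (rho d μ t y)) (√(1 - t) • x₀ + √t • z) =
      (√t)⁻¹ • ((√(1 - t) / √t) • pb (μ.map (fun y => y - x₀)) (√(1 - t) / √t) z - z) := by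
  have hprob : IsProbabilityMeasure (μ.map (fun y => y - x₀)) :=
    Measure.isProbabilityMeasure_map (by fun_prop)
  have hm := moment_shift hmom x₀
  set ν := μ.map (fun y => y - x₀)
  set u := √(1 - t) / √t with hu
  have hst : 0 < √t := Real.sqrt_pos.2 ht
  apply HasGradientAt.gradient
  have hw : (√t)⁻¹ • ((√(1 - t) • x₀ + √t • z) - √(1 - t) • x₀) = z := by
    rw [add_sub_cancel_left, smul_smul, inv_mul_cancel₀ hst.ne', one_smul]
  have e : (fun y => Real.log (rho d μ t y)) = fun y =>
      Real.log ((2 * π * t) ^ (-(d : ℝ) / 2)) +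
        ((-1/2) * ‖(√t)⁻¹ • (y - √(1 - t) • x₀)‖ ^ 2 +
          Real.log (Mm ν u ((√t)⁻¹ • (y - √(1 - t) • x₀)))) := by
    ext y
    have hM := Mm_pos ν u ((√t)⁻¹ • (y - √(1 - t) • x₀))
    rw [rho_eq x₀ ht ht1 y, Real.log_mul (by positivity) (by positivity),
      Real.log_mul (Real.exp_ne_zero _) hM.ne', Real.log_exp]
    congr 2; ring
  rw [e, hasGradientAt_iff_hasFDerivAt]
  have h1 : HasFDerivAt (fun y : EuclideanSpace ℝ (Fin d) => (√t)⁻¹ • (y - √(1 - t) • x₀))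
      ((√t)⁻¹ • ContinuousLinearMap.id ℝ (EuclideanSpace ℝ (Fin d))) (√(1 - t) • x₀ + √t • z) :=
    by
      have := ((hasFDerivAt_id (𝕜 := ℝ) (√(1 - t) • x₀ + √t • z)).sub_const
        (√(1 - t) • x₀)).const_smul ((√t)⁻¹)
      exact this
  have h2 : HasFDerivAt (fun w : EuclideanSpace ℝ (Fin d) => (-1/2) * ‖w‖ ^ 2 + Real.log (Mm ν u w))
      (((-1/2 : ℝ)) • (2 • innerSL ℝ z) + (Mm ν u z)⁻¹ • (InnerProductSpace.toDual ℝ _ (u • Bv ν u z)))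
      ((√t)⁻¹ • ((√(1 - t) • x₀ + √t • z) - √(1 - t) • x₀)) := by
    rw [hw]
    refine HasFDerivAt.add (HasFDerivAt.const_mul ?_ _) ?_
    · simpa using (hasStrictFDerivAt_norm_sq z).hasFDerivAt
    · exact (Mm_hasGradientAt hm u z).hasFDerivAt.log (Mm_pos ν u z).ne'
  have h23 := HasFDerivAt.comp (f := fun y : EuclideanSpace ℝ (Fin d) =>
    (√t)⁻¹ • (y - √(1 - t) • x₀)) (√(1 - t) • x₀ + √t • z) h2 h1
  have h3 := h23.const_add (Real.log ((2 * π * t) ^ (-(d : ℝ) / 2)))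
  refine h3.congr_fderiv ?_
  ext w
  simp [pb, inner_sub_left, real_inner_smul_left]
  ring

lemma score_eq {d : ℕ} {μ : Measure (EuclideanSpace ℝ (Fin d))} [IsProbabilityMeasure μ]
    (hmom : Integrable (fun x₀ : EuclideanSpace ℝ (Fin d) => ‖x₀‖ ^ 2) μ)
    (x₀ : EuclideanSpace ℝ (Fin d)) {t : ℝ} (ht : 0 < t) (ht1 : t < 1) :
    scoreIntegrand d μ t x₀ = 1 / (2 * t ^ 2) *
      (∫ z, ‖pb (μ.map (fun y => y - x₀)) (√(1 - t) / √t) z‖ ^ 2 * gd z) - d / (2 * t) := by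
  unfold scoreIntegrand condExpX0
  have hst : 0 < √t := Real.sqrt_pos.2 ht
  have hsq : √t ^ 2 = t := Real.sq_sqrt ht.le
  have hsq1 : √(1 - t) ^ 2 = 1 - t := Real.sq_sqrt (by linarith)
  congr 1
  rw [← integral_const_mul, ← integral_const_mul]
  congr 1; ext z
  dsimp only
  rw [grad_rho hmom x₀ ht ht1 z]
  have hgd : stdGaussianDensity d z = gd z := by
    unfold stdGaussianDensity gd; simp
  have h1 : t⁻¹ • (√(1 - t) • x₀ + √t • z - √(1 - t) • x₀) = (√t)⁻¹ • z := by
    rw [add_sub_cancel_left, smul_smul]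
    congr 1
    nth_rewrite 1 [← hsq]
    field_simp
  rw [hgd, h1, ← smul_add, add_sub_cancel, smul_smul, norm_smul, mul_pow, Real.norm_eq_abs, sq_abs,
    mul_pow, div_pow, inv_pow, hsq, hsq1]
  have : (1 - t) ≠ 0 := by linarith
  field_simp

/-- a function with nonnegative-up-to-constant derivative and finite limits -/
lemma ftc_limits {G D : ℝ → ℝ} {C a b : ℝ} (hG : ∀ t ∈ Set.Ioo (0:ℝ) 1, HasDerivAt G (D t) t)
    (hD : ∀ t ∈ Set.Ioo (0:ℝ) 1, -C ≤ D t)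
    (h0 : Tendsto G (nhdsWithin 0 (Set.Ioi 0)) (nhds a))
    (h1 : Tendsto G (nhdsWithin 1 (Set.Iio 1)) (nhds b)) :
    ∫ t in (0:ℝ)..1, D t = b - a := by
  refine intervalIntegral.integral_eq_sub_of_hasDerivAt_of_tendsto one_pos hG ?_ h0 h1
  rw [intervalIntegrable_iff_integrableOn_Ioc_of_le zero_le_one]
  have hcont : ContinuousOn G (Set.Ioo 0 1) := fun t ht => (hG t ht).continuousAt.continuousWithinAt
  have hext : ContinuousOn (extendFrom (Set.Ioo 0 1) G) (Set.Icc 0 1) :=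
    continuousOn_Icc_extendFrom_Ioo hcont h0 h1
  have hlin : ContinuousOn (fun t : ℝ => C * t) (Set.Icc 0 1) := by fun_prop
  have hc2 : ContinuousOn (fun t => extendFrom (Set.Ioo 0 1) G t + C * t) (Set.Icc 0 1) :=
    hext.add hlin
  have hder : ∀ t ∈ Set.Ioo (0:ℝ) 1,
      HasDerivAt (fun t => extendFrom (Set.Ioo 0 1) G t + C * t) (D t + C) t := by
    intro t ht
    have e : extendFrom (Set.Ioo 0 1) G =ᶠ[nhds t] G := by
      filter_upwards [Ioo_mem_nhds ht.1 ht.2] with s hs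
      exact extendFrom_eq (subset_closure hs)
        ((hG s hs).continuousAt.tendsto.mono_left nhdsWithin_le_nhds)
    have h2 : HasDerivAt (fun t : ℝ => C * t) C t := by
      simpa using (hasDerivAt_id t).const_mul C
    exact ((hG t ht).congr_of_eventuallyEq e).add h2
  have hnn : ∀ t ∈ Set.Ioo (0:ℝ) 1, 0 ≤ D t + C := fun t ht => by
    have := hD t ht
    linarith
  have key : IntegrableOn (fun t => D t + C) (Set.Ioc 0 1) :=
    intervalIntegral.integrableOn_deriv_of_nonneg hc2 hder hnn
  have hC : IntegrableOn (fun _ : ℝ => C) (Set.Ioc (0:ℝ) 1) := integrableOn_const (by simp)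
  have hs := key.sub hC
  refine hs.congr (ae_of_all _ fun t => ?_)
  simp

lemma u_deriv {t : ℝ} (ht : 0 < t) (ht1 : t < 1) :
    HasDerivAt (fun t => √(1 - t) / √t) (-(1 / (2 * t ^ 2 * (√(1 - t) / √t)))) t := by
  have h1t : 0 < 1 - t := by linarith
  have hst : 0 < √t := Real.sqrt_pos.2 ht
  have hst1 : 0 < √(1 - t) := Real.sqrt_pos.2 h1t
  have hsq : √t ^ 2 = t := Real.sq_sqrt ht.le
  have hsq1 : √(1 - t) ^ 2 = 1 - t := Real.sq_sqrt h1t.le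
  have h1 : HasDerivAt (fun t : ℝ => √(1 - t)) (-1 / (2 * √(1 - t))) t :=
    ((hasDerivAt_id t).const_sub 1).sqrt h1t.ne'
  have h2 : HasDerivAt (fun t : ℝ => √t) (1 / (2 * √t)) t := Real.hasDerivAt_sqrt ht.ne'
  refine (h1.div h2 hst.ne').congr_deriv ?_
  set p := √t
  set q := √(1 - t)
  have ht' : t = p ^ 2 := hsq.symm
  have hpq : q ^ 2 = 1 - p ^ 2 := by rw [hsq, hsq1]
  rw [ht']
  field_simp
  rw [hpq]
  ring


end SBD


/-- **Score-based density formula (smooth case).** If `X₀` has a smooth density `ρ₀` with finite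
second moment and `sup_x ‖∇² log ρ₀(x)‖ < ∞`, then for every `x₀`,
`log ρ₀(x₀) = −(1 + log(2π))·d/2 − ∫₀¹ D(t, x₀) dt`. -/
theorem score_based_density_formula
    (d : ℕ) (hd : 1 ≤ d) (μ : Measure (EuclideanSpace ℝ (Fin d))) [IsProbabilityMeasure μ]
    (ρ₀ : EuclideanSpace ℝ (Fin d) → ℝ)
    (hdensity : μ = volume.withDensity (fun x => ENNReal.ofReal (ρ₀ x)))
    (hpos : ∀ x, 0 < ρ₀ x) (hsmooth : ContDiff ℝ (⊤ : ℕ∞) ρ₀)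
    (hmom : Integrable (fun x₀ : EuclideanSpace ℝ (Fin d) => ‖x₀‖ ^ 2) μ)
    (hhess : ∃ L : ℝ, ∀ x,
      ‖fderiv ℝ (gradient (fun y => Real.log (ρ₀ y))) x‖ ≤ L)
    (x₀ : EuclideanSpace ℝ (Fin d)) :
    Real.log (ρ₀ x₀)
      = -((1 + Real.log (2 * π)) / 2 * d) - ∫ t in (0:ℝ)..1, scoreIntegrand d μ t x₀ := by
  obtain ⟨L₀, hL₀⟩ := hhess
  have hL : ∀ x, ‖fderiv ℝ (gradient (fun y => Real.log (ρ₀ y))) x‖ ≤ max L₀ 0 :=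
    fun x => (hL₀ x).trans (le_max_left _ _)
  have hL0 : 0 ≤ max L₀ 0 := le_max_right _ _
  generalize max L₀ 0 = L at hL hL0
  have hprob : IsProbabilityMeasure (μ.map (fun y => y - x₀)) :=
    Measure.isProbabilityMeasure_map (by fun_prop)
  have hm := SBD.moment_shift hmom x₀
  have hν := fun u z => SBD.Mm_density hdensity hpos hsmooth.continuous x₀ u z
  have hsc := fun t (ht : t ∈ Set.Ioo (0:ℝ) 1) => SBD.score_eq hmom x₀ ht.1 ht.2
  have hgr := SBD.growth_of_hess hpos hsmooth hL0 hL x₀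
  have hcv := SBD.convex_of_hess hpos hsmooth hL x₀
  have hfc : Continuous (fun v => ρ₀ (x₀ + v)) := hsmooth.continuous.comp (by fun_prop)
  have hf0 : ∀ v, 0 < ρ₀ (x₀ + v) := fun v => hpos _
  have htop := SBD.Gt_tendsto_top hm hν hfc hf0 (norm_nonneg _) hL0 hgr
  have hzero := SBD.Gt_tendsto_zero hm
  have hlow := fun u (hu : 1 + 32 * L ≤ u) =>
    SBD.pb_sq_lower hm hν hfc hf0 (norm_nonneg _) hL0 hgr hcv hu
  have hder := fun u (hu : 0 < u) => SBD.Gt_hasDerivAt hm hu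
  generalize μ.map (fun y => y - x₀) = ν at *
  rw [finrank_euclideanSpace_fin] at htop
  simp only [finrank_euclideanSpace_fin, add_zero] at hlow htop
  have hupos : ∀ t ∈ Set.Ioo (0:ℝ) 1, 0 < √(1 - t) / √t := fun t ht =>
    div_pos (Real.sqrt_pos.2 (by linarith [ht.2])) (Real.sqrt_pos.2 ht.1)
  have husq : ∀ t ∈ Set.Ioo (0:ℝ) 1, (√(1 - t) / √t) ^ 2 = (1 - t) / t := fun t ht => by
    rw [div_pow, Real.sq_sqrt ht.1.le, Real.sq_sqrt (by linarith [ht.2])]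
  -- the primitive
  have hG : ∀ t ∈ Set.Ioo (0:ℝ) 1, HasDerivAt
      (fun t => SBD.Gt ν (√(1 - t) / √t) - (d : ℝ) / 2 * Real.log t) (scoreIntegrand d μ t x₀) t := by
    intro t ht
    have h1 := (hder _ (hupos t ht)).comp t (SBD.u_deriv ht.1 ht.2)
    have h2 := (Real.hasDerivAt_log ht.1.ne').const_mul ((d : ℝ) / 2)
    refine (h1.sub h2).congr_deriv ?_
    rw [hsc t ht]
    have h3 := (hupos t ht).ne'
    have h4 := ht.1.ne'
    generalize √(1 - t) / √t = u at *
    field_simp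
  -- lower bound
  have hD : ∃ C : ℝ, ∀ t ∈ Set.Ioo (0:ℝ) 1, -C ≤ scoreIntegrand d μ t x₀ := by
    set U := 1 + 32 * L with hU
    have hU1 : 1 ≤ U := by linarith
    refine ⟨d * (1 + U ^ 2) + 4 * d * L * (1 + U ^ 2) ^ 2, fun t ht => ?_⟩
    have ht0 := ht.1
    rw [hsc t ht]
    have hI : 0 ≤ ∫ z, ‖SBD.pb ν (√(1 - t) / √t) z‖ ^ 2 * SBD.gd z :=
      integral_nonneg fun z => mul_nonneg (by positivity) (SBD.gd_pos z).le
    have hd0 : (0:ℝ) ≤ d := by positivity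
    rcases le_or_gt U (√(1 - t) / √t) with h | h
    · have h1 := hlow _ h
      rw [husq t ht] at h1
      have hu2 : U ^ 2 ≤ (√(1 - t) / √t) ^ 2 := by gcongr
      rw [husq t ht] at hu2
      set I := ∫ z, ‖SBD.pb ν (√(1 - t) / √t) z‖ ^ 2 * SBD.gd z
      have h1t : 0 < 1 - t := by linarith [ht.2]
      rw [le_div_iff₀ ht0] at hu2
      have hth : t ≤ 1 / 2 := by nlinarith
      have h2 : (d : ℝ) * ((1 - t) - 2 * L * t) * t ≤ (1 - t) ^ 2 * I := by
        have e1 : (1 - t) / t * I * (t * (1 - t)) = (1 - t) ^ 2 * I := by field_simp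
        have e2 : (d : ℝ) * (1 - 2 * L / ((1 - t) / t)) * (t * (1 - t)) = d * ((1 - t) - 2 * L * t) * t := by
          field_simp
        rw [← e1, ← e2]
        exact mul_le_mul_of_nonneg_right h1 (by positivity)
      have h3 : (d : ℝ) * t - 8 * d * L * t ^ 2 ≤ I := by
        have h5 : (1 - t) ^ 2 * (d * t - 8 * d * L * t ^ 2) ≤ (1 - t) ^ 2 * I := by
          refine le_trans ?_ h2
          have h6 : 0 ≤ (d:ℝ) * t ^ 2 * (1 - t) := by positivity
          have h7 : 0 ≤ (d:ℝ) * L * t ^ 2 * (4 * (1 - t) ^ 2 - 1) := by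
            have : 0 ≤ 4 * (1 - t) ^ 2 - 1 := by nlinarith
            positivity
          nlinarith
        exact le_of_mul_le_mul_left h5 (by positivity)
      have h4 : 1 / (2 * t ^ 2) * (d * t - 8 * d * L * t ^ 2) ≤ 1 / (2 * t ^ 2) * I := by gcongr
      have h5 : 1 / (2 * t ^ 2) * (d * t - 8 * d * L * t ^ 2) = d / (2 * t) - 4 * d * L := by
        field_simp
        ring
      have h6 : 4 * d * L * 1 ≤ 4 * d * L * (1 + U ^ 2) ^ 2 := by
        have : (1:ℝ) ≤ (1 + U ^ 2) ^ 2 := by nlinarith [sq_nonneg U]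
        gcongr
      have h7 : 0 ≤ (d:ℝ) * (1 + U ^ 2) := by positivity
      linarith
    · have hu2 : (√(1 - t) / √t) ^ 2 ≤ U ^ 2 := by
        have := (hupos t ht).le
        gcongr
      rw [husq t ht, div_le_iff₀ ht0] at hu2
      have h1 : (d : ℝ) / (2 * t) ≤ d * (1 + U ^ 2) := by
        rw [div_le_iff₀ (by positivity)]
        nlinarith
      have h2 : 0 ≤ 1 / (2 * t ^ 2) * ∫ z, ‖SBD.pb ν (√(1 - t) / √t) z‖ ^ 2 * SBD.gd z := by positivity
      have h3 : 0 ≤ 4 * d * L * (1 + U ^ 2) ^ 2 := by positivity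
      linarith
  obtain ⟨C, hC⟩ := hD
  have hev0 : ∀ᶠ t : ℝ in nhdsWithin 0 (Set.Ioi 0), t ∈ Set.Ioo (0:ℝ) 1 := Ioo_mem_nhdsGT one_pos
  have hev1 : ∀ᶠ t : ℝ in nhdsWithin 1 (Set.Iio 1), t ∈ Set.Ioo (0:ℝ) 1 := Ioo_mem_nhdsLT one_pos
  have h1 : Tendsto (fun t => SBD.Gt ν (√(1 - t) / √t) - (d : ℝ) / 2 * Real.log t)
      (nhdsWithin 1 (Set.Iio 1)) (nhds 0) := by
    have hu : Tendsto (fun t : ℝ => √(1 - t) / √t) (nhdsWithin 1 (Set.Iio 1)) (nhdsWithin 0 (Set.Ioi 0)) := by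
      refine tendsto_nhdsWithin_iff.2 ⟨?_, hev1.mono fun t ht => hupos t ht⟩
      have : ContinuousAt (fun t : ℝ => √(1 - t) / √t) 1 := by
        refine ContinuousAt.div (by fun_prop) (by fun_prop) (by simp)
      have := this.tendsto
      simp only [sub_self, Real.sqrt_zero, zero_div] at this
      exact this.mono_left nhdsWithin_le_nhds
    have hl : Tendsto (fun t : ℝ => (d : ℝ) / 2 * Real.log t) (nhdsWithin 1 (Set.Iio 1)) (nhds 0) := by
      have := ((Real.continuousAt_log one_ne_zero).tendsto.const_mul ((d : ℝ) / 2))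
      simp only [Real.log_one, mul_zero] at this
      exact this.mono_left nhdsWithin_le_nhds
    have := (hzero.comp hu).sub hl
    simpa using this
  have h0 : Tendsto (fun t => SBD.Gt ν (√(1 - t) / √t) - (d : ℝ) / 2 * Real.log t)
      (nhdsWithin 0 (Set.Ioi 0)) (nhds ((d : ℝ) / 2 + (d : ℝ) / 2 * Real.log (2 * π) + Real.log (ρ₀ x₀))) := by
    have hu : Tendsto (fun t : ℝ => √(1 - t) / √t) (nhdsWithin 0 (Set.Ioi 0)) atTop := by
      have ha : Tendsto (fun t : ℝ => √(1 - t)) (nhdsWithin 0 (Set.Ioi 0)) (nhds 1) := by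
        have : ContinuousAt (fun t : ℝ => √(1 - t)) 0 := by fun_prop
        have := this.tendsto
        simp only [sub_zero, Real.sqrt_one] at this
        exact this.mono_left nhdsWithin_le_nhds
      have hb : Tendsto (fun t : ℝ => (√t)⁻¹) (nhdsWithin 0 (Set.Ioi 0)) atTop := by
        refine Tendsto.inv_tendsto_nhdsGT_zero ?_
        refine tendsto_nhdsWithin_iff.2 ⟨?_, hev0.mono fun t ht => Real.sqrt_pos.2 ht.1⟩
        have := (Real.continuous_sqrt.tendsto 0)
        simp only [Real.sqrt_zero] at this
        exact this.mono_left nhdsWithin_le_nhds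
      simpa only [div_eq_mul_inv] using ha.pos_mul_atTop one_pos hb
    have hl : Tendsto (fun t : ℝ => (d : ℝ) / 2 * Real.log (1 - t)) (nhdsWithin 0 (Set.Ioi 0)) (nhds 0) := by
      have : ContinuousAt (fun t : ℝ => (d : ℝ) / 2 * Real.log (1 - t)) 0 := by
        refine ContinuousAt.mul (by fun_prop) (ContinuousAt.log (by fun_prop) (by simp))
      have := this.tendsto
      simp only [sub_zero, Real.log_one, mul_zero] at this
      exact this.mono_left nhdsWithin_le_nhds
    have hs := (htop.comp hu).sub hl
    rw [sub_zero] at hs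
    refine hs.congr' ?_
    filter_upwards [hev0] with t ht
    have h1t : 0 < 1 - t := by linarith [ht.2]
    simp only [Function.comp]
    rw [Real.log_div (Real.sqrt_pos.2 h1t).ne' (Real.sqrt_pos.2 ht.1).ne', Real.log_sqrt h1t.le,
      Real.log_sqrt ht.1.le]
    ring
  rw [SBD.ftc_limits hG hC h0 h1]
  ring
end
end
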